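/- arXiv:1609.08801 — 4 statements merged into one kernel-verified Lean document; each statement's English description precedes it below -/
import Mathlib

section
/- There exists a universal constant C > 0 such that for every weighted graph G = (V,E,w) on n vertices and every parameter 0 < ρ < 1, there exists a spanner H of G with lightness Ψ(H) ≤ 1 + ρ and coarse scaling distortion γ, where γ(ε) = (C/ρ) · log(2/ε) · (1 + log(1 + log(2/ε)))². -/
open Finset

attribute [local instance] Classical.propDecidable

section Defs

variable {V : Type*} [Fintype V]

/-- Total weight of a (sub)graph: the sum of its edge weights. -/
noncomputable def wWeight (H : SimpleGraph V) (w : Sym2 V → ℝ) : ℝ :=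
  ∑ e ∈ H.edgeSet.toFinite.toFinset, w e

/-- Shortest-path distance in a weighted graph: infimum of walk weights. -/
noncomputable def wdist (G : SimpleGraph V) (w : Sym2 V → ℝ) (u v : V) : ℝ :=
  sInf {x : ℝ | ∃ p : G.Walk u v, x = (p.edges.map w).sum}

/-- `T` is a spanning tree of `G`. -/
def IsSpanningTree (G T : SimpleGraph V) : Prop :=
  T ≤ G ∧ T.IsTree

/-- Weight of a minimum spanning tree of `G`. -/
noncomputable def mstWeight (G : SimpleGraph V) (w : Sym2 V → ℝ) : ℝ :=
  sInf {x : ℝ | ∃ T : SimpleGraph V, IsSpanningTree G T ∧ x = wWeight T w}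

/-- `T` is a minimum spanning tree of `G`. -/
def IsMST (G : SimpleGraph V) (w : Sym2 V → ℝ) (T : SimpleGraph V) : Prop :=
  IsSpanningTree G T ∧ ∀ T' : SimpleGraph V, IsSpanningTree G T' → wWeight T w ≤ wWeight T' w

/-- A spanner of `G`: a connected spanning subgraph. -/
def IsSpanner (G H : SimpleGraph V) : Prop := H ≤ G ∧ H.Connected

/-- `G` together with `w` is a weighted graph: connected, positive pairwise-distinct
edge weights. -/
def IsWeightedGraph (G : SimpleGraph V) (w : Sym2 V → ℝ) : Prop :=
  G.Connected ∧ (∀ e ∈ G.edgeSet, 0 < w e) ∧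
    (∀ e ∈ G.edgeSet, ∀ e' ∈ G.edgeSet, e ≠ e' → w e ≠ w e')

/-- The ordered pairs of distinct vertices whose distortion in `H` is at most `t`. -/
noncomputable def goodPairs (G H : SimpleGraph V) (w : Sym2 V → ℝ) (t : ℝ) : Finset (V × V) :=
  Finset.univ.offDiag.filter (fun p => wdist H w p.1 p.2 ≤ t * wdist G w p.1 p.2)

/-- Scaling distortion `γ`: for every `ε ∈ (0,1)`, at least a `(1-ε)` fraction of the
pairs of distinct vertices have distortion at most `γ ε`.  (Counted over ordered pairs:
`n·(n-1) = 2·(n choose 2)`.) -/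
def HasScalingDistortion (G H : SimpleGraph V) (w : Sym2 V → ℝ) (γ : ℝ → ℝ) : Prop :=
  ∀ ε : ℝ, 0 < ε → ε < 1 →
    (1 - ε) * ((Fintype.card V : ℝ) * ((Fintype.card V : ℝ) - 1)) ≤
      ((goodPairs G H w (γ ε)).card : ℝ)

/-- The `ℓ_q`-distortion of the spanner `H` of `G`. -/
noncomputable def distq (G H : SimpleGraph V) (w : Sym2 V → ℝ) (q : ℝ) : ℝ :=
  ((∑ p ∈ (Finset.univ : Finset V).offDiag, (wdist H w p.1 p.2 / wdist G w p.1 p.2) ^ q) /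
    ((Fintype.card V : ℝ) * ((Fintype.card V : ℝ) - 1))) ^ (1 / q)

/-- `R(v,ε)`: the minimal radius `r` such that the ball `B(v,r)` contains at least `εn`
vertices. -/
noncomputable def Rgraph (G : SimpleGraph V) (w : Sym2 V → ℝ) (v : V) (ε : ℝ) : ℝ :=
  sInf {r : ℝ | 0 ≤ r ∧
    ε * (Fintype.card V : ℝ) ≤ ((Finset.univ.filter (fun u => wdist G w u v ≤ r)).card : ℝ)}

/-- Coarse scaling distortion `γ`: every pair of distinct vertices that are mutually
`ε/2`-far has distortion at most `γ ε`. -/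
def HasCoarseScalingDistortion (G H : SimpleGraph V) (w : Sym2 V → ℝ) (γ : ℝ → ℝ) : Prop :=
  ∀ ε : ℝ, 0 < ε → ε < 1 → ∀ u v : V, u ≠ v →
    Rgraph G w v (ε / 2) ≤ wdist G w u v → Rgraph G w u (ε / 2) ≤ wdist G w u v →
    wdist H w u v ≤ γ ε * wdist G w u v

end Defs

/-! ### Packing vertex-disjoint stars -/

lemma exists_idempotent_of_leaves {J : Type*} [Fintype J] (L : SimpleGraph J) (A : Finset J)
    (c : J → J) (hc : ∀ j ∈ A, c j ∉ A) (hadj : ∀ j ∈ A, L.Adj j (c j))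
    (hlarge : ∀ j ∈ A, 3 ≤ #{i ∈ A | c i = c j}) :
    ∃ σ : J → J, (∀ j, σ (σ j) = σ j) ∧ (∀ j, σ j ≠ j → L.Adj j (σ j)) ∧
      (∀ j, σ j ≠ j → 3 ≤ #{i | σ i = σ j ∧ σ i ≠ i}) ∧ #A = #{j | σ j ≠ j} := by
  set σ : J → J := fun j => if j ∈ A then c j else j with hσ
  have hmem : ∀ j, σ j ≠ j ↔ j ∈ A := by
    intro j
    by_cases hj : j ∈ A
    · simpa [hσ, hj] using (hadj j hj).ne'
    · simp [hσ, hj]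
  have hval : ∀ j ∈ A, σ j = c j := fun j hj => by simp [hσ, hj]
  refine ⟨σ, fun j => ?_, fun j hj => ?_, fun j hj => ?_, ?_⟩
  · by_cases hj : j ∈ A
    · simp [hσ, hj, hc j hj]
    · simp [hσ, hj]
  · rw [hmem] at hj
    rw [hval j hj]
    exact hadj j hj
  · rw [hmem] at hj
    refine (hlarge j hj).trans (Finset.card_le_card fun i hi => ?_)
    rw [Finset.mem_filter] at hi
    simp only [Finset.mem_filter, Finset.mem_univ, true_and, hmem]
    exact ⟨by rw [hval i hi.1, hval j hj, hi.2], hi.1⟩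
  · congr 1
    ext j
    simp [hmem]

lemma exists_star_packing {J : Type*} [Fintype J] (L : SimpleGraph J) (M : Finset J)
    (hM : ∀ v ∈ M, 3 ≤ #{u | L.Adj v u}) :
    ∃ σ : J → J, (∀ j, σ (σ j) = σ j) ∧ (∀ j, σ j ≠ j → L.Adj j (σ j)) ∧
      (∀ j, σ j ≠ j → 3 ≤ #{i | σ i = σ j ∧ σ i ≠ i}) ∧ #M ≤ 5 * #{j | σ j ≠ j} := by
  set P : Finset J → Prop := fun S => ∀ s ∈ S, ∀ s' ∈ S, s ≠ s' →
    ∀ x, ¬ ((x = s ∨ L.Adj s x) ∧ (x = s' ∨ L.Adj s' x)) with hP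
  obtain ⟨S, hS, hmax⟩ := Finset.exists_max_image (M.powerset.filter P) Finset.card
    ⟨∅, by simp [hP]⟩
  rw [Finset.mem_filter, Finset.mem_powerset] at hS
  obtain ⟨hSM, hSP⟩ := hS
  set NS : Finset J := {u | ∃ s ∈ S, L.Adj s u} with hNS
  have hcA : ∀ u, ∃ s, u ∈ NS → s ∈ S ∧ L.Adj s u := by
    intro u
    by_cases hu : u ∈ NS
    · simp only [hNS, Finset.mem_filter, Finset.mem_univ, true_and] at hu
      obtain ⟨s, hs⟩ := hu
      exact ⟨s, fun _ => hs⟩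
    · exact ⟨u, fun h => absurd h hu⟩
  choose c hc using hcA
  have hSNS : ∀ s ∈ S, s ∉ NS := by
    intro s hs hs'
    obtain ⟨h1, h2⟩ := hc s hs'
    exact hSP s hs _ h1 h2.ne' s ⟨Or.inl rfl, Or.inr h2⟩
  have huniq : ∀ s ∈ S, ∀ u, L.Adj s u → c u = s := by
    intro s hs u hu
    have huN : u ∈ NS := by
      simp only [hNS, Finset.mem_filter, Finset.mem_univ, true_and]
      exact ⟨s, hs, hu⟩
    by_contra hne
    exact hSP _ (hc u huN).1 s hs hne u ⟨Or.inr (hc u huN).2, Or.inr hu⟩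
  obtain ⟨σA, hA1, hA2, hA3, hA4⟩ := exists_idempotent_of_leaves L NS c
    (fun j hj => hSNS _ (hc j hj).1) (fun j hj => (hc j hj).2.symm) (fun j hj => by
      refine (hM _ (hSM (hc j hj).1)).trans (Finset.card_le_card fun u hu => ?_)
      simp only [Finset.mem_filter, Finset.mem_univ, true_and] at hu ⊢
      refine ⟨?_, huniq _ (hc j hj).1 u hu⟩
      simp only [hNS, Finset.mem_filter, Finset.mem_univ, true_and]
      exact ⟨_, (hc j hj).1, hu⟩)
  have hScard : #S ≤ #NS := by
    refine Finset.card_le_card_of_surjOn c fun s hs => ?_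
    have h3 := hM s (hSM hs)
    obtain ⟨u, hu⟩ := Finset.card_pos.mp (by omega : 0 < #{u | L.Adj s u})
    simp only [Finset.mem_filter, Finset.mem_univ, true_and] at hu
    refine ⟨u, ?_, huniq s hs u hu⟩
    simp only [hNS, Finset.coe_filter, Finset.mem_univ, true_and]
    exact ⟨s, hs, hu⟩
  set W : Finset J := M \ (S ∪ NS) with hW
  have hl : ∀ v, ∃ x, v ∈ W → x ∈ NS ∧ L.Adj v x := by
    intro v
    by_cases hv : v ∈ W
    · simp only [hW, Finset.mem_sdiff, Finset.mem_union, not_or] at hv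
      obtain ⟨hvM, hvS, hvN⟩ := hv
      have hnot : ¬ P (insert v S) := by
        intro hPv
        have := hmax (insert v S) (by
          rw [Finset.mem_filter, Finset.mem_powerset]
          exact ⟨Finset.insert_subset hvM hSM, hPv⟩)
        rw [Finset.card_insert_of_notMem hvS] at this
        omega
      have hex : ∃ s ∈ S, ∃ x, (x = s ∨ L.Adj s x) ∧ (x = v ∨ L.Adj v x) := by
        by_contra hno
        push Not at hno
        refine hnot fun s hs s' hs' hne x hx => ?_
        rw [Finset.mem_insert] at hs hs'
        rcases hs with rfl | hs <;> rcases hs' with rfl | hs'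
        · exact hne rfl
        · rcases hx.1 with h | h
          · exact (hno s' hs' x hx.2).1 h
          · exact (hno s' hs' x hx.2).2 h
        · rcases hx.2 with h | h
          · exact (hno s hs x hx.1).1 h
          · exact (hno s hs x hx.1).2 h
        · exact hSP s hs s' hs' hne x hx
      obtain ⟨s, hs, x, hx1, hx2⟩ := hex
      have hNSmem : ∀ y, L.Adj s y → y ∈ NS := fun y hy => by
        simp only [hNS, Finset.mem_filter, Finset.mem_univ, true_and]
        exact ⟨s, hs, hy⟩
      refine ⟨x, fun _ => ?_⟩
      rcases hx1 with rfl | hx1 <;> rcases hx2 with rfl | hx2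
      · exact absurd hs hvS
      · exact absurd (hNSmem v hx2.symm) hvN
      · exact absurd (hNSmem _ hx1) hvN
      · exact ⟨hNSmem x hx1, hx2⟩
    · exact ⟨v, fun h => absurd h hv⟩
  choose l hl using hl
  set A : Finset J := W.filter fun v => 3 ≤ #{i ∈ W | l i = l v} with hA
  obtain ⟨σB, hB1, hB2, hB3, hB4⟩ := exists_idempotent_of_leaves L A l
    (fun j hj hj' => by
      rw [hA, Finset.mem_filter] at hj hj'
      have h1 := (hl j hj.1).1
      have h2 := hj'.1
      simp only [hW, Finset.mem_sdiff, Finset.mem_union, not_or] at h2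
      exact h2.2.2 h1)
    (fun j hj => by
      rw [hA, Finset.mem_filter] at hj
      exact (hl j hj.1).2)
    (fun j hj => by
      have hj' := hj
      rw [hA, Finset.mem_filter] at hj'
      refine hj'.2.trans (Finset.card_le_card fun i hi => ?_)
      rw [Finset.mem_filter] at hi ⊢
      refine ⟨?_, hi.2⟩
      rw [hA, Finset.mem_filter, hi.2]
      exact ⟨hi.1, hj'.2⟩)
  have hWA : #(W \ A) ≤ 2 * #NS := by
    refine Finset.card_le_mul_card_image_of_maps_to (f := l) (fun v hv => ?_) 2 fun x _ => ?_
    · exact (hl v (Finset.mem_sdiff.mp hv).1).1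
    · by_contra hgt
      push Not at hgt
      obtain ⟨v, hv⟩ := Finset.card_pos.mp (by omega : 0 < #{a ∈ W \ A | l a = x})
      rw [Finset.mem_filter, Finset.mem_sdiff, hA, Finset.mem_filter, not_and] at hv
      refine hv.1.2 hv.1.1 (hgt.trans_le (Finset.card_le_card fun i hi => ?_))
      rw [Finset.mem_filter, Finset.mem_sdiff] at hi
      rw [Finset.mem_filter]
      exact ⟨hi.1.1, hi.2.trans hv.2.symm⟩
  have hWcard : #W ≤ #(W \ A) + #A := by
    have := Finset.card_sdiff_add_card W A
    have := Finset.card_le_card (Finset.subset_union_left (s₁ := W) (s₂ := A))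
    omega
  have hMcard : #M ≤ #W + (#S + #NS) := by
    have h1 := Finset.card_sdiff_add_card M (S ∪ NS)
    rw [← hW] at h1
    have h2 := Finset.card_le_card (Finset.subset_union_left (s₁ := M) (s₂ := S ∪ NS))
    have h3 := Finset.card_union_le S NS
    omega
  by_cases hcmp : #NS ≤ #A
  · exact ⟨σB, hB1, hB2, hB3, by omega⟩
  · exact ⟨σA, hA1, hA2, hA3, by omega⟩

/-! ### Graphs without short cycles are sparse -/

/-- In a graph without cycles of length at most `2 * r + 1`, the number of edges inside a ball of
radius `r` is at most the number of vertices of that ball. -/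
lemma card_edges_ball_le {J : Type*} [Fintype J] {Θ : SimpleGraph J} {r : ℕ}
    (hcyc : ∀ (u : J) (c : Θ.Walk u u), c.IsCycle → 2 * r + 1 < c.length) (v : J) (B : Finset J)
    (hB : ∀ u ∈ B, ∃ p : Θ.Walk u v, p.length ≤ r) (F : Finset (Sym2 J))
    (hF : ∀ e ∈ F, e ∈ Θ.edgeSet) (hFB : ∀ x y, s(x, y) ∈ F → x ∈ B ∧ y ∈ B) : #F ≤ #B := by
  have hpar : ∀ u, ∃ p, Θ.Reachable u v → u ≠ v →
      Θ.Adj u p ∧ ∃ q : Θ.Walk p v, q.length + 1 = Θ.dist u v := by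
    intro u
    by_cases hu : Θ.Reachable u v
    · obtain ⟨p, hp⟩ := hu.exists_walk_length_eq_dist
      cases p with
      | nil => exact ⟨v, fun _ h => absurd rfl h⟩
      | cons h q => exact ⟨_, fun _ _ => ⟨h, q, by simpa using hp⟩⟩
    · exact ⟨u, fun h => absurd h hu⟩
  choose par hpar using hpar
  let Tr : SimpleGraph J :=
    { Adj := fun x y => Θ.Adj x y ∧ (par x = y ∨ par y = x)
      symm := ⟨fun x y h => ⟨h.1.symm, h.2.symm⟩⟩
      loopless := ⟨fun x h => Θ.loopless.irrefl x h.1⟩ }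
  have hle : Tr ≤ Θ := fun x y h => h.1
  have hwalk : ∀ n u, Θ.Reachable u v → Θ.dist u v ≤ n → ∃ q : Tr.Walk u v, q.length ≤ n := by
    intro n
    induction n with
    | zero =>
      intro u hu hd
      have : u = v := (hu.dist_eq_zero_iff).mp (by omega)
      subst this
      exact ⟨.nil, by simp⟩
    | succ n ih =>
      intro u hu hd
      by_cases huv : u = v
      · subst huv
        exact ⟨.nil, by simp⟩
      · obtain ⟨hadj, q, hq⟩ := hpar u hu huv
        have hdist := SimpleGraph.dist_le q
        obtain ⟨q', hq'⟩ := ih (par u) ⟨q⟩ (by omega)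
        exact ⟨.cons (show Tr.Adj u (par u) from ⟨hadj, Or.inl rfl⟩) q', by simpa using hq'⟩
  have hwalkB : ∀ u ∈ B, ∃ q : Tr.Walk u v, q.length ≤ r := fun u hu => by
    obtain ⟨p, hp⟩ := hB u hu
    exact hwalk r u ⟨p⟩ ((SimpleGraph.dist_le p).trans hp)
  have hsub : F ⊆ B.image fun u => s(u, par u) := by
    intro e
    induction e with
    | _ x y =>
    intro he
    have hxy : Θ.Adj x y := hF _ he
    obtain ⟨hx, hy⟩ := hFB x y he
    by_contra hnot
    simp only [Finset.mem_image, not_exists, not_and] at hnot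
    have hnx : par x ≠ y := fun h => hnot x hx (by rw [h])
    have hny : par y ≠ x := fun h => hnot y hy (by rw [h, Sym2.eq_swap])
    obtain ⟨p, hp⟩ := hwalkB x hx
    obtain ⟨q, hq⟩ := hwalkB y hy
    have hlen : (q.append p.reverse).bypass.length ≤ 2 * r := by
      refine ((q.append p.reverse).length_bypass_le_length).trans ?_
      rw [SimpleGraph.Walk.length_append, SimpleGraph.Walk.length_reverse]
      omega
    set W := (q.append p.reverse).bypass with hW
    have hWp : W.IsPath := SimpleGraph.Walk.bypass_isPath _
    have hedge : s(x, y) ∉ (W.mapLe hle).edges := by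
      intro hmem
      rw [SimpleGraph.Walk.edges_mapLe_eq_edges] at hmem
      have : Tr.Adj x y := W.adj_of_mem_edges hmem
      rcases this.2 with h | h
      · exact hnx h
      · exact hny h
    have hcycle := (SimpleGraph.Walk.cons_isCycle_iff (W.mapLe hle) hxy).mpr
      ⟨hWp.mapLe hle, hedge⟩
    have := hcyc _ _ hcycle
    rw [SimpleGraph.Walk.length_cons] at this
    simp at this
    omega
  exact (Finset.card_le_card hsub).trans Finset.card_image_le

/-- A graph with at most `2 ^ k` vertices of positive degree and no cycle of length at most
`2 * k + 3` has at most twice as many edges as vertices of positive degree. -/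
lemma card_edges_le_of_no_short_cycle {J : Type*} [Fintype J] {k : ℕ} (S : Finset J)
    (hS : #S ≤ 2 ^ k) (Θ : SimpleGraph J) (hΘS : ∀ x y, Θ.Adj x y → x ∈ S)
    (hcyc : ∀ (u : J) (c : Θ.Walk u u), c.IsCycle → 2 * k + 3 < c.length)
    (F : Finset (Sym2 J)) (hF : ∀ e ∈ F, e ∈ Θ.edgeSet) : #F ≤ 2 * #S := by
  induction hn : #S using Nat.strong_induction_on generalizing S Θ F with
  | _ n ih =>
  rcases S.eq_empty_or_nonempty with rfl | ⟨v, hv⟩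
  · have : F = ∅ := by
      refine Finset.eq_empty_of_forall_notMem fun e => ?_
      induction e with
      | _ x y =>
      intro he
      exact absurd (hΘS x y (hF _ he)) (by simp)
    simp [this]
  · set B : ℕ → Finset J := fun r => {u | ∃ p : Θ.Walk u v, p.length ≤ r} with hBdef
    have hmemB : ∀ r u, u ∈ B r ↔ ∃ p : Θ.Walk u v, p.length ≤ r := by
      intro r u
      simp [hBdef]
    have hvB : ∀ r, v ∈ B r := fun r => (hmemB r v).mpr ⟨.nil, by simp⟩
    have hBS : ∀ r, B r ⊆ S := by
      intro r u hu
      obtain ⟨p, -⟩ := (hmemB r u).mp hu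
      cases p with
      | nil => exact hv
      | cons h _ => exact hΘS _ _ h
    obtain ⟨r, hrk, hr⟩ : ∃ r ≤ k, #(B (r + 1)) ≤ 2 * #(B r) := by
      by_contra hno
      push Not at hno
      have hgrow : ∀ r ≤ k + 1, 2 ^ r ≤ #(B r) := by
        intro r
        induction r with
        | zero => exact fun _ => Finset.card_pos.mpr ⟨v, hvB 0⟩
        | succ r ihr =>
          intro hrk
          have h1 := ihr (by omega)
          have h2 := hno r (by omega)
          rw [pow_succ]
          omega
      have h1 := hgrow (k + 1) le_rfl
      have h2 := Finset.card_le_card (hBS (k + 1))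
      have h3 : 0 < 2 ^ k := by positivity
      rw [pow_succ] at h1
      omega
    set F₁ : Finset (Sym2 J) := F.filter fun e => ∃ x ∈ e, x ∈ B r with hF₁
    set F₂ : Finset (Sym2 J) := F.filter fun e => ¬ ∃ x ∈ e, x ∈ B r with hF₂
    have hstep : ∀ x y, Θ.Adj x y → x ∈ B r → y ∈ B (r + 1) := by
      intro x y hxy hx
      obtain ⟨p, hp⟩ := (hmemB r x).mp hx
      exact (hmemB _ y).mpr ⟨.cons hxy.symm p, by simpa using hp⟩
    have hBmono : B r ⊆ B (r + 1) := by
      intro u hu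
      obtain ⟨p, hp⟩ := (hmemB r u).mp hu
      exact (hmemB _ u).mpr ⟨p, by omega⟩
    have hc₁ : #F₁ ≤ #(B (r + 1)) := by
      refine card_edges_ball_le (r := r + 1) (fun u c hc => ?_) v _
        (fun u hu => (hmemB _ u).mp hu) F₁ (fun e he => hF e (Finset.mem_filter.mp he).1) ?_
      · have := hcyc u c hc
        omega
      · intro x y he
        obtain ⟨heF, z, hz, hzB⟩ := Finset.mem_filter.mp he
        have hxy : Θ.Adj x y := hF _ heF
        rcases Sym2.mem_iff.mp hz with rfl | rfl
        · exact ⟨hBmono hzB, hstep _ _ hxy hzB⟩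
        · exact ⟨hstep _ _ hxy.symm hzB, hBmono hzB⟩
    let Θ' : SimpleGraph J :=
      { Adj := fun x y => Θ.Adj x y ∧ x ∉ B r ∧ y ∉ B r
        symm := ⟨fun x y h => ⟨h.1.symm, h.2.2, h.2.1⟩⟩
        loopless := ⟨fun x h => Θ.loopless.irrefl x h.1⟩ }
    have hle : Θ' ≤ Θ := fun x y h => h.1
    have hSB := Finset.card_sdiff_add_card_eq_card (hBS r)
    have hBpos := Finset.card_pos.mpr ⟨v, hvB r⟩
    have hc₂ := ih #(S \ B r) (by omega) (S \ B r) (by omega) Θ'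
      (fun x y h => Finset.mem_sdiff.mpr ⟨hΘS x y h.1, h.2.1⟩)
      (fun u c hc => by
        have := hcyc u _ (hc.mapLe hle)
        simpa using this) F₂
      (fun e => by
        induction e with
        | _ x y =>
        intro he
        obtain ⟨heF, hno⟩ := Finset.mem_filter.mp he
        push Not at hno
        exact ⟨hF _ heF, hno x (by simp), hno y (by simp)⟩) rfl
    have hsum := Finset.card_filter_add_card_filter_not (s := F) (fun e => ∃ x ∈ e, x ∈ B r)
    rw [← hF₁, ← hF₂] at hsum
    omega
/-! ### Travel costs on a line with shortcuts -/

/-- `LineConn pos m E s s' r`: one can travel from the real number `s` to `s'` at cost at most `r`,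
moving along the real line at unit cost per length, and jumping between `pos x` and `pos y` at
cost `m s(x, y)` whenever `s(x, y) ∈ E`. -/
inductive LineConn {V : Type*} (pos : V → ℝ) (m : Sym2 V → ℝ) (E : Finset (Sym2 V)) (s : ℝ) :
    ℝ → ℝ → Prop
  | walk {s' r : ℝ} : |s - s'| ≤ r → LineConn pos m E s s' r
  | jump {s' r r₁ : ℝ} {x y : V} : LineConn pos m E s (pos x) r₁ → s(x, y) ∈ E →
      r₁ + m s(x, y) + |pos y - s'| ≤ r → LineConn pos m E s s' r

namespace LineConn

variable {V : Type*} {pos : V → ℝ} {m : Sym2 V → ℝ} {E E' : Finset (Sym2 V)}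

lemma mono_cost {s s' r r' : ℝ} (h : LineConn pos m E s s' r) (hr : r ≤ r') :
    LineConn pos m E s s' r' := by
  cases h with
  | walk h => exact walk (h.trans hr)
  | jump h he hle => exact jump h he (hle.trans hr)

lemma mono_edges {s s' r : ℝ} (h : LineConn pos m E s s' r) (hE : E ⊆ E') :
    LineConn pos m E' s s' r := by
  induction h with
  | walk h => exact walk h
  | jump _ he hle ih => exact jump ih (hE he) hle

lemma refl (s : ℝ) {r : ℝ} (hr : 0 ≤ r) : LineConn pos m E s s r :=
  walk (by simpa using hr)

lemma extend {s s' r : ℝ} (h : LineConn pos m E s s' r) (s'' : ℝ) :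
    LineConn pos m E s s'' (r + |s' - s''|) := by
  cases h with
  | walk h => exact walk (by have := abs_sub_le s s' s''; linarith)
  | @jump _ _ _ x y h he hle =>
    exact jump h he (by have := abs_sub_le (pos y) s' s''; linarith)

lemma trans {s s' s'' r r' : ℝ} (h : LineConn pos m E s s' r) (h' : LineConn pos m E s' s'' r') :
    LineConn pos m E s s'' (r + r') := by
  induction h' with
  | walk h' => exact (h.extend _).mono_cost (by linarith)
  | jump _ he hle ih => exact jump ih he (by linarith)

lemma of_mem {x y : V} (he : s(x, y) ∈ E) : LineConn pos m E (pos x) (pos y) (m s(x, y)) :=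
  jump (refl _ le_rfl) he (by simp)

lemma symm {s s' r : ℝ} (h : LineConn pos m E s s' r) : LineConn pos m E s' s r := by
  induction h with
  | walk h => exact walk (by rwa [abs_sub_comm])
  | @jump s' r r₁ x y h he hle ih =>
    have h1 : LineConn pos m E s' (pos y) |pos y - s'| := walk (by rw [abs_sub_comm])
    have h2 : LineConn pos m E (pos y) (pos x) (m s(x, y)) := by
      rw [Sym2.eq_swap] at he ⊢
      exact of_mem he
    exact ((h1.trans h2).trans ih).mono_cost (by linarith)

end LineConn

/-! ### Covers of the line by cheap pieces -/

/-- The graph in which two indices are adjacent when the corresponding sets meet. -/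
def touchGraph {J : Type*} (C : J → Set ℝ) : SimpleGraph J where
  Adj j k := j ≠ k ∧ (C j ∩ C k).Nonempty
  symm := ⟨fun j k h => ⟨h.1.symm, by rw [Set.inter_comm]; exact h.2⟩⟩
  loopless := ⟨fun j h => h.1 rfl⟩

/-- A connected family of sets `C j` of travel diameter at most `φ j`, such that every `pos x` is
at travel distance at most `K` from one of the sets. -/
structure IsCover {V J : Type*} (pos : V → ℝ) (m : Sym2 V → ℝ) (E : Finset (Sym2 V))
    (C : J → Set ℝ) (φ : J → ℝ) (K : ℝ) : Prop where
  nonneg : ∀ j, 0 ≤ φ j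
  conn : ∀ j, ∀ s ∈ C j, ∀ s' ∈ C j, LineConn pos m E s s' (φ j)
  near : ∀ x, ∃ j, ∃ s ∈ C j, LineConn pos m E (pos x) s K
  connected : (touchGraph C).Connected

section Cover

variable {V : Type*} {pos : V → ℝ} {m : Sym2 V → ℝ} {E E' : Finset (Sym2 V)}

lemma IsCover.mono {J : Type*} {C : J → Set ℝ} {φ : J → ℝ} {K K' : ℝ}
    (h : IsCover pos m E C φ K) (hE : E ⊆ E') (hK : K ≤ K') : IsCover pos m E' C φ K' where
  nonneg := h.nonneg
  conn j s hs s' hs' := (h.conn j s hs s' hs').mono_edges hE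
  near x := by
    obtain ⟨j, s, hs, hc⟩ := h.near x
    exact ⟨j, s, hs, (hc.mono_edges hE).mono_cost hK⟩
  connected := h.connected

lemma IsCover.map {J J' : Type*} {C : J → Set ℝ} {φ : J → ℝ} {K : ℝ}
    (h : IsCover pos m E C φ K) (hE : E ⊆ E') {C' : J' → Set ℝ} {φ' : J' → ℝ} {K' : ℝ}
    (π : J → J') (hπ : Function.Surjective π)
    (hadj : ∀ j k, (touchGraph C).Adj j k → π j ≠ π k → (C' (π j) ∩ C' (π k)).Nonempty)
    (hnonneg : ∀ j, 0 ≤ φ' j)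
    (hconn : ∀ j, ∀ s ∈ C' j, ∀ s' ∈ C' j, LineConn pos m E' s s' (φ' j))
    (hnear : ∀ j, ∀ s ∈ C j, ∃ s' ∈ C' (π j), LineConn pos m E' s s' (K' - K)) :
    IsCover pos m E' C' φ' K' where
  nonneg := hnonneg
  conn := hconn
  near x := by
    obtain ⟨j, s, hs, hc⟩ := h.near x
    obtain ⟨s', hs', hc'⟩ := hnear j s hs
    exact ⟨π j, s', hs', ((hc.mono_edges hE).trans hc').mono_cost (by linarith)⟩
  connected := by
    have hreach : ∀ j k, (touchGraph C).Reachable j k →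
        (touchGraph C').Reachable (π j) (π k) := by
      rintro j k ⟨p⟩
      induction p with
      | nil => exact SimpleGraph.Reachable.refl _
      | @cons u v w huv p ih =>
        by_cases heq : π u = π v
        · rw [heq]; exact ih
        · exact (SimpleGraph.Adj.reachable
            (show (touchGraph C').Adj (π u) (π v) from ⟨heq, hadj u v huv heq⟩)).trans ih
    have := h.connected.nonempty
    have : Nonempty J' := Nonempty.map π inferInstance
    refine ⟨fun a b => ?_⟩
    obtain ⟨j, rfl⟩ := hπ a
    obtain ⟨k, rfl⟩ := hπ b
    exact hreach j k (h.connected.preconnected j k)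

/-- Merging the sets of a cover along the fibers of an idempotent map. -/
lemma IsCover.merge {J : Type*} {C : J → Set ℝ} {φ : J → ℝ} {K : ℝ}
    (h : IsCover pos m E C φ K) (hE : E ⊆ E') (σ : J → J) (hσ : ∀ j, σ (σ j) = σ j)
    (φ' : J → ℝ) (hnonneg : ∀ z, σ z = z → 0 ≤ φ' z)
    (hconn : ∀ j k, σ j = σ k → ∀ s ∈ C j, ∀ s' ∈ C k, LineConn pos m E' s s' (φ' (σ j))) :
    IsCover pos m E' (fun z : {j // σ j = j} => ⋃ j ∈ {j | σ j = z.1}, C j)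
      (fun z => φ' z.1) K := by
  refine h.map hE (fun j => ⟨σ j, hσ j⟩) ?_ ?_ (fun z => hnonneg _ z.2) ?_ ?_
  · rintro ⟨z, hz⟩
    exact ⟨z, by simp [hz]⟩
  · rintro j k ⟨-, s, hs, hs'⟩ -
    exact ⟨s, Set.mem_biUnion (x := j) rfl hs, Set.mem_biUnion (x := k) rfl hs'⟩
  · rintro ⟨z, hz⟩ s hs s' hs'
    simp only [Set.mem_ofPred_eq, Set.mem_iUnion, exists_prop] at hs hs'
    obtain ⟨j, hj, hs⟩ := hs
    obtain ⟨k, hk, hs'⟩ := hs'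
    have := hconn j k (hj.trans hk.symm) s hs s' hs'
    rwa [hj] at this
  · intro j s hs
    exact ⟨s, Set.mem_biUnion (x := j) rfl hs, LineConn.refl _ (by simp)⟩

lemma sum_fixed_fiber {J : Type*} [Fintype J] (σ : J → J) (hσ : ∀ j, σ (σ j) = σ j) (g : J → ℝ) :
    ∑ z : {j // σ j = j}, ∑ j with σ j = z.1, g j = ∑ j, g j := by
  rw [← Finset.sum_fiberwise (Finset.univ : Finset J) (fun j => (⟨σ j, hσ j⟩ : {j // σ j = j})) g]
  refine Finset.sum_congr rfl fun z _ => Finset.sum_congr ?_ fun _ _ => rfl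
  ext j
  simp [Subtype.ext_iff]

/-- Travelling inside a star whose leaves are linked to its centre at cost at most `θ`. -/
lemma IsCover.star_conn {J : Type*} {C : J → Set ℝ} {φ : J → ℝ} {K θ : ℝ}
    (h : IsCover pos m E C φ K) (hE : E ⊆ E') (hθ : 0 ≤ θ) {j k z : J}
    (hj : j ≠ z → ∃ p ∈ C j, ∃ q ∈ C z, LineConn pos m E' p q θ)
    (hk : k ≠ z → ∃ p ∈ C k, ∃ q ∈ C z, LineConn pos m E' p q θ)
    {s s' : ℝ} (hs : s ∈ C j) (hs' : s' ∈ C k) :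
    LineConn pos m E' s s' (∑ i ∈ {j, k, z}, φ i + 2 * θ) := by
  have hc : ∀ j, ∀ s ∈ C j, ∀ s' ∈ C j, LineConn pos m E' s s' (φ j) :=
    fun j s hs s' hs' => (h.conn j s hs s' hs').mono_edges hE
  have hsum : ∀ T : Finset J, T ⊆ {j, k, z} → ∑ i ∈ T, φ i ≤ ∑ i ∈ {j, k, z}, φ i :=
    fun T hT => Finset.sum_le_sum_of_subset_of_nonneg hT fun i _ _ => h.nonneg i
  by_cases hjk : j = k
  · subst hjk
    refine (hc j s hs s' hs').mono_cost ?_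
    have := hsum {j} (by simp)
    rw [Finset.sum_singleton] at this
    linarith
  by_cases hjz : j = z
  · subst hjz
    obtain ⟨p, hp, q, hq, hpq⟩ := hk (Ne.symm hjk)
    refine (((hc _ s hs q hq).trans hpq.symm).trans (hc _ p hp s' hs')).mono_cost ?_
    have := hsum {j, k} (by intro i; simp; tauto)
    rw [Finset.sum_pair hjk] at this
    linarith
  by_cases hkz : k = z
  · subst hkz
    obtain ⟨p, hp, q, hq, hpq⟩ := hj hjk
    refine (((hc _ s hs p hp).trans hpq).trans (hc _ q hq s' hs')).mono_cost ?_
    have := hsum {j, k} (by intro i; simp)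
    rw [Finset.sum_pair hjk] at this
    linarith
  obtain ⟨p, hp, q, hq, hpq⟩ := hj hjz
  obtain ⟨p', hp', q', hq', hpq'⟩ := hk hkz
  refine (((((hc _ s hs p hp).trans hpq).trans (hc _ q hq q' hq')).trans hpq'.symm).trans
    (hc _ p' hp' s' hs')).mono_cost ?_
  have : ∑ i ∈ {j, k, z}, φ i = φ j + (φ k + φ z) := by
    rw [Finset.sum_insert (by simp [hjk, hjz]), Finset.sum_pair hkz]
  linarith

lemma sum_triple_le {J : Type*} {φ : J → ℝ} {a b c : ℝ} {j k z : J} (hnonneg : ∀ i, 0 ≤ φ i)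
    (hj : φ j ≤ a) (hk : φ k ≤ b) (hz : φ z ≤ c) : ∑ i ∈ {j, k, z}, φ i ≤ a + b + c := by
  have h1 : ∀ (x : J) (s : Finset J), ∑ i ∈ insert x s, φ i ≤ φ x + ∑ i ∈ s, φ i := by
    intro x s
    by_cases hx : x ∈ s
    · rw [Finset.insert_eq_of_mem hx]
      have := hnonneg x
      linarith
    · rw [Finset.sum_insert hx]
  have h2 := h1 j {k, z}
  have h3 := h1 k {z}
  rw [Finset.sum_singleton] at h3
  linarith

/-- Merging stars of touching sets. -/
lemma IsCover.merge_touching {J : Type*} {C : J → Set ℝ} {φ : J → ℝ} {K : ℝ}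
    (h : IsCover pos m E C φ K) (σ : J → J) (hσ : ∀ j, σ (σ j) = σ j)
    (hadj : ∀ j, σ j ≠ j → (touchGraph C).Adj j (σ j)) (φ' : J → ℝ)
    (hφ' : ∀ j k, σ j = σ k → ∑ i ∈ {j, k, σ j}, φ i ≤ φ' (σ j)) :
    IsCover pos m E (fun z : {j // σ j = j} => ⋃ j ∈ {j | σ j = z.1}, C j)
      (fun z => φ' z.1) K := by
  have hlink : ∀ j, j ≠ σ j → ∃ p ∈ C j, ∃ q ∈ C (σ j), LineConn pos m E p q 0 := by
    intro j hj
    obtain ⟨-, p, hp, hp'⟩ := hadj j hj.symm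
    exact ⟨p, hp, p, hp', LineConn.refl _ le_rfl⟩
  refine h.merge subset_rfl σ hσ φ' (fun z hz => ?_) fun j k hjk s hs s' hs' => ?_
  · have := hφ' z z rfl
    rw [hz] at this
    exact (Finset.sum_nonneg fun i _ => h.nonneg i).trans this
  · refine (h.star_conn subset_rfl le_rfl (hlink j) (by rw [hjk]; exact hlink k) hs
      hs').mono_cost ?_
    have := hφ' j k hjk
    linarith

/-- Any cover can be coarsened so that all its pieces have comparable size. -/
lemma IsCover.coarsen {K a : ℝ} (ha : 0 < a) {J : Type} [Fintype J] {C : J → Set ℝ} {φ : J → ℝ}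
    (h : IsCover pos m E C φ K) (hφ : ∀ j, φ j ≤ 2 * a) :
    ∃ (J' : Type) (_ : Fintype J') (C' : J' → Set ℝ) (φ' : J' → ℝ),
      IsCover pos m E C' φ' K ∧ (∀ j, φ' j ≤ 4 * a) ∧ ∑ j, φ' j ≤ ∑ j, φ j ∧
        (Fintype.card J' = 1 ∨ ∀ j, a ≤ φ' j) := by
  induction hn : Fintype.card J using Nat.strong_induction_on generalizing J with
  | _ n ih =>
  by_cases hsmall : ∃ j k, (touchGraph C).Adj j k ∧ φ j < a ∧ φ k < a
  · obtain ⟨j, k, hjk, hj, hk⟩ := hsmall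
    set σ : J → J := fun i => if i = k then j else i with hσdef
    have hne : j ≠ k := hjk.ne
    have hσ : ∀ i, σ (σ i) = σ i := by
      intro i
      by_cases hi : i = k <;> simp [hσdef, hi]
    have hcover := h.merge_touching σ hσ (by
      intro i hi
      by_cases hik : i = k
      · subst hik
        simpa [hσdef] using hjk.symm
      · simp [hσdef, hik] at hi) (fun z => ∑ i with σ i = z, φ i) (by
      intro i l hil
      refine Finset.sum_le_sum_of_subset_of_nonneg ?_ fun i _ _ => h.nonneg i
      intro x hx
      simp only [Finset.mem_insert, Finset.mem_singleton] at hx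
      rcases hx with rfl | rfl | rfl <;> simp [hσ, hil])
    have hcard : Fintype.card {i // σ i = i} < n := by
      rw [← hn]
      refine Fintype.card_subtype_lt (x := k) ?_
      simpa [hσdef] using hne
    obtain ⟨J', hJ', C', φ', h1, h2, h3, h4⟩ := ih _ hcard hcover (by
      rintro ⟨z, hz⟩
      by_cases hzj : z = j
      · subst hzj
        have : (Finset.univ.filter fun i => σ i = z) = {z, k} := by
          ext i
          by_cases hi : i = k <;> simp [hσdef, hi]
        simp only [this]
        rw [Finset.sum_pair hne]
        linarith
      · have hzk : z ≠ k := by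
          rintro rfl
          simp [hσdef] at hz
          exact hne hz
        have : (Finset.univ.filter fun i => σ i = z) = {z} := by
          ext i
          by_cases hi : i = k
          · simp [hσdef, hi, hzk.symm, Ne.symm hzj]
          · simp [hσdef, hi]
        simp only [this, Finset.sum_singleton]
        exact hφ z) rfl
    refine ⟨J', hJ', C', φ', h1, h2, h3.trans ?_, h4⟩
    rw [sum_fixed_fiber σ hσ φ]
  · push Not at hsmall
    by_cases hcard : Fintype.card J = 1
    · exact ⟨J, inferInstance, C, φ, h, fun j => (hφ j).trans (by linarith), le_rfl, Or.inl hcard⟩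
    have hnt : Nontrivial J := by
      have := h.connected.nonempty
      rw [← Fintype.one_lt_card_iff_nontrivial]
      have := Fintype.card_pos (α := J)
      omega
    have hnb : ∀ j, ∃ k, (touchGraph C).Adj j k := fun j =>
      h.connected.preconnected.exists_adj_of_nontrivial j
    choose nb hnb using hnb
    have hbig : ∀ j, φ j < a → a ≤ φ (nb j) := fun j hj => by
      by_contra hlt
      exact absurd (hsmall j (nb j) (hnb j) hj) (by linarith)
    set σ : J → J := fun j => if φ j < a then nb j else j with hσdef
    have hσ : ∀ j, σ (σ j) = σ j := by
      intro j
      by_cases hj : φ j < a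
      · simp [hσdef, hj, (hbig j hj).not_gt]
      · simp [hσdef, hj]
    have hfix : ∀ j, σ j = j → a ≤ φ j := by
      intro j hj
      by_contra hlt
      push Not at hlt
      simp only [hσdef, hlt, if_true] at hj
      exact (hnb j).ne hj.symm
    refine ⟨{j // σ j = j}, inferInstance, _, _, h.merge_touching σ hσ ?_
      (fun z => min (4 * a) (∑ i with σ i = z, φ i)) ?_, ?_, ?_, ?_⟩
    · intro j hj
      by_cases hs : φ j < a
      · simpa [hσdef, hs] using hnb j
      · simp [hσdef, hs] at hj
    · intro j k hjk
      have hle : ∀ i, σ i ≠ i → φ i ≤ a := by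
        intro i hi
        by_contra hlt
        push Not at hlt
        simp [hσdef, hlt.le] at hi
      refine le_min ?_ ?_
      · have hset : ({j, k, σ j} : Finset J) = insert (σ j) (({j, k} : Finset J).erase (σ j)) := by
          ext i
          simp only [Finset.mem_insert, Finset.mem_singleton, Finset.mem_erase]
          tauto
        have h1 : ∑ i ∈ ({j, k} : Finset J).erase (σ j), φ i ≤
            (({j, k} : Finset J).erase (σ j)).card • a := by
          refine Finset.sum_le_card_nsmul _ _ _ fun i hi => hle i ?_
          simp only [Finset.mem_erase, Finset.mem_insert, Finset.mem_singleton] at hi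
          rcases hi with ⟨hi, rfl | rfl⟩
          · exact hi.symm
          · rw [← hjk]; exact hi.symm
        have h2 : (({j, k} : Finset J).erase (σ j)).card ≤ 2 :=
          (Finset.card_erase_le).trans Finset.card_le_two
        have h3 : ((({j, k} : Finset J).erase (σ j)).card : ℝ) ≤ 2 := by exact_mod_cast h2
        rw [nsmul_eq_mul] at h1
        rw [hset, Finset.sum_insert (Finset.notMem_erase _ _)]
        have := hφ (σ j)
        nlinarith
      · refine Finset.sum_le_sum_of_subset_of_nonneg ?_ fun i _ _ => h.nonneg i
        intro x hx
        simp only [Finset.mem_insert, Finset.mem_singleton] at hx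
        rcases hx with rfl | rfl | rfl <;> simp [hσ, hjk]
    · exact fun _ => min_le_left _ _
    · calc _ ≤ ∑ z : {j // σ j = j}, ∑ i with σ i = z.1, φ i :=
            Finset.sum_le_sum fun _ _ => min_le_right _ _
        _ = _ := sum_fixed_fiber σ hσ φ
    · right
      rintro ⟨z, hz⟩
      refine le_min (by linarith) ((hfix z hz).trans ?_)
      exact Finset.single_le_sum (f := φ) (fun i _ => h.nonneg i) (by simp [hz])

/-- Merging large linked stars of a cover decreases the total size substantially. -/
lemma IsCover.merge_stars {K a θ : ℝ} (ha : 0 < a) {J : Type} [Fintype J] {C : J → Set ℝ}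
    {φ : J → ℝ} (h : IsCover pos m E C φ K) (hE : E ⊆ E') (hφ : ∀ j, φ j ≤ 4 * a)
    (hφ' : ∀ j, a ≤ φ j) (hθ : 0 ≤ θ) (hθa : 2 * θ ≤ a / 2) (σ : J → J)
    (hσ : ∀ j, σ (σ j) = σ j)
    (hlink : ∀ j, σ j ≠ j → ∃ p ∈ C j, ∃ q ∈ C (σ j), LineConn pos m E' p q θ)
    (hlarge : ∀ j, σ j ≠ j → 3 ≤ #{i | σ i = σ j ∧ σ i ≠ i}) :
    ∃ (J' : Type) (_ : Fintype J') (C' : J' → Set ℝ) (φ' : J' → ℝ),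
      IsCover pos m E' C' φ' K ∧ (∀ j, φ' j ≤ 13 * a) ∧
        ∑ j, φ' j + a / 6 * #{j | σ j ≠ j} ≤ ∑ j, φ j := by
  set g : J → ℝ := fun j => φ j - a / 6 * (if σ j ≠ j then 1 else 0) with hg
  have hgsum : ∀ s : Finset J, ∑ j ∈ s, g j =
      ∑ j ∈ s, φ j - a / 6 * #(s.filter fun j => σ j ≠ j) := by
    intro s
    rw [hg, Finset.sum_sub_distrib, ← Finset.mul_sum, Finset.sum_boole]
  set ψ : J → ℝ := fun z => if ∃ i, σ i = z ∧ σ i ≠ i then min (13 * a) (∑ i with σ i = z, g i)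
    else φ z with hψ
  have hconn : ∀ j k, σ j = σ k → ∀ s ∈ C j, ∀ s' ∈ C k, LineConn pos m E' s s' (ψ (σ j)) := by
    intro j k hjk s hs s' hs'
    by_cases htriv : ∃ i, σ i = σ j ∧ σ i ≠ i
    · have hstar := h.star_conn (j := j) (k := k) (z := σ j) hE hθ (fun hj => hlink j hj.symm)
        (fun hk => by rw [hjk]; exact hlink k (by rw [← hjk]; exact hk.symm)) hs hs'
      refine hstar.mono_cost ?_
      simp only [hψ, htriv, if_true]
      refine le_min ?_ ?_
      · have := sum_triple_le h.nonneg (hφ j) (hφ k) (hφ (σ j))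
        linarith
      · obtain ⟨i, hi, hi'⟩ := htriv
        have h3 := hlarge i hi'
        rw [hi] at h3
        set S : Finset J := Finset.univ.filter fun i => σ i = σ j with hS
        set A : Finset J := Finset.univ.filter fun i => σ i = σ j ∧ σ i ≠ i with hA
        set T : Finset J := {j, k, σ j} with hT
        have hTS : T ⊆ S := by
          intro x hx
          simp only [hT, Finset.mem_insert, Finset.mem_singleton] at hx
          rcases hx with rfl | rfl | rfl <;> simp [hS, hσ, hjk]
        have hSA : S.filter (fun j => σ j ≠ j) = A := by
          rw [hS, hA, Finset.filter_filter]
        have hAS : #A + 1 ≤ #S := by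
          have h1 : insert (σ j) A ⊆ S := by
            intro x hx
            simp only [hA, Finset.mem_insert, Finset.mem_filter, Finset.mem_univ, true_and] at hx
            rcases hx with rfl | hx
            · simp [hS, hσ]
            · simp [hS, hx.1]
          have h2 : σ j ∉ A := by simp [hA, hσ]
          rw [← Finset.card_insert_of_notMem h2]
          exact Finset.card_le_card h1
        have hT3 : #T ≤ 3 := Finset.card_le_three
        have hdiff : (#(S \ T) : ℝ) * a ≤ ∑ i ∈ S \ T, φ i := by
          rw [← nsmul_eq_mul]
          exact Finset.card_nsmul_le_sum _ _ _ fun i _ => hφ' i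
        have hcard : #A ≤ #(S \ T) + 2 := by
          rw [Finset.card_sdiff_of_subset hTS]
          omega
        have hcard' : (#A : ℝ) ≤ #(S \ T) + 2 := by exact_mod_cast hcard
        have h3' : (3 : ℝ) ≤ #A := by exact_mod_cast h3
        rw [hgsum, hSA, ← Finset.sum_sdiff hTS]
        nlinarith
    · push Not at htriv
      have hj : σ j = j := htriv j rfl
      have hk : σ k = k := htriv k hjk.symm
      have hkj : k = j := by rw [← hk, ← hjk, hj]
      subst hkj
      have : ψ (σ k) = φ k := by
        simp only [hψ]
        rw [if_neg (by push Not; exact htriv), hk]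
      rw [this]
      exact (h.conn k s hs s' hs').mono_edges hE
  refine ⟨{j // σ j = j}, inferInstance, _, _, h.merge hE σ hσ ψ ?_ hconn, ?_, ?_⟩
  · intro z hz
    simp only [hψ]
    split_ifs with hex
    · refine le_min (by linarith) (Finset.sum_nonneg fun i _ => ?_)
      simp only [hg]
      have := hφ' i
      split_ifs <;> linarith
    · exact h.nonneg z
  · rintro ⟨z, hz⟩
    simp only [hψ]
    split_ifs with hex
    · exact min_le_left _ _
    · exact (hφ z).trans (by linarith)
  · have h1 : ∑ z : {j // σ j = j}, ψ z.1 ≤ ∑ z : {j // σ j = j}, ∑ i with σ i = z.1, g i := by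
      refine Finset.sum_le_sum fun z _ => ?_
      simp only [hψ]
      split_ifs with hex
      · exact min_le_right _ _
      · push Not at hex
        have : (Finset.univ.filter fun i => σ i = z.1) = {z.1} := by
          ext i
          simp only [Finset.mem_filter, Finset.mem_univ, true_and, Finset.mem_singleton]
          constructor
          · intro hi
            rw [← hi]
            exact (hex i hi).symm
          · rintro rfl
            exact z.2
        rw [this, Finset.sum_singleton]
        simp [hg, z.2]
    rw [sum_fixed_fiber σ hσ g, hgsum] at h1
    linarith

/-- Given a cover and a graph `Θ` of cheap links between pieces that do not touch, the cover can be
modified so that its total size decreases by a constant fraction of the size of the linked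
pieces. -/
lemma IsCover.shrink {K a : ℝ} (ha : 0 < a) {J : Type} [Fintype J] {C : J → Set ℝ} {φ : J → ℝ}
    (h : IsCover pos m E C φ K) (hE : E ⊆ E') (hφ : ∀ j, φ j ≤ 4 * a) (hφ' : ∀ j, a ≤ φ j)
    (Θ : SimpleGraph J)
    (hlink : ∀ p q, Θ.Adj p q → ∃ s ∈ C p, ∃ s' ∈ C q, LineConn pos m E' s s' (a / 4))
    (hfar : ∀ p q, Θ.Adj p q → ¬ (touchGraph C).Adj p q) :
    ∃ (J' : Type) (_ : Fintype J') (C' : J' → Set ℝ) (φ' : J' → ℝ),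
      IsCover pos m E' C' φ' (K + 4 * a) ∧ (∀ j, φ' j ≤ 128 * a) ∧
        ∑ j, φ' j + a / 60 * #{p | ∃ q, Θ.Adj p q} ≤ ∑ j, φ j := by
  set S : Finset J := {p | ∃ q, Θ.Adj p q} with hS
  rcases S.eq_empty_or_nonempty with hemp | ⟨p₀, hp₀⟩
  · exact ⟨J, inferInstance, C, φ, h.mono hE (by linarith), fun j => (hφ j).trans (by linarith),
      by simp [hemp]⟩
  obtain ⟨q₀, hpq⟩ : ∃ q, Θ.Adj p₀ q := by simpa [hS] using hp₀
  have hnt : Nontrivial J := ⟨p₀, q₀, hpq.ne⟩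
  choose nb hnb using fun j => h.connected.preconnected.exists_adj_of_nontrivial j
  set Lf : Finset J := {j | ∀ k, (touchGraph C).Adj j k → k = nb j} with hLf
  have hmemLf : ∀ j, j ∈ Lf ↔ ∀ k, (touchGraph C).Adj j k → k = nb j := by
    intro j
    simp [hLf]
  have hnbLf : ∀ j ∈ Lf, nb j ∉ Lf := by
    intro j hj hj'
    rw [hmemLf] at hj hj'
    have hback : nb (nb j) = j := (hj' j (hnb j).symm).symm
    have hcomp : ∀ u v, (touchGraph C).Reachable u v → u = j ∨ u = nb j → v = j ∨ v = nb j := by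
      rintro u v ⟨p⟩
      induction p with
      | nil => exact id
      | cons hadj _ ih =>
        rintro (rfl | rfl)
        · exact ih (Or.inr (hj _ hadj))
        · exact ih (Or.inl ((hj' _ hadj).trans hback))
    have hp := hcomp j p₀ (h.connected.preconnected _ _) (Or.inl rfl)
    have hq := hcomp j q₀ (h.connected.preconnected _ _) (Or.inl rfl)
    have hn := hfar _ _ hpq
    have hne := hpq.ne
    rcases hp with rfl | rfl <;> rcases hq with rfl | rfl
    · exact hne rfl
    · exact hn (hnb _)
    · exact hn (hnb _).symm
    · exact hne rfl
  by_cases hcase : #S ≤ 2 * #Lf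
  · set π : J → {j // j ∉ Lf} := fun j => if hj : j ∈ Lf then ⟨nb j, hnbLf j hj⟩ else ⟨j, hj⟩
      with hπ
    have hπ1 : ∀ j ∈ Lf, (π j).1 = nb j := fun j hj => by simp [hπ, hj]
    have hπ2 : ∀ j, j ∉ Lf → (π j).1 = j := fun j hj => by simp [hπ, hj]
    refine ⟨{j // j ∉ Lf}, inferInstance, fun j => C j.1, fun j => φ j.1,
      h.map hE π ?_ ?_ (fun j => h.nonneg _) ?_ ?_, fun j => (hφ _).trans (by linarith), ?_⟩
    · exact fun z => ⟨z.1, Subtype.ext (hπ2 _ z.2)⟩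
    · intro j k hjk hne
      have hne' : (π j).1 ≠ (π k).1 := fun h => hne (Subtype.ext h)
      by_cases hj : j ∈ Lf
      · have hk : k = nb j := (hmemLf j).mp hj k hjk
        subst hk
        exact absurd (by rw [hπ1 j hj, hπ2 _ (hnbLf j hj)]) hne'
      by_cases hk : k ∈ Lf
      · have hj' : j = nb k := (hmemLf k).mp hk j hjk.symm
        subst hj'
        exact absurd (by rw [hπ1 k hk, hπ2 _ (hnbLf k hk)]) hne'
      simp only [hπ2 j hj, hπ2 k hk]
      exact hjk.2
    · exact fun j s hs s' hs' => (h.conn _ s hs s' hs').mono_edges hE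
    · intro j s hs
      by_cases hj : j ∈ Lf
      · obtain ⟨-, p, hp, hp'⟩ := hnb j
        refine ⟨p, by simpa only [hπ1 j hj] using hp',
          ((h.conn _ s hs p hp).mono_edges hE).mono_cost ?_⟩
        linarith [hφ j]
      · exact ⟨s, by simpa only [hπ2 j hj] using hs, LineConn.refl _ (by linarith)⟩
    · have h1 : ∑ z : {j // j ∉ Lf}, φ z.1 + ∑ j ∈ Lf, φ j = ∑ j, φ j := by
        rw [← Finset.sum_add_sum_compl Lf, add_comm]
        congr 1
        exact (Finset.sum_subtype _ (fun x => by simp) φ).symm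
      have h2 : #Lf • a ≤ ∑ j ∈ Lf, φ j := Finset.card_nsmul_le_sum _ _ _ fun j _ => hφ' j
      rw [nsmul_eq_mul] at h2
      have h3 : (#S : ℝ) ≤ 2 * #Lf := by exact_mod_cast hcase
      nlinarith
  · set M : Finset J := S \ Lf with hM
    have hMcard : #S ≤ 2 * #M := by
      have h1 := Finset.card_sdiff_add_card S Lf
      have h2 := Finset.card_le_card (Finset.subset_union_left (s₁ := S) (s₂ := Lf))
      rw [← hM] at h1
      omega
    obtain ⟨σ, hσ1, hσ2, hσ3, hσ4⟩ := exists_star_packing (touchGraph C ⊔ Θ) M (by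
      intro v hv
      rw [hM, Finset.mem_sdiff, hmemLf] at hv
      obtain ⟨hvS, hvL⟩ := hv
      push Not at hvL
      obtain ⟨k, hk, hkne⟩ := hvL
      obtain ⟨q, hq⟩ : ∃ q, Θ.Adj v q := by simpa [hS] using hvS
      have hqt := hfar _ _ hq
      rw [← Finset.card_eq_three.mpr ⟨nb v, k, q, hkne.symm, ?_, ?_, rfl⟩]
      · refine Finset.card_le_card fun x hx => ?_
        simp only [Finset.mem_insert, Finset.mem_singleton] at hx
        simp only [Finset.mem_filter, Finset.mem_univ, true_and, SimpleGraph.sup_adj]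
        rcases hx with rfl | rfl | rfl
        · exact Or.inl (hnb v)
        · exact Or.inl hk
        · exact Or.inr hq
      · rintro rfl
        exact hqt (hnb v)
      · rintro rfl
        exact hqt hk)
    obtain ⟨J', hJ', C', φ', h1, h2, h3⟩ := h.merge_stars ha hE hφ hφ' (θ := a / 4) (by linarith)
      (by linarith) σ hσ1 (fun j hj => by
        rcases hσ2 j hj with ht | hθ
        · obtain ⟨-, p, hp, hp'⟩ := ht
          exact ⟨p, hp, p, hp', LineConn.refl _ (by linarith)⟩
        · exact hlink _ _ hθ) hσ3
    refine ⟨J', hJ', C', φ', h1.mono subset_rfl (by linarith), fun j => (h2 j).trans (by linarith),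
      ?_⟩
    have h4 : (#S : ℝ) ≤ 10 * #{j | σ j ≠ j} := by
      exact_mod_cast (by omega : #S ≤ 10 * #{j | σ j ≠ j})
    nlinarith

/-- A set of shortcuts as produced by the greedy algorithm with stretch `t`: in any subset, the
ends of a heaviest shortcut are far apart with respect to the other shortcuts. -/
def IsGreedy {V : Type*} (pos : V → ℝ) (m : Sym2 V → ℝ) (t : ℝ) (E : Finset (Sym2 V)) : Prop :=
  ∀ E' ⊆ E, E'.Nonempty → ∃ e ∈ E', (∀ e' ∈ E', m e' ≤ m e) ∧
    ∀ x y, e = s(x, y) → ¬ LineConn pos m (E'.erase e) (pos x) (pos y) (t * m e)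

lemma exists_edges_eq_append {J : Type*} {Θ : SimpleGraph J} {e : Sym2 J} {u v : J}
    (p : Θ.Walk u v) (he : e ∈ p.edges) :
    ∃ (x y : J) (p₁ : Θ.Walk u x) (p₂ : Θ.Walk y v), e = s(x, y) ∧
      p.edges = p₁.edges ++ e :: p₂.edges := by
  induction p with
  | nil => simp at he
  | @cons a b c hab q ih =>
    rw [SimpleGraph.Walk.edges_cons, List.mem_cons] at he
    rcases he with rfl | he
    · exact ⟨a, b, .nil, q, rfl, by simp⟩
    · obtain ⟨x, y, p₁, p₂, h1, h2⟩ := ih he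
      exact ⟨x, y, .cons hab p₁, p₂, h1, by simp [h2]⟩

/-- An edge on a cycle can be bypassed along the rest of the cycle. -/
lemma exists_walk_bypassing_edge {J : Type*} {Θ : SimpleGraph J} {u : J} (c : Θ.Walk u u)
    (hc : c.IsCycle) {e : Sym2 J} (he : e ∈ c.edges) :
    ∃ (x y : J) (p : Θ.Walk x y), e = s(x, y) ∧ p.length + 1 = c.length ∧
      ∀ e' ∈ p.edges, e' ∈ c.edges ∧ e' ≠ e := by
  obtain ⟨x, y, p₁, p₂, h1, h2⟩ := exists_edges_eq_append c he
  have hnodup := hc.edges_nodup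
  refine ⟨y, x, p₂.append p₁, h1.trans Sym2.eq_swap, ?_, fun e' he' => ?_⟩
  · have := congrArg List.length h2
    simp only [SimpleGraph.Walk.length_edges, List.length_append, List.length_cons] at this
    rw [SimpleGraph.Walk.length_append]
    omega
  · rw [SimpleGraph.Walk.edges_append, List.mem_append] at he'
    rw [h2] at hnodup ⊢
    have hperm := List.nodup_middle.mp hnodup
    rw [List.nodup_cons, List.mem_append] at hperm
    refine ⟨by simp; tauto, ?_⟩
    rintro rfl
    exact hperm.1 he'.symm

/-- Travelling along a walk in the graph of links between pieces of a cover. -/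
lemma IsCover.conn_walk {K a : ℝ} {J : Type*} {C : J → Set ℝ} {φ : J → ℝ}
    (h : IsCover pos m E C φ K) (hE : E ⊆ E') (ha : 0 ≤ a) (hφ : ∀ j, φ j ≤ 4 * a)
    (hKa : K ≤ a / 16)
    {nd : V → J} {pt : V → ℝ} (hpt : ∀ x, pt x ∈ C (nd x))
    (hnear : ∀ x, LineConn pos m E (pos x) (pt x) K) {Θ : SimpleGraph J} {p q : J}
    (W : Θ.Walk p q)
    (hW : ∀ ε ∈ W.edges, ∃ e ∈ E', m e ≤ a / 16 ∧ Sym2.map nd e = ε) {s s' : ℝ} (hs : s ∈ C p)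
    (hs' : s' ∈ C q) : LineConn pos m E' s s' (W.length * (5 * a) + 4 * a) := by
  have hc : ∀ j, ∀ s ∈ C j, ∀ s' ∈ C j, LineConn pos m E' s s' (4 * a) :=
    fun j s hs s' hs' => ((h.conn j s hs s' hs').mono_edges hE).mono_cost (hφ j)
  have hn : ∀ x, LineConn pos m E' (pos x) (pt x) K := fun x => (hnear x).mono_edges hE
  induction W generalizing s with
  | nil => exact (hc _ s hs s' hs').mono_cost (by simp)
  | @cons u v w huv W ih =>
    simp only [SimpleGraph.Walk.edges_cons, List.mem_cons] at hW
    obtain ⟨e, he, hme, hmap⟩ := hW _ (Or.inl rfl)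
    obtain ⟨x, y, rfl, rfl, rfl⟩ : ∃ x y, e = s(x, y) ∧ nd x = u ∧ nd y = v := by
      induction e with
      | _ x y =>
      rw [Sym2.map_mk, Sym2.eq_iff] at hmap
      rcases hmap with ⟨h1, h2⟩ | ⟨h1, h2⟩
      · exact ⟨x, y, rfl, h1, h2⟩
      · exact ⟨y, x, Sym2.eq_swap, h2, h1⟩
    have hrest := ih (fun ε hε => hW ε (Or.inr hε)) (hpt y) hs'
    refine ((((((hc _ s hs _ (hpt x)).trans (hn x).symm).trans (LineConn.of_mem he)).trans
      (hn y)).trans hrest)).mono_cost ?_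
    rw [SimpleGraph.Walk.length_cons]
    push_cast
    linarith

/-- If `E₁` and `E₂` are the shortcuts of length at most `w` and at most `128 * w` of a greedy set
of shortcuts, then a cover at scale `w` can be turned into one at scale `128 * w`, at a
decrease of the total size that pays for the new shortcuts. -/
lemma IsCover.next_scale [Fintype V] {N : Finset V} {k : ℕ} (hN : #N ≤ 2 ^ k)
    {t : ℝ} (ht : t = 10240 * (2 * k + 4)) (hgreedy : IsGreedy pos m t E)
    (hEN : ∀ x y, s(x, y) ∈ E → x ∈ N) {w : ℝ} (hw : 0 < w) {J : Type} [Fintype J]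
    {C : J → Set ℝ} {φ : J → ℝ} {K : ℝ}
    (h : IsCover pos m (E.filter fun e => m e ≤ w) C φ K) (hK : K ≤ 128 * w)
    (hφ : ∀ j, φ j ≤ 2048 * w) :
    ∃ (J' : Type) (_ : Fintype J') (C' : J' → Set ℝ) (φ' : J' → ℝ) (K' : ℝ),
      IsCover pos m (E.filter fun e => m e ≤ 128 * w) C' φ' K' ∧ K' ≤ 128 * (128 * w) ∧
      (∀ j, φ' j ≤ 2048 * (128 * w)) ∧
        ∑ j, φ' j + (∑ e ∈ E with m e ≤ 128 * w, m e) / 8 ≤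
          ∑ j, φ j + (∑ e ∈ E with m e ≤ w, m e) / 8 := by
  set E₁ := E.filter fun e => m e ≤ w with hE₁
  set E₂ := E.filter fun e => m e ≤ 128 * w with hE₂
  set F := E₂ \ E₁ with hFdef
  set a : ℝ := 2048 * w with ha
  have ha0 : 0 < a := by positivity
  have hE12 : E₁ ⊆ E₂ := by
    intro e he
    rw [hE₁, Finset.mem_filter] at he
    rw [hE₂, Finset.mem_filter]
    exact ⟨he.1, by linarith [he.2]⟩
  have hsum : ∑ e ∈ E₂, m e = ∑ e ∈ F, m e + ∑ e ∈ E₁, m e := (Finset.sum_sdiff hE12).symm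
  have hFE₂ : F ⊆ E₂ := Finset.sdiff_subset
  have hFm : ∀ e ∈ F, w < m e ∧ m e ≤ a / 16 := by
    intro e he
    rw [hFdef, Finset.mem_sdiff, hE₁, hE₂, Finset.mem_filter, Finset.mem_filter] at he
    refine ⟨?_, by linarith [he.1.2]⟩
    by_contra hle
    exact he.2 ⟨he.1.1, by linarith⟩
  have hFE : ∀ e ∈ F, e ∈ E := fun e he => (Finset.mem_filter.mp (hFE₂ he)).1
  have hE₁E : E₁ ⊆ E := Finset.filter_subset _ _
  have hk0 : (0 : ℝ) ≤ k := Nat.cast_nonneg k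
  have ht0 : 0 ≤ t := by rw [ht]; positivity
  rcases F.eq_empty_or_nonempty with hemp | hFne
  · refine ⟨J, inferInstance, C, φ, K, h.mono hE12 le_rfl, by linarith,
      fun j => (hφ j).trans (by linarith), ?_⟩
    rw [hsum, hemp]
    simp
  obtain ⟨J', hJ', C', φ', h', hφ4, hφsum, hφbig⟩ := h.coarsen ha0 (fun j => by linarith [hφ j])
  choose nd pt hpt hnear using h'.near
  have hheavy : ∀ D ⊆ F, D.Nonempty → ∃ e ∈ D, ∀ x y, e = s(x, y) →
      ¬ LineConn pos m (E₁ ∪ D.erase e) (pos x) (pos y) (5 * a * (2 * k + 4)) := by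
    intro D hD hDne
    obtain ⟨e, he, hmax, hnot⟩ := hgreedy (E₁ ∪ D)
      (Finset.union_subset hE₁E fun e he => hFE e (hD he))
      (hDne.mono Finset.subset_union_right)
    have heE₁ : e ∉ E₁ := by
      intro heE
      obtain ⟨d, hd⟩ := hDne
      have h1 := hmax d (Finset.mem_union_right _ hd)
      have h2 := (hFm d (hD hd)).1
      have h3 := (Finset.mem_filter.mp heE).2
      linarith
    have heD : e ∈ D := (Finset.mem_union.mp he).resolve_left heE₁
    refine ⟨e, heD, fun x y hxy hcon => hnot x y hxy ?_⟩
    rw [Finset.erase_union_distrib, Finset.erase_eq_of_notMem heE₁]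
    refine hcon.mono_cost ?_
    have := (hFm e (hD heD)).1
    rw [ht, ha]
    nlinarith
  have hconn4 : ∀ j, ∀ s ∈ C' j, ∀ s' ∈ C' j, LineConn pos m E₁ s s' (4 * a) :=
    fun j s hs s' hs' => (h'.conn j s hs s' hs').mono_cost (hφ4 j)
  have hfar : ∀ x y, s(x, y) ∈ F →
      ¬ LineConn pos m E₁ (pos x) (pos y) (5 * a * (2 * k + 4)) := by
    intro x y hxy hcon
    obtain ⟨e, he, hnot⟩ := hheavy {s(x, y)} (by simpa using hxy) (by simp)
    rw [Finset.mem_singleton] at he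
    subst he
    exact hnot x y rfl (by simpa using hcon)
  have hbig : 20 * a ≤ 5 * a * (2 * k + 4) := by nlinarith
  have hndne : ∀ x y, s(x, y) ∈ F → nd x ≠ nd y := by
    intro x y hxy heq
    refine hfar x y hxy ((((hnear x).trans (hconn4 _ _ (hpt x) _ (by rw [heq]; exact hpt y))).trans
      (hnear y).symm).mono_cost (by linarith))
  have hndtouch : ∀ x y, s(x, y) ∈ F → ¬ (touchGraph C').Adj (nd x) (nd y) := by
    rintro x y hxy ⟨-, p, hp, hp'⟩
    exact hfar x y hxy (((((hnear x).trans (hconn4 _ _ (hpt x) _ hp)).trans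
      (hconn4 _ _ hp' _ (hpt y))).trans (hnear y).symm).mono_cost (by linarith))
  let Θ : SimpleGraph J' :=
    { Adj := fun p q => p ≠ q ∧ s(p, q) ∈ F.image (Sym2.map nd)
      symm := ⟨fun p q h => ⟨h.1.symm, by rw [Sym2.eq_swap]; exact h.2⟩⟩
      loopless := ⟨fun p h => h.1 rfl⟩ }
  have hΘ : ∀ p q, Θ.Adj p q → ∃ x y, s(x, y) ∈ F ∧ nd x = p ∧ nd y = q := by
    rintro p q ⟨-, hpq⟩
    obtain ⟨e, he, hmap⟩ := Finset.mem_image.mp hpq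
    induction e with
    | _ x y =>
    rw [Sym2.map_mk, Sym2.eq_iff] at hmap
    rcases hmap with ⟨h1, h2⟩ | ⟨h1, h2⟩
    · exact ⟨x, y, he, h1, h2⟩
    · exact ⟨y, x, by rwa [Sym2.eq_swap], h2, h1⟩
  have hΘmem : ∀ e ∈ F.image (Sym2.map nd), e ∈ Θ.edgeSet := by
    intro ε hε
    obtain ⟨e, he, rfl⟩ := Finset.mem_image.mp hε
    induction e with
    | _ x y => exact ⟨hndne x y he, hε⟩
  have hinj : #(F.image (Sym2.map nd)) = #F := by
    refine Finset.card_image_of_injOn ?_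
    have key : ∀ x y x' y', s(x, y) ∈ F → s(x', y') ∈ F → nd x = nd x' → nd y = nd y' →
        s(x, y) ≠ s(x', y') → LineConn pos m (E₁ ∪ {s(x', y')}) (pos x) (pos y)
          (5 * a * (2 * k + 4)) := by
      intro x y x' y' hxy hxy' h1 h2 hne
      have hn : ∀ x, LineConn pos m (E₁ ∪ {s(x', y')}) (pos x) (pt x) K :=
        fun x => (hnear x).mono_edges Finset.subset_union_left
      have hc := (hconn4 _ _ (hpt x) _ (by rw [h1]; exact hpt x')).mono_edges
        (Finset.subset_union_left (s₂ := {s(x', y')}))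
      have hc' := (hconn4 _ _ (hpt y) _ (by rw [h2]; exact hpt y')).mono_edges
        (Finset.subset_union_left (s₂ := {s(x', y')}))
      refine ((((((hn x).trans hc).trans (hn x').symm).trans (LineConn.of_mem (x := x') (y := y')
        (by simp))).trans (hn y')).trans (hc'.symm.trans (hn y).symm)).mono_cost ?_
      have := (hFm _ hxy').2
      linarith
    intro e he e' he' heq
    rw [Finset.mem_coe] at he he'
    by_contra hne
    obtain ⟨d, hd, hnot⟩ := hheavy {e, e'}
      (by intro d hd; simp only [Finset.mem_insert, Finset.mem_singleton] at hd
          rcases hd with rfl | rfl <;> assumption) ⟨e, by simp⟩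
    have herase : ∀ e e' : Sym2 V, e ≠ e' → ({e, e'} : Finset (Sym2 V)).erase e = {e'} := by
      intro e e' hne
      rw [Finset.erase_insert]
      simpa using hne
    rw [Finset.mem_insert, Finset.mem_singleton] at hd
    have key2 : ∀ e e' : Sym2 V, e ∈ F → e' ∈ F → Sym2.map nd e = Sym2.map nd e' → e ≠ e' →
        ∃ x y, e = s(x, y) ∧ LineConn pos m (E₁ ∪ {e'}) (pos x) (pos y)
          (5 * a * (2 * k + 4)) := by
      intro e e' he he' heq hne
      induction e with
      | _ x y =>
      induction e' with
      | _ x' y' =>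
      rw [Sym2.map_mk, Sym2.map_mk, Sym2.eq_iff] at heq
      refine ⟨x, y, rfl, ?_⟩
      rcases heq with ⟨h1, h2⟩ | ⟨h1, h2⟩
      · exact key x y x' y' he he' h1 h2 hne
      · rw [Sym2.eq_swap (a := x')] at he' hne ⊢
        exact key x y y' x' he he' h1 h2 hne
    rcases hd with rfl | rfl
    · obtain ⟨x, y, hxy, hcon⟩ := key2 _ _ he he' heq hne
      exact hnot x y hxy (by rwa [herase _ _ hne])
    · obtain ⟨x, y, hxy, hcon⟩ := key2 _ _ he' he heq.symm (Ne.symm hne)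
      exact hnot x y hxy (by rwa [Finset.pair_comm, herase _ _ (Ne.symm hne)])
  have hcyc : ∀ (u : J') (c : Θ.Walk u u), c.IsCycle → 2 * k + 3 < c.length := by
    intro u c hc
    by_contra hlen
    push Not at hlen
    have hξ : ∀ ε, ∃ e, ε ∈ c.edges → e ∈ F ∧ Sym2.map nd e = ε := by
      intro ε
      by_cases hε : ε ∈ c.edges
      · have := c.edges_subset_edgeSet hε
        induction ε with
        | _ p q =>
        obtain ⟨e, he, hmap⟩ := Finset.mem_image.mp (this : Θ.Adj p q).2
        exact ⟨e, fun _ => ⟨he, hmap⟩⟩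
      · obtain ⟨e, -⟩ := hFne
        exact ⟨e, fun h => absurd h hε⟩
    choose ξ hξ using hξ
    obtain ⟨e, he, hnot⟩ := hheavy (c.edges.toFinset.image ξ)
      (by
        intro e he
        obtain ⟨ε, hε, rfl⟩ := Finset.mem_image.mp he
        exact (hξ ε (List.mem_toFinset.mp hε)).1)
      (by
        obtain ⟨ε, hε⟩ := List.exists_mem_of_ne_nil c.edges (by
          intro h
          exact hc.ne_nil (SimpleGraph.Walk.edges_eq_nil.mp h).eq_nil)
        exact ⟨ξ ε, Finset.mem_image_of_mem _ (List.mem_toFinset.mpr hε)⟩)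
    obtain ⟨ε, hε, rfl⟩ := Finset.mem_image.mp he
    rw [List.mem_toFinset] at hε
    obtain ⟨p, q, W, hpq, hWlen, hWedges⟩ := exists_walk_bypassing_edge c hc hε
    have hξε := hξ ε hε
    obtain ⟨x, y, hxy, rfl, rfl⟩ : ∃ x y, ξ ε = s(x, y) ∧ nd x = p ∧ nd y = q := by
      have hmap := hξε.2.trans hpq
      generalize ξ ε = e' at hmap ⊢
      induction e' with
      | _ x y =>
      rw [Sym2.map_mk, Sym2.eq_iff] at hmap
      rcases hmap with ⟨h1, h2⟩ | ⟨h1, h2⟩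
      · exact ⟨x, y, rfl, h1, h2⟩
      · exact ⟨y, x, Sym2.eq_swap, h2, h1⟩
    set E'' := E₁ ∪ (c.edges.toFinset.image ξ).erase (ξ ε) with hE''
    have hsub : E₁ ⊆ E'' := Finset.subset_union_left
    have hwalk := h'.conn_walk hsub ha0.le hφ4 (by linarith) hpt hnear W (fun ε' hε' => by
      obtain ⟨h1, h2⟩ := hWedges ε' hε'
      refine ⟨ξ ε', Finset.mem_union_right _ (Finset.mem_erase.mpr ⟨fun heq => h2 ?_,
        Finset.mem_image_of_mem _ (List.mem_toFinset.mpr h1)⟩), (hFm _ (hξ ε' h1).1).2,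
        (hξ ε' h1).2⟩
      rw [← (hξ ε' h1).2, heq, hξε.2]) (hpt x) (hpt y)
    refine hnot x y hxy (((((hnear x).mono_edges hsub).trans hwalk).trans
      ((hnear y).mono_edges hsub).symm).mono_cost ?_)
    have hWlen' : (W.length : ℝ) + 1 ≤ 2 * k + 3 := by
      exact_mod_cast (by omega : W.length + 1 ≤ 2 * k + 3)
    nlinarith
  have hSN : #({p | ∃ q, Θ.Adj p q} : Finset J') ≤ 2 ^ k := by
    refine le_trans ?_ hN
    refine (Finset.card_le_card fun p hp => ?_).trans (Finset.card_image_le (f := nd))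
    simp only [Finset.mem_filter, Finset.mem_univ, true_and] at hp
    obtain ⟨q, hpq⟩ := hp
    obtain ⟨x, y, hxy, rfl, -⟩ := hΘ _ _ hpq
    exact Finset.mem_image_of_mem _ (hEN x y (hFE _ hxy))
  have hFcard := card_edges_le_of_no_short_cycle _ hSN Θ
    (fun x y hxy => by simpa using ⟨y, hxy⟩) hcyc _ hΘmem
  rw [hinj] at hFcard
  obtain ⟨e, he⟩ := hFne
  have hJ'ne : ¬ Fintype.card J' = 1 := by
    intro hcard
    induction e with
    | _ x y =>
    have := Fintype.card_le_one_iff.mp hcard.le (nd x) (nd y)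
    exact hndne x y he this
  obtain ⟨J'', hJ'', C'', φ'', h1, h2, h3⟩ := h'.shrink ha0 hE12 hφ4 (hφbig.resolve_left hJ'ne) Θ
    (by
      intro p q hpq
      obtain ⟨x, y, hxy, rfl, rfl⟩ := hΘ _ _ hpq
      refine ⟨pt x, hpt x, pt y, hpt y, ((((hnear x).mono_edges hE12).symm.trans
        (LineConn.of_mem (hFE₂ hxy))).trans ((hnear y).mono_edges hE12)).mono_cost ?_⟩
      have := (hFm _ hxy).2
      linarith)
    (by
      intro p q hpq
      obtain ⟨x, y, hxy, rfl, rfl⟩ := hΘ _ _ hpq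
      exact hndtouch x y hxy)
  refine ⟨J'', hJ'', C'', φ'', _, h1, by linarith, fun j => (h2 j).trans (by linarith), ?_⟩
  have h4 : ∑ e ∈ F, m e ≤ #F • (a / 16) := Finset.sum_le_card_nsmul _ _ _ fun e he => (hFm e he).2
  rw [nsmul_eq_mul] at h4
  have h5 : (#F : ℝ) ≤ 2 * #({p | ∃ q, Θ.Adj p q} : Finset J') := by exact_mod_cast hFcard
  have h6 : (0 : ℝ) ≤ #({p | ∃ q, Θ.Adj p q} : Finset J') := Nat.cast_nonneg _
  have h7 : (#F : ℝ) * (a / 16) ≤ 2 * #({p | ∃ q, Θ.Adj p q} : Finset J') * (a / 16) :=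
    mul_le_mul_of_nonneg_right h5 (by positivity)
  have h8 : 0 ≤ a * #({p | ∃ q, Θ.Adj p q} : Finset J') := by positivity
  have h3' : ∑ j, φ'' j + a / 60 * #({p | ∃ q, Θ.Adj p q} : Finset J') ≤ ∑ j, φ' j := by
    convert h3
  rw [hsum]
  linarith

/-- The greedy algorithm. -/
lemma exists_isGreedy (pos : V → ℝ) (m : Sym2 V → ℝ) {t : ℝ} (ht : 1 ≤ t) (P : Finset (Sym2 V))
    (hP : ∀ e ∈ P, 0 ≤ m e) :
    ∃ E ⊆ P, IsGreedy pos m t E ∧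
      ∀ x y, s(x, y) ∈ P → LineConn pos m E (pos x) (pos y) (t * m s(x, y)) := by
  induction P using Finset.induction_on_max_value m with
  | empty =>
    exact ⟨∅, subset_rfl, fun E' hE' hne => absurd hne (by simp [Finset.subset_empty.mp hE']),
      by simp⟩
  | insert p P hp hmax ih =>
    obtain ⟨E, hEP, hE, hconn⟩ := ih fun e he => hP e (Finset.mem_insert_of_mem he)
    induction p with
    | _ x y =>
    by_cases hxy : LineConn pos m E (pos x) (pos y) (t * m s(x, y))
    · refine ⟨E, hEP.trans (Finset.subset_insert _ _), hE, fun x' y' h => ?_⟩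
      rcases Finset.mem_insert.mp h with h | h
      · rw [h]
        rcases Sym2.eq_iff.mp h with ⟨rfl, rfl⟩ | ⟨rfl, rfl⟩
        · exact hxy
        · exact hxy.symm
      · exact hconn x' y' h
    · refine ⟨insert s(x, y) E, Finset.insert_subset_insert _ hEP, fun E' hE' hne => ?_,
        fun x' y' h => ?_⟩
      · by_cases hmem : s(x, y) ∈ E'
        · refine ⟨s(x, y), hmem, fun e' he' => ?_, fun x' y' h hcon => hxy ?_⟩
          · rcases Finset.mem_insert.mp (hE' he') with rfl | h
            · exact le_rfl
            · exact hmax e' (hEP h)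
          · have hsub : E'.erase s(x, y) ⊆ E := by
              intro e he
              rw [Finset.mem_erase] at he
              exact Finset.mem_of_mem_insert_of_ne (hE' he.2) he.1
            rcases Sym2.eq_iff.mp h with ⟨rfl, rfl⟩ | ⟨rfl, rfl⟩
            · exact hcon.mono_edges hsub
            · exact (hcon.mono_edges hsub).symm
        · exact hE E' ((Finset.subset_insert_iff_of_notMem hmem).mp hE') hne
      · rcases Finset.mem_insert.mp h with h' | h'
        · have h0 := hP _ (Finset.mem_insert_self s(x, y) P)
          refine (LineConn.of_mem ?_).mono_cost ?_
          · rw [h']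
            exact Finset.mem_insert_self _ _
          · rw [h']
            nlinarith
        · exact (hconn x' y' h').mono_edges (Finset.subset_insert _ _)

/-- A cover of a segment by short intervals. -/
lemma exists_isCover_intervals {Λ h : ℝ} (hh : 0 < h) (hhΛ : h ≤ Λ)
    (hpos : ∀ v, 0 ≤ pos v ∧ pos v ≤ Λ) :
    ∃ (J : Type) (_ : Fintype J) (C : J → Set ℝ) (φ : J → ℝ),
      IsCover pos m E C φ 0 ∧ (∀ j, φ j ≤ h) ∧ ∑ j, φ j ≤ 2 * Λ := by
  set n := ⌊Λ / h⌋₊ with hn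
  have hdiv : 0 ≤ Λ / h := div_nonneg (hh.le.trans hhΛ) hh.le
  refine ⟨Fin (n + 1), inferInstance, fun j => Set.Icc (j * h) ((j + 1) * h), fun _ => h,
    ⟨fun _ => hh.le, fun j s hs s' hs' => LineConn.walk ?_, fun x => ?_, ?_⟩, fun _ => le_rfl, ?_⟩
  · rw [Set.mem_Icc] at hs hs'
    rw [abs_le]
    constructor <;> linarith
  · have hx : 0 ≤ pos x / h := div_nonneg (hpos x).1 hh.le
    refine ⟨⟨⌊pos x / h⌋₊, Nat.lt_succ_of_le (Nat.floor_le_floor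
      (div_le_div_of_nonneg_right (hpos x).2 hh.le))⟩, pos x, ⟨?_, ?_⟩, LineConn.refl _ le_rfl⟩
    · have := Nat.floor_le hx
      rwa [le_div_iff₀ hh] at this
    · have := (Nat.lt_floor_add_one (pos x / h)).le
      rwa [div_le_iff₀ hh] at this
  · have hreach : ∀ i (hi : i < n + 1), (touchGraph fun j : Fin (n + 1) =>
        Set.Icc ((j : ℝ) * h) ((j + 1) * h)).Reachable 0 ⟨i, hi⟩ := by
      intro i
      induction i with
      | zero => exact fun _ => SimpleGraph.Reachable.refl _
      | succ i ih =>
        intro hi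
        refine (ih (by omega)).trans (SimpleGraph.Adj.reachable ⟨by simp, (i + 1) * h, ?_, ?_⟩)
        · simp only [Set.mem_Icc, le_refl, and_true]
          nlinarith
        · simp only [Set.mem_Icc]
          push_cast
          constructor <;> nlinarith
    exact ⟨fun u v => (hreach u u.2).symm.trans (hreach v v.2)⟩
  · have := Nat.floor_le hdiv
    rw [le_div_iff₀ hh] at this
    simp only [Finset.sum_const, Finset.card_univ, Fintype.card_fin, nsmul_eq_mul]
    push_cast
    linarith

/-- Any metric on a set `N` of at most `2 ^ k` points, placed on a segment of length `Λ`, has a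
spanner of weight `O(Λ)` and stretch `O(k)` if travelling along the segment is allowed. -/
theorem exists_light_line_spanner [Fintype V] {Λ : ℝ} (hΛ : 0 < Λ)
    (hpos : ∀ v, 0 ≤ pos v ∧ pos v ≤ Λ) (hm : ∀ x y, x ≠ y → 0 < m s(x, y)) {N : Finset V} {k : ℕ}
    (hN : #N ≤ 2 ^ k) :
    ∃ E : Finset (Sym2 V), (∀ x y, s(x, y) ∈ E → x ∈ N ∧ y ∈ N ∧ x ≠ y) ∧
      ∑ e ∈ E, m e ≤ 16 * Λ ∧ ∀ x ∈ N, ∀ y ∈ N, x ≠ y →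
        LineConn pos m E (pos x) (pos y) (10240 * (2 * k + 4) * m s(x, y)) := by
  set P : Finset (Sym2 V) := {e | (∀ x ∈ e, x ∈ N) ∧ ¬ e.IsDiag} with hP
  have hPmem : ∀ x y, s(x, y) ∈ P ↔ x ∈ N ∧ y ∈ N ∧ x ≠ y := by
    intro x y
    simp [hP, and_assoc]
  have hPm : ∀ e ∈ P, 0 < m e := by
    intro e
    induction e with
    | _ x y => exact fun he => hm x y ((hPmem x y).mp he).2.2
  have hk0 : (0 : ℝ) ≤ k := Nat.cast_nonneg k
  obtain ⟨E, hEP, hgreedy, hconn⟩ := exists_isGreedy pos m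
    (t := 10240 * (2 * (k : ℝ) + 4)) (by linarith) P fun e he => (hPm e he).le
  refine ⟨E, fun x y h => (hPmem x y).mp (hEP h), ?_,
    fun x hx y hy hne => hconn x y ((hPmem x y).mpr ⟨hx, hy, hne⟩)⟩
  rcases E.eq_empty_or_nonempty with hemp | hne
  · rw [hemp, Finset.sum_empty]
    linarith
  obtain ⟨e₀, he₀, hmin⟩ := E.exists_min_image m hne
  have hme₀ := hPm e₀ (hEP he₀)
  set w : ℝ := min (m e₀ / 2) (Λ / 2048) with hw
  have hw0 : 0 < w := lt_min (by linarith) (by linarith)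
  have hw1 : w ≤ m e₀ / 2 := min_le_left _ _
  have hw2 : w ≤ Λ / 2048 := min_le_right _ _
  have hscale : ∀ n : ℕ, ∃ (J : Type) (_ : Fintype J) (C : J → Set ℝ) (φ : J → ℝ) (K : ℝ),
      IsCover pos m (E.filter fun e => m e ≤ 128 ^ n * w) C φ K ∧ K ≤ 128 * (128 ^ n * w) ∧
      (∀ j, φ j ≤ 2048 * (128 ^ n * w)) ∧
        ∑ j, φ j + (∑ e ∈ E with m e ≤ 128 ^ n * w, m e) / 8 ≤ 2 * Λ := by
    intro n
    induction n with
    | zero =>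
      have hfil : E.filter (fun e => m e ≤ 128 ^ 0 * w) = ∅ := by
        refine Finset.filter_eq_empty_iff.mpr fun e he hle => ?_
        have := hmin e he
        linarith
      obtain ⟨J, hJ, C, φ, h1, h2, h3⟩ := exists_isCover_intervals (m := m) (E := ∅)
        (h := 2048 * w) (by positivity) (by linarith) hpos
      rw [hfil]
      exact ⟨J, hJ, C, φ, 0, h1, by positivity, by simpa using h2, by simpa using h3⟩
    | succ n ih =>
      obtain ⟨J, hJ, C, φ, K, h1, h2, h3, h4⟩ := ih
      obtain ⟨J', hJ', C', φ', K', h1', h2', h3', h4'⟩ := h1.next_scale hN rfl hgreedy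
        (fun x y h => ((hPmem x y).mp (hEP h)).1) (by positivity) h2 h3
      rw [show (128 : ℝ) ^ (n + 1) * w = 128 * (128 ^ n * w) by ring]
      exact ⟨J', hJ', C', φ', K', h1', h2', h3', h4'.trans h4⟩
  obtain ⟨e₁, he₁, hmax⟩ := E.exists_max_image m hne
  obtain ⟨n, hn⟩ := pow_unbounded_of_one_lt (m e₁ / w) (by norm_num : (1 : ℝ) < 128)
  rw [div_lt_iff₀ hw0] at hn
  obtain ⟨J, hJ, C, φ, K, h1, h2, h3, h4⟩ := hscale n
  rw [Finset.filter_true_of_mem fun e he => (hmax e he).trans hn.le] at h4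
  have := Finset.sum_nonneg fun j (_ : j ∈ Finset.univ) => h1.nonneg j
  linarith
end Cover

/-! ### Weighted shortest-path distances -/

section Distance

variable {V : Type*} {G H : SimpleGraph V} {w w' : Sym2 V → ℝ}

lemma walk_weight_nonneg (hw : ∀ e ∈ G.edgeSet, 0 ≤ w e) {u v : V} (p : G.Walk u v) :
    0 ≤ (p.edges.map w).sum := by
  refine List.sum_nonneg fun x hx => ?_
  obtain ⟨e, he, rfl⟩ := List.mem_map.mp hx
  exact hw e (p.edges_subset_edgeSet he)

lemma wdist_nonneg (hw : ∀ e ∈ G.edgeSet, 0 ≤ w e) (u v : V) : 0 ≤ wdist G w u v := by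
  refine Real.sInf_nonneg ?_
  rintro x ⟨p, rfl⟩
  exact walk_weight_nonneg hw p

lemma wdist_le_walk (hw : ∀ e ∈ G.edgeSet, 0 ≤ w e) {u v : V} (p : G.Walk u v) :
    wdist G w u v ≤ (p.edges.map w).sum := by
  refine csInf_le ⟨0, ?_⟩ ⟨p, rfl⟩
  rintro x ⟨q, rfl⟩
  exact walk_weight_nonneg hw q

lemma wdist_comm (G : SimpleGraph V) (w : Sym2 V → ℝ) (u v : V) :
    wdist G w u v = wdist G w v u := by
  have : ∀ u v : V, {x : ℝ | ∃ p : G.Walk u v, x = (p.edges.map w).sum} ⊆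
      {x : ℝ | ∃ p : G.Walk v u, x = (p.edges.map w).sum} := by
    rintro u v x ⟨p, rfl⟩
    refine ⟨p.reverse, ?_⟩
    rw [SimpleGraph.Walk.edges_reverse, List.map_reverse, List.sum_reverse]
  rw [wdist, wdist, (this u v).antisymm (this v u)]

lemma wdist_self (hw : ∀ e ∈ G.edgeSet, 0 ≤ w e) (u : V) : wdist G w u u = 0 :=
  le_antisymm (by simpa using wdist_le_walk hw (.nil : G.Walk u u)) (wdist_nonneg hw u u)

lemma wdist_le_of_edges_subset (hH : ∀ e ∈ H.edgeSet, 0 ≤ w' e) {u v : V} (p : G.Walk u v)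
    (hp : ∀ e ∈ p.edges, e ∈ H.edgeSet) (hle : ∀ e ∈ p.edges, w' e ≤ w e) :
    wdist H w' u v ≤ (p.edges.map w).sum := by
  refine (wdist_le_walk hH (p.transfer H hp)).trans ?_
  rw [SimpleGraph.Walk.edges_transfer]
  exact List.sum_le_sum hle

variable [Finite V]

lemma exists_path_eq_wdist (hG : G.Connected) (hw : ∀ e ∈ G.edgeSet, 0 ≤ w e)
    (u v : V) : ∃ p : G.Walk u v, p.IsPath ∧ (p.edges.map w).sum = wdist G w u v := by
  set S : Set ℝ := {x | ∃ p : G.Walk u v, p.IsPath ∧ x = (p.edges.map w).sum} with hS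
  have hne : S.Nonempty := by
    obtain ⟨p⟩ := hG.preconnected u v
    exact ⟨_, p.bypass, p.bypass_isPath, rfl⟩
  have hfin : S.Finite := by
    refine (Set.finite_range fun A : Finset (Sym2 V) => ∑ e ∈ A, w e).subset ?_
    rintro x ⟨p, hp, rfl⟩
    exact ⟨p.edges.toFinset, List.sum_toFinset w hp.isTrail.edges_nodup⟩
  obtain ⟨p, hp, hpS⟩ := hne.csInf_mem hfin
  refine ⟨p, hp, le_antisymm ?_ (wdist_le_walk hw p)⟩
  obtain ⟨q₀⟩ := hG.preconnected u v
  refine le_csInf ⟨_, q₀, rfl⟩ ?_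
  rintro x ⟨q, rfl⟩
  have h1 : sInf S ≤ (q.bypass.edges.map w).sum :=
    csInf_le hfin.bddBelow ⟨_, q.bypass_isPath, rfl⟩
  rw [← hpS]
  refine h1.trans ?_
  refine (q.edges_bypass_sublist_edges.map w).sum_le_sum fun x hx => ?_
  obtain ⟨e, he, rfl⟩ := List.mem_map.mp hx
  exact hw e (q.edges_subset_edgeSet he)

lemma wdist_triangle (hG : G.Connected) (hw : ∀ e ∈ G.edgeSet, 0 ≤ w e) (u v x : V) :
    wdist G w u x ≤ wdist G w u v + wdist G w v x := by
  obtain ⟨p, -, hp⟩ := exists_path_eq_wdist hG hw u v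
  obtain ⟨q, -, hq⟩ := exists_path_eq_wdist hG hw v x
  refine (wdist_le_walk hw (p.append q)).trans ?_
  rw [SimpleGraph.Walk.edges_append, List.map_append, List.sum_append, hp, hq]

lemma wdist_pos (hG : G.Connected) (hw : ∀ e ∈ G.edgeSet, 0 < w e) {u v : V} (huv : u ≠ v) :
    0 < wdist G w u v := by
  obtain ⟨p, -, hp⟩ := exists_path_eq_wdist hG (fun e he => (hw e he).le) u v
  rw [← hp]
  refine List.sum_pos _ ?_ ?_
  · intro x hx
    obtain ⟨e, he, rfl⟩ := List.mem_map.mp hx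
    exact hw e (p.edges_subset_edgeSet he)
  · intro h
    rw [List.map_eq_nil_iff] at h
    exact huv (SimpleGraph.Walk.edges_eq_nil.mp h).eq

lemma wdist_anti (hGH : G ≤ H) (hG : G.Connected) (hw : ∀ e ∈ H.edgeSet, 0 ≤ w e) (u v : V) :
    wdist H w u v ≤ wdist G w u v := by
  have hw' : ∀ e ∈ G.edgeSet, 0 ≤ w e :=
    fun e he => hw e (SimpleGraph.edgeSet_mono hGH he)
  obtain ⟨p, -, hp⟩ := exists_path_eq_wdist hG hw' u v
  rw [← hp]
  exact wdist_le_of_edges_subset hw p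
    (fun e he => SimpleGraph.edgeSet_mono hGH (p.edges_subset_edgeSet he)) fun _ _ => le_rfl

lemma wdist_le_mul (hG : G.Connected) (hw : ∀ e ∈ G.edgeSet, 0 ≤ w e)
    (hw' : ∀ e ∈ G.edgeSet, 0 ≤ w' e) {l : ℝ} (hle : ∀ e ∈ G.edgeSet, w' e ≤ l * w e) (u v : V) :
    wdist G w' u v ≤ l * wdist G w u v := by
  obtain ⟨p, -, hp⟩ := exists_path_eq_wdist hG hw u v
  rw [← hp, ← List.sum_map_mul_left]
  exact (wdist_le_walk hw' p).trans
    (List.sum_le_sum fun e he => hle e (p.edges_subset_edgeSet he))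

end Distance

/-! ### Embedding a tree into a line -/

section Embedding

variable {V : Type*} {T : SimpleGraph V} {w : Sym2 V → ℝ}

lemma exists_line_embedding_finset (hT : T.Connected) (hw : ∀ e ∈ T.edgeSet, 0 ≤ w e) [Fintype V]
    {n : ℕ} (hn : 1 ≤ n) (hnV : n ≤ Fintype.card V) :
    ∃ (S : Finset V) (A : Finset (Sym2 V)) (pos : V → ℝ), #S = n ∧
      (∀ e ∈ A, e ∈ T.edgeSet ∧ ∀ v ∈ e, v ∈ S) ∧
      (∀ v ∈ S, 0 ≤ pos v ∧ pos v ≤ 2 * ∑ e ∈ A, w e) ∧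
      ∀ x ∈ S, ∀ y ∈ S, wdist T w x y ≤ |pos x - pos y| := by
  induction n, hn using Nat.le_induction with
  | base =>
    obtain ⟨v⟩ := hT.nonempty
    refine ⟨{v}, ∅, fun _ => 0, by simp, by simp, by simp, ?_⟩
    intro x hx y hy
    rw [mem_singleton.mp hx, mem_singleton.mp hy, wdist_self hw]
    simp
  | succ n hn ih =>
    obtain ⟨S, A, pos, hS, hA, hpos, hd⟩ := ih (by omega)
    obtain ⟨a, ha⟩ : S.Nonempty := card_pos.mp (by omega)
    obtain ⟨b, hb⟩ : ∃ b, b ∉ S := by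
      by_contra! h
      rw [eq_univ_iff_forall.mpr h, card_univ] at hS
      omega
    obtain ⟨p⟩ := hT.preconnected a b
    obtain ⟨d, -, hy, hx⟩ := p.exists_boundary_dart S ha hb
    set y := d.fst
    set x := d.snd
    have hadj : s(y, x) ∈ T.edgeSet := d.adj
    have hw0 := hw _ hadj
    set c := w s(y, x) with hc
    have hy : y ∈ S := hy
    have hx : x ∉ S := hx
    have hyx : y ≠ x := fun h => hx (h ▸ hy)
    have hdxy : wdist T w y x ≤ c := by
      simpa using wdist_le_walk hw (SimpleGraph.Walk.cons d.adj .nil)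
    have hsum : ∑ e ∈ insert s(y, x) A, w e = c + ∑ e ∈ A, w e := by
      rw [sum_insert]
      exact fun h => hx ((hA _ h).2 x (Sym2.mem_mk_right _ _))
    set pos' : V → ℝ := fun z =>
      if z = x then pos y + c else if pos y < pos z then pos z + 2 * c else pos z with hpos'
    have hposx : pos' x = pos y + c := by simp [hpos']
    have hposS : ∀ z ∈ S, pos' z = if pos y < pos z then pos z + 2 * c else pos z := by
      intro z hz
      have : z ≠ x := fun h => hx (h ▸ hz)
      simp [hpos', this]
    have hexp : ∀ z ∈ S, wdist T w x z ≤ |pos' x - pos' z| := by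
      intro z hz
      have h1 := wdist_triangle hT hw x y z
      rw [wdist_comm T w x y] at h1
      have h2 := hd y hy z hz
      rw [hposx, hposS z hz]
      split_ifs with h
      · rw [abs_of_neg (by linarith)] at h2 ⊢
        linarith
      · rw [abs_of_nonneg (by linarith)] at h2 ⊢
        linarith
    refine ⟨insert x S, insert s(y, x) A, pos', by rw [card_insert_of_notMem hx, hS], ?_, ?_, ?_⟩
    · intro e he
      rcases mem_insert.mp he with rfl | he
      · refine ⟨hadj, fun v hv => ?_⟩
        rcases Sym2.mem_iff.mp hv with rfl | rfl
        · exact mem_insert_of_mem hy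
        · exact mem_insert_self _ _
      · exact ⟨(hA e he).1, fun v hv => mem_insert_of_mem ((hA e he).2 v hv)⟩
    · intro v hv
      rw [hsum]
      rcases mem_insert.mp hv with rfl | hv
      · rw [hposx]
        have := hpos y hy
        constructor <;> linarith
      · have := hpos v hv
        rw [hposS v hv]
        split_ifs <;> constructor <;> linarith
    · intro u hu v hv
      rcases mem_insert.mp hu with rfl | hu <;> rcases mem_insert.mp hv with rfl | hv
      · rw [wdist_self hw]
        positivity
      · exact hexp v hv
      · rw [wdist_comm, abs_sub_comm]
        exact hexp u hu
      · refine (hd u hu v hv).trans ?_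
        rw [hposS u hu, hposS v hv]
        split_ifs with h1 h2 h2
        · exact le_of_eq (by ring_nf)
        · rw [abs_of_nonneg (by linarith), abs_of_nonneg (by linarith)]
          linarith
        · rw [abs_of_nonpos (by linarith), abs_of_nonpos (by linarith)]
          linarith
        · exact le_rfl

/-- A connected graph of total weight `L` embeds into the interval `[0, 2L]` without contracting
distances. -/
lemma exists_line_embedding [Fintype V] (hT : T.Connected) (hw : ∀ e ∈ T.edgeSet, 0 ≤ w e) :
    ∃ pos : V → ℝ, (∀ v, 0 ≤ pos v ∧ pos v ≤ 2 * wWeight T w) ∧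
      ∀ x y, wdist T w x y ≤ |pos x - pos y| := by
  have := hT.nonempty
  obtain ⟨S, A, pos, hS, hA, hpos, hd⟩ :=
    exists_line_embedding_finset hT hw (Fintype.card_pos (α := V)) le_rfl
  have hS := (card_eq_iff_eq_univ S).mp hS
  subst hS
  have hsum : ∑ e ∈ A, w e ≤ wWeight T w := by
    refine sum_le_sum_of_subset_of_nonneg (fun e he => ?_) fun e he _ => ?_
    · simpa using (hA e he).1
    · exact hw e (by simpa using he)
  refine ⟨pos, fun v => ⟨(hpos v (mem_univ v)).1, (hpos v (mem_univ v)).2.trans (by linarith)⟩,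
    fun x y => hd x (mem_univ x) y (mem_univ y)⟩

end Embedding

/-! ### Hanging points on a line -/

section Hanging

variable {V : Type*} {pos δ : V → ℝ} {Λ : ℝ}

lemma exists_separated_subset (hδ : ∀ v, 0 ≤ δ v) (S : Finset V) :
    ∃ B ⊆ S, (∀ v ∈ S, ∃ b ∈ B, δ b ≤ δ v ∧ |pos v - pos b| ≤ δ v) ∧
      ∀ b ∈ B, ∀ b' ∈ B, b ≠ b' → max (δ b) (δ b') ≤ |pos b - pos b'| := by
  induction S using Finset.induction_on_max_value δ with
  | empty => exact ⟨∅, by simp, by simp, by simp⟩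
  | insert a s ha hmax ih =>
    obtain ⟨B, hBs, hcov, hsep⟩ := ih
    by_cases h : ∃ b ∈ B, |pos a - pos b| ≤ δ a
    · obtain ⟨b, hb, hab⟩ := h
      refine ⟨B, hBs.trans (subset_insert _ _), fun v hv => ?_, hsep⟩
      rcases mem_insert.mp hv with rfl | hv
      · exact ⟨b, hb, hmax b (hBs hb), hab⟩
      · exact hcov v hv
    · push Not at h
      refine ⟨insert a B, insert_subset_insert _ hBs, fun v hv => ?_, ?_⟩
      · rcases mem_insert.mp hv with rfl | hv
        · exact ⟨v, mem_insert_self _ _, le_rfl, by simpa using hδ v⟩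
        · obtain ⟨b, hb, h⟩ := hcov v hv
          exact ⟨b, mem_insert_of_mem hb, h⟩
      · intro b hbB b' hbB' hne
        rcases mem_insert.mp hbB with rfl | hb <;> rcases mem_insert.mp hbB' with rfl | hb'
        · exact absurd rfl hne
        · exact max_le (h b' hb').le ((hmax b' (hBs hb')).trans (h b' hb').le)
        · rw [abs_sub_comm]
          exact max_le ((hmax b (hBs hb)).trans (h b hb).le) (h b hb).le
        · exact hsep b hb b' hb' hne

lemma sum_le_of_separated (B : Finset V) (hpos : ∀ v ∈ B, 0 ≤ pos v) (hδ : ∀ v, δ v ≤ Λ)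
    (hΛ : 0 ≤ Λ)
    (hsep : ∀ b ∈ B, ∀ b' ∈ B, b ≠ b' → max (δ b) (δ b') ≤ |pos b - pos b'|) {p : ℝ}
    (hp : 0 ≤ p) (hBp : ∀ b ∈ B, pos b ≤ p) : ∑ b ∈ B, δ b ≤ p + Λ := by
  induction B using Finset.induction_on_max_value pos generalizing p with
  | empty => simpa using by positivity
  | insert a s ha hmax ih =>
    rw [sum_insert ha]
    rcases s.eq_empty_or_nonempty with rfl | ⟨c, hc⟩
    · have := hδ a
      simp only [sum_empty]
      linarith
    · have hle : ∀ b ∈ s, pos b ≤ pos a - δ a := by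
        intro b hb
        have h1 := hsep a (mem_insert_self _ _) b (mem_insert_of_mem hb) fun h => ha (h ▸ hb)
        rw [abs_of_nonneg (by linarith [hmax b hb])] at h1
        linarith [le_max_left (δ a) (δ b)]
      have h1 := ih (fun v hv => hpos v (mem_insert_of_mem hv))
        (fun b hb b' hb' => hsep b (mem_insert_of_mem hb) b' (mem_insert_of_mem hb'))
        ((hpos c (mem_insert_of_mem hc)).trans (hle c hc)) hle
      linarith [hBp a (mem_insert_self _ _)]

lemma exists_hanging_subset [Fintype V] {p : ℝ} (hp : 0 ≤ p) (hpos : ∀ v, 0 ≤ pos v ∧ pos v ≤ p)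
    (hΛ : 0 ≤ Λ) (hδ : ∀ v, 0 ≤ δ v ∧ δ v ≤ Λ) :
    ∃ B : Finset V, (∀ v, ∃ b ∈ B, δ b ≤ δ v ∧ |pos v - pos b| ≤ δ v) ∧
      ∑ b ∈ B, δ b ≤ p + Λ := by
  obtain ⟨B, -, hcov, hsep⟩ := exists_separated_subset (pos := pos) (fun v => (hδ v).1) univ
  exact ⟨B, fun v => hcov v (mem_univ v), sum_le_of_separated B (fun v _ => (hpos v).1)
    (fun v => (hδ v).2) hΛ hsep hp fun b _ => (hpos b).2⟩

end Hanging

/-! ### Nets -/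

section Net

/-- Greedily selecting disjoint balls in order of increasing radius. -/
lemma exists_disjoint_balls {V : Type*} [Fintype V] (d : V → V → ℝ) (R : V → ℝ)
    (hself : ∀ v, d v v = 0) (hR : ∀ v, 0 ≤ R v) (hcomm : ∀ u v, d u v = d v u)
    (htri : ∀ u v x, d u x ≤ d u v + d v x) (S : Finset V) :
    ∃ N ⊆ S, (∀ v ∈ S, ∃ x ∈ N, d v x ≤ 2 * R v) ∧
      ∀ x ∈ N, ∀ y ∈ N, x ≠ y →
        Disjoint (univ.filter fun u => d u x ≤ R x) (univ.filter fun u => d u y ≤ R y) := by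
  induction S using Finset.induction_on_max_value R with
  | empty => exact ⟨∅, by simp, by simp, by simp⟩
  | insert a s ha hmax ih =>
    obtain ⟨N, hNs, hcov, hdis⟩ := ih
    by_cases h : ∃ b ∈ N, d a b ≤ 2 * R a
    · refine ⟨N, hNs.trans (subset_insert _ _), fun v hv => ?_, hdis⟩
      rcases mem_insert.mp hv with rfl | hv
      · exact h
      · exact hcov v hv
    · push Not at h
      have key : ∀ b ∈ N,
          Disjoint (univ.filter fun u => d u a ≤ R a) (univ.filter fun u => d u b ≤ R b) := by
        intro b hb
        rw [disjoint_left]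
        intro u hu hu'
        rw [mem_filter] at hu hu'
        have h1 := htri a u b
        rw [hcomm a u] at h1
        linarith [h b hb, hmax b (hNs hb), hu.2, hu'.2]
      refine ⟨insert a N, insert_subset_insert _ hNs, fun v hv => ?_, ?_⟩
      · rcases mem_insert.mp hv with rfl | hv
        · exact ⟨v, mem_insert_self _ _, by rw [hself]; linarith [hR v]⟩
        · obtain ⟨b, hb, h⟩ := hcov v hv
          exact ⟨b, mem_insert_of_mem hb, h⟩
      · intro b hbB b' hbB' hne
        rcases mem_insert.mp hbB with rfl | hb <;> rcases mem_insert.mp hbB' with rfl | hb'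
        · exact absurd rfl hne
        · exact key b' hb'
        · exact (key b hb).symm
        · exact hdis b hb b' hb' hne

lemma exists_net {V : Type*} [Fintype V] [Nonempty V] (d : V → V → ℝ) (R : V → ℝ)
    (hself : ∀ v, d v v = 0) (hR : ∀ v, 0 ≤ R v) (hcomm : ∀ u v, d u v = d v u)
    (htri : ∀ u v x, d u x ≤ d u v + d v x) {η : ℝ}
    (hball : ∀ v, η * Fintype.card V ≤ #{u | d u v ≤ R v}) :
    ∃ N : Finset V, η * #N ≤ 1 ∧ ∀ v, ∃ x ∈ N, d v x ≤ 2 * R v := by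
  obtain ⟨N, -, hcov, hdis⟩ := exists_disjoint_balls d R hself hR hcomm htri univ
  refine ⟨N, ?_, fun v => hcov v (mem_univ v)⟩
  have h1 : ∑ x ∈ N, #{u | d u x ≤ R x} ≤ Fintype.card V := by
    rw [← card_biUnion (fun x hx y hy h => hdis x hx y hy h)]
    exact card_le_univ _
  have h2 : (#N : ℝ) * (η * Fintype.card V) ≤ Fintype.card V := by
    rw [← nsmul_eq_mul]
    refine (card_nsmul_le_sum N (fun x => (#{u | d u x ≤ R x} : ℝ)) _ fun x _ => hball x).trans ?_
    exact_mod_cast h1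
  have h3 : (0 : ℝ) < Fintype.card V := by exact_mod_cast Fintype.card_pos
  refine le_of_mul_le_mul_right ?_ h3
  linarith

variable {V : Type*} [Fintype V] {G : SimpleGraph V} {w : Sym2 V → ℝ}

lemma Rgraph_nonneg (v : V) (η : ℝ) : 0 ≤ Rgraph G w v η :=
  Real.sInf_nonneg fun _ h => h.1

lemma exists_mem_Rgraph (hw : ∀ e ∈ G.edgeSet, 0 ≤ w e) (v : V) {η : ℝ} (hη : η ≤ 1) :
    ({r : ℝ | 0 ≤ r ∧ η * (Fintype.card V : ℝ) ≤
      ((Finset.univ.filter (fun u => wdist G w u v ≤ r)).card : ℝ)}).Nonempty := by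
  refine ⟨∑ u, wdist G w u v, sum_nonneg fun u _ => wdist_nonneg hw u v, ?_⟩
  rw [filter_true_of_mem, card_univ]
  · exact mul_le_of_le_one_left (by positivity) hη
  · exact fun u _ => single_le_sum (f := fun u => wdist G w u v)
      (fun u _ => wdist_nonneg hw u v) (mem_univ u)

/-- The infimum defining `Rgraph` is attained. -/
lemma le_card_ball_Rgraph (hw : ∀ e ∈ G.edgeSet, 0 ≤ w e) (v : V) {η : ℝ} (hη : η ≤ 1) :
    η * Fintype.card V ≤ #{u | wdist G w u v ≤ Rgraph G w v η} := by
  by_contra! hlt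
  set R := Rgraph G w v η with hR
  have hne := exists_mem_Rgraph hw v hη
  have hF : ({u | R < wdist G w u v} : Finset V).Nonempty := by
    by_contra! hF
    obtain ⟨r, -, hr⟩ := hne
    refine hlt.not_ge (hr.trans ?_)
    refine Nat.cast_le.mpr (card_le_card fun u _ => ?_)
    by_contra hu
    have : u ∈ ({u | R < wdist G w u v} : Finset V) := by simpa using hu
    simp [hF] at this
  obtain ⟨u, hu, hmin⟩ := exists_min_image _ (fun u => wdist G w u v) hF
  rw [mem_filter] at hu
  refine hu.2.not_ge (le_csInf hne fun r ⟨_, hr⟩ => ?_)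
  by_contra! hru
  refine hlt.not_ge (hr.trans ?_)
  refine Nat.cast_le.mpr (card_le_card fun z hz => ?_)
  rw [mem_filter] at hz ⊢
  refine ⟨mem_univ z, ?_⟩
  by_contra! hzR
  linarith [hmin z (by simpa using hzR), hz.2]

lemma Rgraph_mono (hw : ∀ e ∈ G.edgeSet, 0 ≤ w e) (v : V) {η η' : ℝ} (h : η ≤ η') (hη : η' ≤ 1) :
    Rgraph G w v η ≤ Rgraph G w v η' :=
  csInf_le_csInf ⟨0, fun _ h => h.1⟩ (exists_mem_Rgraph hw v hη) fun _ hr =>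
    ⟨hr.1, (mul_le_mul_of_nonneg_right h (by positivity)).trans hr.2⟩

lemma Rgraph_nonpos (hw : ∀ e ∈ G.edgeSet, 0 ≤ w e) (v : V) {η : ℝ}
    (hη : η * Fintype.card V ≤ 1) : Rgraph G w v η ≤ 0 := by
  refine csInf_le ⟨0, fun _ h => h.1⟩ ⟨le_rfl, hη.trans ?_⟩
  rw [Nat.one_le_cast, Nat.one_le_iff_ne_zero, card_ne_zero]
  exact ⟨v, by simp [wdist_self hw]⟩

end Net

/-! ### A spanner for pairs at a fixed scale -/

section Level

lemma sum_biUnion_le {ι α : Type*} [DecidableEq α] (F : Finset ι) (A : ι → Finset α) {f : α → ℝ}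
    (hf : ∀ i ∈ F, ∀ a ∈ A i, 0 ≤ f a) :
    ∑ a ∈ F.biUnion A, f a ≤ ∑ i ∈ F, ∑ a ∈ A i, f a := by
  have h : F.biUnion A = (F.sigma A).image Sigma.snd := by
    ext a
    simp
  rw [h, sum_sigma']
  refine sum_image_le_of_nonneg fun a ha => ?_
  obtain ⟨⟨i, a⟩, hi, rfl⟩ := mem_image.mp ha
  exact hf i (mem_sigma.mp hi).1 a (mem_sigma.mp hi).2

lemma LineConn.le_of_metric {V : Type*} {pos : V → ℝ} {m : Sym2 V → ℝ} {E : Finset (Sym2 V)}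
    {d : V → V → ℝ} (htri : ∀ x y z, d x z ≤ d x y + d y z) (hpos : ∀ x y, d x y ≤ |pos x - pos y|)
    (hE : ∀ x y, s(x, y) ∈ E → d x y ≤ m s(x, y)) {x : V} {s' r : ℝ}
    (h : LineConn pos m E (pos x) s' r) (y : V) : d x y ≤ r + |s' - pos y| := by
  induction h generalizing y with
  | @walk s' _ h => linarith [hpos x y, abs_sub_le (pos x) s' (pos y)]
  | @jump s' _ _ a b _ he hle ih =>
    have h1 := ih a
    rw [sub_self, abs_zero] at h1
    linarith [htri x a y, htri a b y, hE a b he, hpos b y, abs_sub_le (pos b) s' (pos y)]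

variable {V : Type*} [Fintype V] {G T : SimpleGraph V} {w : Sym2 V → ℝ}

/-- Adding shortest paths for a light family of pairs. Edges outside `T` are penalized by the
factor `l`. -/
lemma exists_path_family (hG : G.Connected) (hw : ∀ e ∈ G.edgeSet, 0 < w e) {l : ℝ} (hl : 1 ≤ l)
    (F : Finset (Sym2 V)) (m : Sym2 V → ℝ)
    (hm : ∀ x y, m s(x, y) = wdist G (fun e => if e ∈ T.edgeSet then w e else l * w e) x y) :
    ∃ D : Finset (Sym2 V), (∀ e ∈ D, e ∈ G.edgeSet) ∧ l * ∑ e ∈ D, w e ≤ ∑ e ∈ F, m e ∧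
      ∀ H : SimpleGraph V, T ≤ H → H ≤ G → (∀ e ∈ D, e ∈ H.edgeSet) →
        ∀ x y, s(x, y) ∈ F → wdist H w x y ≤ m s(x, y) := by
  set w' : Sym2 V → ℝ := fun e => if e ∈ T.edgeSet then w e else l * w e with hw'
  have hww' : ∀ e ∈ G.edgeSet, w e ≤ w' e := by
    intro e he
    have := hw e he
    simp only [hw']
    split_ifs <;> nlinarith
  have hw'0 : ∀ e ∈ G.edgeSet, 0 ≤ w' e := fun e he => (hw e he).le.trans (hww' e he)
  have hA : ∀ e : Sym2 V, ∃ A : Finset (Sym2 V), (∀ e' ∈ A, e' ∈ G.edgeSet) ∧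
      ∑ e' ∈ A, w' e' = m e ∧ ∃ x y, e = s(x, y) ∧ ∀ H : SimpleGraph V, H ≤ G →
        (∀ e' ∈ A, e' ∈ H.edgeSet) → wdist H w x y ≤ m e := by
    intro e
    induction e with
    | _ x y =>
      obtain ⟨p, hp, hpd⟩ := exists_path_eq_wdist hG hw'0 x y
      have hsum : ∑ e' ∈ p.edges.toFinset, w' e' = m s(x, y) := by
        rw [List.sum_toFinset w' hp.isTrail.edges_nodup, hpd, hm]
      refine ⟨p.edges.toFinset, fun e he => p.edges_subset_edgeSet (List.mem_toFinset.mp he), hsum,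
        x, y, rfl, fun H hHG hH => ?_⟩
      rw [hm, ← hpd]
      exact wdist_le_of_edges_subset
        (fun e he => (hw e (SimpleGraph.edgeSet_mono hHG he)).le) p
        (fun e he => hH e (List.mem_toFinset.mpr he))
        fun e he => hww' e (p.edges_subset_edgeSet he)
  choose A hAG hAm hAH using hA
  refine ⟨(F.biUnion A).filter (· ∉ T.edgeSet), ?_, ?_, ?_⟩
  · intro e he
    obtain ⟨f, -, hef⟩ := mem_biUnion.mp (mem_filter.mp he).1
    exact hAG f e hef
  · calc l * ∑ e ∈ (F.biUnion A).filter (· ∉ T.edgeSet), w e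
        = ∑ e ∈ (F.biUnion A).filter (· ∉ T.edgeSet), w' e := by
          rw [mul_sum]
          refine sum_congr rfl fun e he => ?_
          simp [hw', (mem_filter.mp he).2]
      _ ≤ ∑ e ∈ F.biUnion A, w' e := by
          refine sum_le_sum_of_subset_of_nonneg (filter_subset _ _) fun e he _ => ?_
          obtain ⟨f, -, hef⟩ := mem_biUnion.mp he
          exact hw'0 e (hAG f e hef)
      _ ≤ ∑ f ∈ F, ∑ e ∈ A f, w' e := by
          refine sum_biUnion_le F A fun f _ e he => hw'0 e (hAG f e he)
      _ = ∑ f ∈ F, m f := sum_congr rfl fun f _ => hAm f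
  · intro H hTH hHG hDH x y hxy
    obtain ⟨a, b, hab, h⟩ := hAH s(x, y)
    have h1 := h H hHG fun e he => by
      by_cases heT : e ∈ T.edgeSet
      · exact SimpleGraph.edgeSet_mono hTH heT
      · exact hDH e (mem_filter.mpr ⟨mem_biUnion.mpr ⟨_, hxy, he⟩, heT⟩)
    rcases Sym2.eq_iff.mp hab with ⟨rfl, rfl⟩ | ⟨rfl, rfl⟩
    · exact h1
    · rwa [wdist_comm]

/-- A light set of edges whose addition to the spanning graph `T` yields small distortion for all
pairs of vertices that are mutually `η`-far. -/
lemma exists_light_edges_of_far (hG : G.Connected) (hw : ∀ e ∈ G.edgeSet, 0 < w e) (hTG : T ≤ G)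
    (hT : T.Connected) (hL : 0 < wWeight T w) {l : ℝ} (hl : 1 ≤ l) {k : ℕ} {η : ℝ}
    (hη : η * 2 ^ k = 1) :
    ∃ D : Finset (Sym2 V), (∀ e ∈ D, e ∈ G.edgeSet) ∧ l * ∑ e ∈ D, w e ≤ 36 * wWeight T w ∧
      ∀ H : SimpleGraph V, T ≤ H → H ≤ G → (∀ e ∈ D, e ∈ H.edgeSet) → ∀ u v,
        Rgraph G w u η ≤ wdist G w u v → Rgraph G w v η ≤ wdist G w u v →
        wdist H w u v ≤ 17 * (10240 * (2 * k + 4)) * l * wdist G w u v := by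
  have hV := hG.nonempty
  have hw0 : ∀ e ∈ G.edgeSet, 0 ≤ w e := fun e he => (hw e he).le
  have hwT : ∀ e ∈ T.edgeSet, 0 ≤ w e := fun e he => hw0 e (SimpleGraph.edgeSet_mono hTG he)
  set L := wWeight T w
  obtain ⟨pos, hpos, hposd⟩ := exists_line_embedding hT hwT
  set w' : Sym2 V → ℝ := fun e => if e ∈ T.edgeSet then w e else l * w e with hw'
  have hw'pos : ∀ e ∈ G.edgeSet, 0 < w' e := by
    intro e he
    have := hw e he
    simp only [hw']
    split_ifs <;> positivity
  have hw'0 : ∀ e ∈ G.edgeSet, 0 ≤ w' e := fun e he => (hw'pos e he).le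
  have hd'pos : ∀ x y, wdist G w' x y ≤ |pos x - pos y| := by
    intro x y
    refine (wdist_anti hTG hT hw'0 x y).trans ?_
    refine (wdist_le_mul hT hwT (fun e he => hw'0 e (SimpleGraph.edgeSet_mono hTG he))
      (l := 1) (fun e he => ?_) x y).trans ((one_mul _).trans_le (hposd x y))
    simp [hw', he]
  have hd'l : ∀ x y, wdist G w' x y ≤ l * wdist G w x y := by
    refine wdist_le_mul hG hw0 hw'0 fun e he => ?_
    have := hw e he
    simp only [hw']
    split_ifs <;> nlinarith
  set m : Sym2 V → ℝ := Sym2.lift ⟨wdist G w', wdist_comm G w'⟩ with hm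
  have hms : ∀ x y, m s(x, y) = wdist G w' x y := fun x y => rfl
  have hη0 : 0 < η := by
    by_contra! h
    have : (0 : ℝ) < 2 ^ k := by positivity
    nlinarith
  have hη1 : η ≤ 1 := by
    have : (1 : ℝ) ≤ 2 ^ k := one_le_pow₀ one_le_two
    nlinarith
  obtain ⟨N, hN, hnet⟩ := exists_net (fun u v => wdist G w u v) (fun v => Rgraph G w v η)
    (wdist_self hw0) (fun v => Rgraph_nonneg v η) (wdist_comm G w)
    (fun u v x => wdist_triangle hG hw0 u v x) (fun v => le_card_ball_Rgraph hw0 v hη1)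
  have hNk : #N ≤ 2 ^ k := by
    rw [← hη] at hN
    exact_mod_cast le_of_mul_le_mul_left hN hη0
  obtain ⟨E, hEN, hEsum, hEconn⟩ := exists_light_line_spanner (m := m) (by positivity) hpos
    (fun x y hxy => by rw [hms]; exact wdist_pos hG hw'pos hxy) hNk
  have hNne : N.Nonempty := by
    obtain ⟨v⟩ := hV
    obtain ⟨x, hx, -⟩ := hnet v
    exact ⟨x, hx⟩
  choose near hnearN hnear using fun v => exists_min_image N (fun x => wdist G w' v x) hNne
  set δ : V → ℝ := fun v => wdist G w' v (near v) with hδ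
  have hδ0 : ∀ v, 0 ≤ δ v ∧ δ v ≤ 2 * L := by
    refine fun v => ⟨wdist_nonneg hw'0 _ _, (hd'pos _ _).trans ?_⟩
    rw [abs_le]
    constructor <;> linarith [hpos v, hpos (near v)]
  obtain ⟨B, hB, hBsum⟩ := exists_hanging_subset (pos := pos) (by positivity) hpos
    (by positivity) hδ0
  obtain ⟨D, hDG, hDsum, hD⟩ := exists_path_family (T := T) hG hw hl
    (E ∪ B.image fun b => s(b, near b)) m hms
  refine ⟨D, hDG, hDsum.trans ?_, fun H hTH hHG hDH u v hu hv => ?_⟩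
  · have h0 : ∀ e, 0 ≤ m e := by
      intro e
      induction e with
      | _ x y => exact wdist_nonneg hw'0 x y
    have h1 : ∑ e ∈ E ∪ B.image (fun b => s(b, near b)), m e ≤
        ∑ e ∈ E, m e + ∑ e ∈ B.image (fun b => s(b, near b)), m e := by
      rw [← sum_union_inter]
      exact le_add_of_nonneg_right (sum_nonneg fun e _ => h0 e)
    have h2 : ∑ e ∈ B.image (fun b => s(b, near b)), m e ≤ ∑ b ∈ B, δ b :=
      sum_image_le_of_nonneg fun e _ => h0 e
    linarith
  · have hH : H.Connected := hT.mono hTH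
    have hwH : ∀ e ∈ H.edgeSet, 0 ≤ w e := fun e he => hw0 e (SimpleGraph.edgeSet_mono hHG he)
    have hHpos : ∀ x y, wdist H w x y ≤ |pos x - pos y| := fun x y =>
      (wdist_anti hTH hT hwH x y).trans (hposd x y)
    have hHtri := wdist_triangle hH hwH
    have hGtri := wdist_triangle hG hw'0
    have hDF := hD H hTH hHG hDH
    set d := wdist G w u v with hd
    have hd0 : 0 ≤ d := wdist_nonneg hw0 u v
    have hnet' : ∀ z, Rgraph G w z η ≤ d → ∃ x ∈ N, wdist H w z x ≤ 4 * (l * d) ∧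
        wdist G w' z x ≤ 4 * (l * d) := by
      intro z hz
      obtain ⟨x, hx, hzx⟩ := hnet z
      have h1 : δ z ≤ 2 * (l * d) := by
        refine (hnear z x hx).trans ((hd'l z x).trans ?_)
        nlinarith
      obtain ⟨b, hb, hbz, hzb⟩ := hB z
      have hbF := hDF b (near b) (mem_union_right _ (mem_image_of_mem _ hb))
      rw [hms] at hbF
      simp only [hδ] at h1 hbz hzb
      exact ⟨near b, hnearN b, by linarith [hHtri z b (near b), hHpos z b],
        by linarith [hGtri z b (near b), hd'pos z b]⟩
    obtain ⟨x, hx, hux, hux'⟩ := hnet' u hu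
    obtain ⟨y, hy, hvy, hvy'⟩ := hnet' v hv
    have hld : 0 ≤ l * d := by positivity
    have hk0 : (0 : ℝ) ≤ k := by positivity
    have hxy : wdist G w' x y ≤ 9 * (l * d) := by
      have h1 := hGtri x u y
      rw [wdist_comm _ _ x u] at h1
      linarith [hGtri u v y, hd'l u v]
    have hHxy : wdist H w x y ≤ 10240 * (2 * k + 4) * (9 * (l * d)) := by
      rcases eq_or_ne x y with rfl | hne
      · rw [wdist_self hwH]
        positivity
      · have h1 := (hEconn x hx y hy hne).le_of_metric hHtri hHpos
          (fun a b hab => hDF a b (mem_union_left _ hab)) y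
        rw [sub_self, abs_zero, add_zero, hms] at h1
        exact h1.trans (mul_le_mul_of_nonneg_left hxy (by positivity))
    have h1 := hHtri u x v
    have h2 := hHtri x y v
    rw [wdist_comm _ _ y v] at h2
    nlinarith [mul_nonneg hk0 hld]

end Level

/-! ### Combining all scales -/

section Assembly

lemma sum_inv_sq_le (I : ℕ) :
    ∑ j ∈ range (I + 1), (1 : ℝ) / ((j : ℝ) + 1) ^ 2 ≤ 2 - 1 / ((I : ℝ) + 1) := by
  induction I with
  | zero => norm_num
  | succ I ih =>
    rw [sum_range_succ]
    have h : (1 : ℝ) / (I + 1 + 1) ^ 2 ≤ 1 / (I + 1) - 1 / (I + 1 + 1) := by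
      rw [div_sub_div _ _ (by positivity) (by positivity),
        div_le_div_iff₀ (by positivity) (by positivity)]
      nlinarith [(Nat.cast_nonneg I : (0 : ℝ) ≤ I)]
    push_cast
    linarith

/-- For `ε ∈ (0, 1)`, rounding `log₂ (2 / ε)` to a power of two. -/
lemma exists_scale {ε : ℝ} (hε : 0 < ε) (hε1 : ε < 1) :
    ∃ j : ℕ, (1 : ℝ) / 2 ^ 2 ^ (j + 1) ≤ ε / 2 ∧ (2 : ℝ) ^ j ≤ Real.logb 2 (2 / ε) ∧
      (j : ℝ) ≤ Real.logb 2 (1 + Real.logb 2 (2 / ε)) := by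
  set x := Real.logb 2 (2 / ε) with hx
  have hx1 : 1 ≤ x := by
    rw [hx, Real.le_logb_iff_rpow_le one_lt_two (by positivity), Real.rpow_one,
      le_div_iff₀ hε]
    linarith
  obtain ⟨j, hj, hj'⟩ := exists_nat_pow_near hx1 one_lt_two
  refine ⟨j, ?_, hj, ?_⟩
  · rw [hx, Real.logb_lt_iff_lt_rpow one_lt_two (by positivity)] at hj'
    have h : (2 : ℝ) ^ ((2 : ℝ) ^ (j + 1)) = 2 ^ 2 ^ (j + 1) := by
      rw [← Real.rpow_natCast 2 (2 ^ (j + 1))]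
      norm_num
    rw [h, div_lt_iff₀ hε] at hj'
    rw [div_le_div_iff₀ (by positivity) two_pos]
    linarith
  · rw [Real.le_logb_iff_rpow_le one_lt_two (by positivity), Real.rpow_natCast]
    linarith

variable {V : Type*} [Fintype V] {G : SimpleGraph V} {w : Sym2 V → ℝ}

lemma exists_spanning_tree_eq_mstWeight (hG : G.Connected) :
    ∃ T : SimpleGraph V, IsSpanningTree G T ∧ mstWeight G w = wWeight T w := by
  have hfin : {x : ℝ | ∃ T : SimpleGraph V, IsSpanningTree G T ∧ x = wWeight T w}.Finite := by
    refine (Set.finite_range fun T : SimpleGraph V => wWeight T w).subset ?_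
    rintro x ⟨T, -, rfl⟩
    exact ⟨T, rfl⟩
  obtain ⟨T, hTG, hT⟩ := hG.exists_isTree_le
  have hne : {x : ℝ | ∃ T : SimpleGraph V, IsSpanningTree G T ∧ x = wWeight T w}.Nonempty :=
    ⟨_, T, ⟨hTG, hT⟩, rfl⟩
  exact hne.csInf_mem hfin

lemma wWeight_pos [Nontrivial V] (hG : G.Connected) (hw : ∀ e ∈ G.edgeSet, 0 < w e) :
    0 < wWeight G w := by
  obtain ⟨v⟩ := hG.nonempty
  obtain ⟨u, hu⟩ := hG.preconnected.exists_adj_of_nontrivial v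
  refine sum_pos (fun e he => hw e (by simpa using he)) ⟨s(v, u), ?_⟩
  simpa using hu

lemma wWeight_sup_fromEdgeSet_le (hw : ∀ e ∈ G.edgeSet, 0 ≤ w e) {T : SimpleGraph V} (hT : T ≤ G)
    {D : Finset (Sym2 V)} (hD : ∀ e ∈ D, e ∈ G.edgeSet) :
    wWeight (T ⊔ SimpleGraph.fromEdgeSet D) w ≤ wWeight T w + ∑ e ∈ D, w e := by
  have hT' : ∀ e ∈ T.edgeSet, 0 ≤ w e := fun e he => hw e (SimpleGraph.edgeSet_mono hT he)
  have h : ∑ e ∈ T.edgeSet.toFinite.toFinset ∪ D, w e ≤ wWeight T w + ∑ e ∈ D, w e := by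
    rw [wWeight, ← sum_union_inter]
    refine le_add_of_nonneg_right (sum_nonneg fun e he => ?_)
    exact hw e (hD e (mem_inter.mp he).2)
  refine le_trans (sum_le_sum_of_subset_of_nonneg (fun e he => ?_) fun e he _ => ?_) h
  · rw [Set.Finite.mem_toFinset, SimpleGraph.edgeSet_sup, SimpleGraph.edgeSet_fromEdgeSet] at he
    rcases he with he | he
    · exact mem_union_left _ (by simpa using he)
    · exact mem_union_right _ (by simpa using he.1)
  · rcases mem_union.mp he with he | he
    · exact hT' e (by simpa using he)
    · exact hw e (hD e he)

lemma exists_light_spanner_of_nontrivial [Nontrivial V] (hG : G.Connected)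
    (hw : ∀ e ∈ G.edgeSet, 0 < w e) {ρ : ℝ} (hρ : 0 < ρ) (hρ1 : ρ < 1) :
    ∃ H : SimpleGraph V, IsSpanner G H ∧ wWeight H w / mstWeight G w ≤ 1 + ρ ∧
      HasCoarseScalingDistortion G H w
        (fun ε => (17 * 10240 * 8 * 72 / ρ) * Real.logb 2 (2 / ε) *
          (1 + Real.logb 2 (1 + Real.logb 2 (2 / ε))) ^ 2) := by
  have hw0 : ∀ e ∈ G.edgeSet, 0 ≤ w e := fun e he => (hw e he).le
  obtain ⟨T, ⟨hTG, hTree⟩, hTw⟩ := exists_spanning_tree_eq_mstWeight (w := w) hG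
  have hT : T.Connected := hTree.connected
  have hL : 0 < wWeight T w :=
    wWeight_pos hT fun e he => hw e (SimpleGraph.edgeSet_mono hTG he)
  set l : ℕ → ℝ := fun j => 72 * (j + 1) ^ 2 / ρ with hl
  have hl1 : ∀ j, 1 ≤ l j := by
    intro j
    rw [hl, one_le_div hρ]
    have : (0 : ℝ) ≤ j := j.cast_nonneg
    nlinarith
  choose D hDG hDsum hD using fun j : ℕ =>
    exists_light_edges_of_far (k := 2 ^ (j + 1)) (η := 1 / 2 ^ 2 ^ (j + 1)) hG hw hTG hT hL (hl1 j)
      (by field_simp)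
  set I := Fintype.card V
  set F := (range (I + 1)).biUnion D with hF
  have hFG : ∀ e ∈ F, e ∈ G.edgeSet := by
    intro e he
    obtain ⟨j, -, hj⟩ := mem_biUnion.mp he
    exact hDG j e hj
  have hFsum : ∑ e ∈ F, w e ≤ ρ * wWeight T w := by
    calc ∑ e ∈ F, w e ≤ ∑ j ∈ range (I + 1), ∑ e ∈ D j, w e :=
          sum_biUnion_le _ _ fun j _ e he => hw0 e (hDG j e he)
      _ ≤ ∑ j ∈ range (I + 1), ρ * wWeight T w / 2 * (1 / ((j : ℝ) + 1) ^ 2) := by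
          refine sum_le_sum fun j _ => ?_
          have h := hDsum j
          rw [hl, ← le_div_iff₀' (by positivity)] at h
          refine h.trans_eq ?_
          field_simp
          ring
      _ ≤ ρ * wWeight T w / 2 * 2 := by
          rw [← mul_sum]
          refine mul_le_mul_of_nonneg_left ?_ (by positivity)
          refine (sum_inv_sq_le I).trans ?_
          have : (0 : ℝ) ≤ 1 / ((I : ℝ) + 1) := by positivity
          linarith
      _ = ρ * wWeight T w := by ring
  set H := T ⊔ SimpleGraph.fromEdgeSet (F : Set (Sym2 V)) with hH
  have hHG : H ≤ G := by
    refine sup_le hTG ?_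
    intro a b hab
    rw [SimpleGraph.fromEdgeSet_adj] at hab
    exact hFG _ hab.1
  have hFH : ∀ e ∈ F, e ∈ H.edgeSet := by
    intro e he
    rw [hH, SimpleGraph.edgeSet_sup, SimpleGraph.edgeSet_fromEdgeSet]
    exact Or.inr ⟨he, SimpleGraph.not_isDiag_of_mem_edgeSet _ (hFG e he)⟩
  refine ⟨H, ⟨hHG, hT.mono le_sup_left⟩, ?_, ?_⟩
  · rw [hTw, div_le_iff₀ hL]
    linarith [wWeight_sup_fromEdgeSet_le hw0 hTG hFG]
  · intro ε hε hε1 u v huv hv hu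
    obtain ⟨j, hjε, hjx, hj⟩ := exists_scale hε hε1
    set x := Real.logb 2 (2 / ε)
    set d := wdist G w u v with hd
    have hd0 : 0 ≤ d := wdist_nonneg hw0 u v
    have hR : ∀ z, Rgraph G w z (ε / 2) ≤ d → Rgraph G w z (1 / 2 ^ 2 ^ (min j I + 1)) ≤ d := by
      intro z hz
      rcases le_total j I with h | h
      · rw [min_eq_left h]
        exact (Rgraph_mono hw0 z hjε (by linarith)).trans hz
      · rw [min_eq_right h]
        refine (Rgraph_nonpos hw0 z ?_).trans hd0
        rw [div_mul_eq_mul_div, one_mul, div_le_one (by positivity)]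
        have h1 : I < 2 ^ (I + 1) := (Nat.lt_succ_self I).trans Nat.lt_two_pow_self
        exact_mod_cast (h1.trans Nat.lt_two_pow_self).le
    have hFD : ∀ e ∈ D (min j I), e ∈ H.edgeSet := fun e he =>
      hFH e (mem_biUnion.mpr ⟨_, mem_range.mpr (Nat.lt_succ_of_le (min_le_right _ _)), he⟩)
    refine (hD (min j I) H le_sup_left hHG hFD u v (hR u hu) (hR v hv)).trans ?_
    refine mul_le_mul_of_nonneg_right ?_ hd0
    set t := min j I
    have htj : t ≤ j := min_le_left _ _
    have h1 : (2 : ℝ) ^ t ≤ x := (pow_le_pow_right₀ one_le_two htj).trans hjx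
    have h2 : (1 : ℝ) ≤ 2 ^ t := one_le_pow₀ one_le_two
    have h3 : ((t : ℝ) + 1) ^ 2 ≤ (1 + Real.logb 2 (1 + x)) ^ 2 := by
      refine pow_le_pow_left₀ (by positivity) ?_ 2
      have : (t : ℝ) ≤ j := by exact_mod_cast htj
      linarith
    calc 17 * (10240 * (2 * ((2 ^ (t + 1) : ℕ) : ℝ) + 4)) * l t
        ≤ 17 * (10240 * (8 * x)) * l t := by
          refine mul_le_mul_of_nonneg_right ?_ (by linarith [hl1 t])
          push_cast
          rw [pow_succ]
          linarith
      _ = 17 * 10240 * 8 * 72 / ρ * x * ((t : ℝ) + 1) ^ 2 := by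
          rw [hl]
          ring
      _ ≤ 17 * 10240 * 8 * 72 / ρ * x * (1 + Real.logb 2 (1 + x)) ^ 2 := by
          refine mul_le_mul_of_nonneg_left h3 ?_
          have : 0 ≤ x := by linarith
          positivity

end Assembly

/-- There is a universal constant `C > 0` such that every weighted graph
`G` and every `0 < ρ < 1` admit a spanner `H` of lightness at most `1 + ρ` with coarse
scaling distortion `γ(ε) = (C/ρ) · log₂(2/ε) · (1 + log₂(1 + log₂(2/ε)))²`. -/
theorem stmt9 :
    ∃ C : ℝ, 0 < C ∧
      ∀ (V : Type) [Fintype V] (G : SimpleGraph V) (w : Sym2 V → ℝ),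
        IsWeightedGraph G w →
        ∀ ρ : ℝ, 0 < ρ → ρ < 1 →
          ∃ H : SimpleGraph V, IsSpanner G H ∧
            wWeight H w / mstWeight G w ≤ 1 + ρ ∧
            HasCoarseScalingDistortion G H w
              (fun ε => (C / ρ) * Real.logb 2 (2 / ε) *
                (1 + Real.logb 2 (1 + Real.logb 2 (2 / ε))) ^ 2) := by
  refine ⟨17 * 10240 * 8 * 72, by norm_num, fun V _ G w hG ρ hρ hρ1 => ?_⟩
  obtain ⟨hconn, hw, -⟩ := hG
  rcases subsingleton_or_nontrivial V with hV | hV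
  · have h0 : wWeight G w = 0 := by
      refine sum_eq_zero fun e he => ?_
      rw [Set.Finite.mem_toFinset] at he
      induction e with
      | _ x y => exact absurd (Subsingleton.elim x y) (SimpleGraph.Adj.ne he)
    refine ⟨G, ⟨le_rfl, hconn⟩, ?_, fun ε _ _ u v huv => absurd (Subsingleton.elim u v) huv⟩
    rw [h0, zero_div]
    linarith
  · exact exists_light_spanner_of_nontrivial hconn hw hρ hρ1
end

section
/- Let μ:ℕ→ℝ be a non-increasing positive function with Σ_{i≥1} μ(i) = 1, and let γ:(0,1)→ℝ≥0 be monotone non-increasing. Let (Y_ι)_{ι∈I} be a family of metric spaces, and suppose that for every finite metric space (Z,d_Z) there exist an index ι ∈ I and a non-contractive map f_Z : Z → Y_ι with coarse scaling distortion γ. Then for every finite metric space (X,d_X) with points enumerated by a priority ranking x_1,…,x_n, there exist an index ι ∈ I and a non-contractive map f : X → Y_ι such that for all 1 ≤ j < i ≤ n, d_{Y_ι}(f(x_j),f(x_i)) ≤ γ(μ(j))·d_X(x_j,x_i). -/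
open Finset

attribute [local instance] Classical.propDecidable

/-- `R(x,ε)`: the minimal radius `r ≥ 0` such that the closed ball `B(x,r)` contains at
least `ε·|X|` points. -/
noncomputable def Rmet (X : Type*) [MetricSpace X] [Fintype X] (x : X) (ε : ℝ) : ℝ :=
  sInf {r : ℝ | 0 ≤ r ∧
    ε * (Fintype.card X : ℝ) ≤ ((Finset.univ.filter (fun z => dist z x ≤ r)).card : ℝ)}

/-- A radius `r ≥ 0` bounds `R(x,ε)` as soon as some finite set inside the closed ball of radius
`r` has at least `ε·|X|` points. -/
theorem Rmet_le_of_subset {X : Type*} [MetricSpace X] [Fintype X] {x : X} {ε r : ℝ} (hr : 0 ≤ r)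
    (s : Finset X) (hs : ∀ z ∈ s, dist z x ≤ r) (hcard : ε * (Fintype.card X : ℝ) ≤ s.card) :
    Rmet X x ε ≤ r := by
  refine csInf_le ⟨0, fun _ h => h.1⟩ ⟨hr, hcard.trans ?_⟩
  exact_mod_cast Finset.card_le_card fun z hz => by simpa using hs z hz

/-- The distances between distinct points of a finite metric space have a positive lower bound. -/
theorem exists_pos_le_dist (X : Type*) [MetricSpace X] [Fintype X] :
    ∃ δ : ℝ, 0 < δ ∧ ∀ x y : X, x ≠ y → δ ≤ dist x y := by
  rcases (Finset.univ.filter fun p : X × X => p.1 ≠ p.2).eq_empty_or_nonempty with h | h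
  · refine ⟨1, one_pos, fun x y hxy => ?_⟩
    have : (x, y) ∈ Finset.univ.filter fun p : X × X => p.1 ≠ p.2 := by simpa using hxy
    simp [h] at this
  · obtain ⟨p, hp, hmin⟩ := Finset.exists_min_image _ (fun p : X × X => dist p.1 p.2) h
    refine ⟨dist p.1 p.2, dist_pos.2 (by simpa using hp), fun x y hxy => ?_⟩
    exact hmin (x, y) (by simpa using hxy)

/-- A finite metric space can be blown up, replacing each point `x` by a cluster of `m x` points,
so that distances between clusters are unchanged and no cluster has diameter larger than a
distance between clusters. -/
theorem exists_metricSpace_blowup {X : Type*} [MetricSpace X] [Fintype X] (m : X → ℕ) :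
    ∃ _ : MetricSpace (Σ x : X, Fin (m x)),
      (∀ p q : Σ x : X, Fin (m x), p.1 ≠ q.1 → dist p q = dist p.1 q.1) ∧
      ∀ p q : Σ x : X, Fin (m x), p.1 = q.1 → ∀ x y : X, x ≠ y → dist p q ≤ dist x y := by
  obtain ⟨δ, hδ, hmin⟩ := exists_pos_le_dist X
  let e : (Σ x : X, Fin (m x)) → X × ℝ := fun p => (p.1, δ * (1 / ((p.2 : ℕ) + 1)))
  have he : Function.Injective e := by
    rintro ⟨x, a⟩ ⟨y, b⟩ h
    obtain ⟨rfl, h⟩ := Prod.mk.inj h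
    have h' := mul_left_cancel₀ hδ.ne' h
    simp only [one_div, inv_inj, add_left_inj, Nat.cast_inj] at h'
    rw [Fin.ext h']
  have hsnd : ∀ p q, dist (e p).2 (e q).2 ≤ δ := by
    have hmem : ∀ p, (e p).2 ∈ Set.Icc 0 δ := fun p => by
      refine ⟨by positivity, mul_le_of_le_one_right hδ.le ?_⟩
      exact div_le_one_of_le₀ (by simp) (by positivity)
    intro p q
    simpa using Real.dist_le_of_mem_Icc (hmem p) (hmem q)
  refine ⟨MetricSpace.induced e he inferInstance, fun p q hpq => ?_, fun p q hpq x y hxy => ?_⟩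
  · exact max_eq_left ((hsnd p q).trans (hmin _ _ hpq))
  · refine max_le ?_ ((hsnd p q).trans (hmin _ _ hxy))
    have : (e p).1 = (e q).1 := hpq
    rw [this, dist_self]
    exact dist_nonneg

/-- Coarse scaling distortion implies prioritized distortion: if every
finite metric space embeds non-contractively into some member of the family `Y` with
coarse scaling distortion `γ`, then every finite metric space `X` with a priority ranking
`π` embeds non-contractively into some member of the family with prioritized distortion
`j ↦ γ(μ(j))`, where `μ` is non-increasing, positive, with `Σ_{i≥1} μ(i) = 1`. -/
theorem stmt10 (μ : ℕ → ℝ)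
    (hμpos : ∀ i : ℕ, 1 ≤ i → 0 < μ i) (hμlt : ∀ i : ℕ, 1 ≤ i → μ i < 1)
    (hμanti : ∀ i j : ℕ, 1 ≤ i → i ≤ j → μ j ≤ μ i)
    (hμsum : ∑' i : ℕ, μ (i + 1) = 1)
    (γ : ℝ → ℝ) (hγanti : AntitoneOn γ (Set.Ioo (0 : ℝ) 1))
    (hγ0 : ∀ ε ∈ Set.Ioo (0 : ℝ) 1, 0 ≤ γ ε)
    (I : Type) (Y : I → Type) [∀ ι : I, MetricSpace (Y ι)]
    (hyp : ∀ (Z : Type) [MetricSpace Z] [Fintype Z],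
      ∃ (ι : I) (f : Z → Y ι),
        (∀ x y : Z, dist x y ≤ dist (f x) (f y)) ∧
        (∀ ε : ℝ, 0 < ε → ε < 1 → ∀ x y : Z, x ≠ y →
          Rmet Z y (ε / 2) ≤ dist x y → Rmet Z x (ε / 2) ≤ dist x y →
          dist (f x) (f y) ≤ γ ε * dist x y))
    (X : Type) [MetricSpace X] [Fintype X] (π : Fin (Fintype.card X) ≃ X) :
    ∃ (ι : I) (f : X → Y ι),
      (∀ x y : X, dist x y ≤ dist (f x) (f y)) ∧
      ∀ j i : Fin (Fintype.card X), j < i →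
        dist (f (π j)) (f (π i)) ≤ γ (μ ((j : ℕ) + 1)) * dist (π j) (π i) := by
  have hsummable : Summable fun i : ℕ => μ (i + 1) :=
    by_contra fun h => one_ne_zero (hμsum.symm.trans (tsum_eq_zero_of_not_summable h))
  set w : X → ℝ := fun x => μ ((π.symm x : ℕ) + 1) with hw
  have hwpos : ∀ x, 0 < w x := fun x => hμpos _ (Nat.le_add_left _ _)
  have hwsum : ∑ x, w x ≤ 1 := by
    rw [← Equiv.sum_comp π, ← hμsum]
    simp only [hw, Equiv.symm_apply_apply]
    rw [Fin.sum_univ_eq_sum_range (fun i => μ (i + 1))]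
    exact hsummable.sum_le_tsum _ fun i _ => (hμpos _ (Nat.le_add_left _ _)).le
  obtain ⟨n, hn⟩ : ∃ n, n = Fintype.card X := ⟨_, rfl⟩
  let m : X → ℕ := fun x => ⌊w x * n⌋₊ + 1
  have hm : ∀ x, w x * n ≤ m x := fun x => by
    simpa [m] using (Nat.lt_floor_add_one (w x * n)).le
  have hmsum : ∑ x, (m x : ℝ) ≤ 2 * n := by
    calc ∑ x, (m x : ℝ) ≤ ∑ x, (w x * n + 1) := Finset.sum_le_sum fun x _ => by
          simpa [m] using Nat.floor_le (mul_nonneg (hwpos x).le n.cast_nonneg)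
      _ = (∑ x, w x) * n + n := by
          rw [Finset.sum_add_distrib, ← Finset.sum_mul]; simp [hn]
      _ ≤ 2 * n := by nlinarith [n.cast_nonneg (α := ℝ)]
  obtain ⟨hZ, hinter, hintra⟩ := exists_metricSpace_blowup m
  obtain ⟨ι, f, hf, hfγ⟩ := hyp (Σ x : X, Fin (m x))
  let s : X → Σ x : X, Fin (m x) := fun x => ⟨x, ⟨0, Nat.succ_pos _⟩⟩
  have hs : ∀ x y, dist (s x) (s y) = dist x y := fun x y => by
    rcases eq_or_ne x y with rfl | h
    · simp
    · exact hinter (s x) (s y) h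
  refine ⟨ι, f ∘ s, fun x y => (hs x y).symm.trans_le (hf _ _), fun j i hji => ?_⟩
  have hne : π j ≠ π i := π.injective.ne hji.ne
  have hwj : w (π j) = μ ((j : ℕ) + 1) := by simp [hw]
  have hcluster : ∀ z, (∀ a, dist (⟨π j, a⟩ : Σ x : X, Fin (m x)) z ≤ dist (π j) (π i)) →
      Rmet _ z (μ ((j : ℕ) + 1) / 2) ≤ dist (π j) (π i) := fun z hz => by
    refine Rmet_le_of_subset dist_nonneg (Finset.univ.map (Function.Embedding.sigmaMk (π j)))
      (by simpa using hz) ?_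
    rw [Finset.card_map, Finset.card_univ, Fintype.card_fin, Fintype.card_sigma, ← hwj]
    simp only [Fintype.card_fin, Nat.cast_sum]
    nlinarith [hm (π j), mul_le_mul_of_nonneg_left hmsum (hwpos (π j)).le]
  have key := hfγ (μ ((j : ℕ) + 1)) (hμpos _ (Nat.le_add_left _ _)) (hμlt _ (Nat.le_add_left _ _))
    (s (π j)) (s (π i)) (fun h => hne (congrArg Sigma.fst h))
  rw [hs] at key
  exact key (hcluster _ fun a => (hinter _ _ hne).le)
    (hcluster _ fun a => hintra ⟨π j, a⟩ (s (π j)) rfl _ _ hne)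
end

section
/- There exists a universal constant C > 0 such that for every real p with 1 ≤ p ≤ ∞, every finite metric space (X,d) with n = |X| ≥ 2 points, and every priority ranking x_1,…,x_n of X, there exist a dimension m ≤ C·log n and a non-contractive map f : X → ℝ^m equipped with the ℓ_p norm, such that for all 1 ≤ j < i ≤ n, ‖f(x_j) − f(x_i)‖_p ≤ C·(1 + log(j+1))·d(x_j,x_i). -/
open Finset

attribute [local instance] Classical.propDecidable

open scoped ENNReal

namespace PrioritizedEmbedding

/-- Conditional expectations for a random order that draws its elements successively with
probability proportional to `μ`: the first element lying in `S q` lies in the subset `T q`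
with probability `μ (T q) / μ (S q)`, so some order does at least as well on `w`-average. -/
lemma exists_list_find_mem {ι α : Type*} [Fintype ι] (μ : α → ℝ) (hμ : ∀ z, 0 < μ z)
    (w : ι → ℝ) (hw : ∀ q, 0 ≤ w q) (T S : ι → Finset α) (hTS : ∀ q, T q ⊆ S q)
    (U : Finset α) :
    ∃ L : List α,
      ∑ q, w q * ((∑ z ∈ U with z ∈ T q, μ z) / ∑ z ∈ U with z ∈ S q, μ z) ≤
        ∑ q, if ∃ z ∈ T q, L.find? (fun a => decide (a ∈ S q)) = some z then w q else 0 := by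
  induction U using Finset.strongInduction generalizing w with
  | H U ih =>
    rcases U.eq_empty_or_nonempty with rfl | hU
    · exact ⟨[], by simp⟩
    set ratio : ι → ℝ := fun q =>
      (∑ z ∈ U with z ∈ T q, μ z) / ∑ z ∈ U with z ∈ S q, μ z with hratio
    choose! L hL using fun z (hz : z ∈ U) => ih (U.erase z) (Finset.erase_ssubset hz)
      (fun q => if z ∈ S q then 0 else w q) (fun q => by split_ifs <;> simp [hw q])
    have hmul (q : ι) : ratio q * ∑ z ∈ U with z ∈ S q, μ z = ∑ z ∈ U with z ∈ T q, μ z := by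
      by_cases h0 : ∑ z ∈ U with z ∈ S q, μ z = 0
      · have hS := (Finset.sum_eq_zero_iff_of_nonneg fun z _ => (hμ z).le).1 h0
        rw [h0, mul_zero, Finset.sum_eq_zero]
        intro z hz
        rw [Finset.mem_filter] at hz
        exact hS z (Finset.mem_filter.2 ⟨hz.1, hTS q hz.2⟩)
      · exact div_mul_cancel₀ _ h0
    have hlower (z : α) (hz : z ∈ U) :
        ∑ q, w q * ((if z ∈ T q then 1 else 0) + if z ∈ S q then 0 else ratio q) ≤
          ∑ q, if ∃ y ∈ T q, (z :: L z).find? (fun a => decide (a ∈ S q)) = some y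
            then w q else 0 := by
      have hfilter {V : Finset α} (hzV : z ∉ V) :
          ∑ y ∈ U.erase z with y ∈ V, μ y = ∑ y ∈ U with y ∈ V, μ y := by
        refine Finset.sum_congr ?_ fun _ _ => rfl
        ext y
        simp only [Finset.mem_filter, Finset.mem_erase]
        refine ⟨fun h => ⟨h.1.2, h.2⟩, fun h => ⟨⟨?_, h.1⟩, h.2⟩⟩
        rintro rfl
        exact hzV h.2
      have hsplit : ∑ q, w q * ((if z ∈ T q then 1 else 0) + if z ∈ S q then 0 else ratio q) =
          (∑ q, if z ∈ T q then w q else 0) + ∑ q, (if z ∈ S q then 0 else w q) *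
            ((∑ y ∈ U.erase z with y ∈ T q, μ y) / ∑ y ∈ U.erase z with y ∈ S q, μ y) := by
        rw [← Finset.sum_add_distrib]
        refine Finset.sum_congr rfl fun q _ => ?_
        by_cases hzS : z ∈ S q
        · by_cases hzT : z ∈ T q <;> simp [hzS, hzT]
        · have hzT : z ∉ T q := fun h => hzS (hTS q h)
          simp [hzS, hzT, hratio, hfilter hzS, hfilter hzT]
      rw [hsplit]
      refine (add_le_add le_rfl (hL z hz)).trans ?_
      rw [← Finset.sum_add_distrib]
      refine Finset.sum_le_sum fun q _ => ?_
      by_cases hzS : z ∈ S q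
      · by_cases hzT : z ∈ T q <;> simp [hzS, hzT]
      · have hzT : z ∉ T q := fun h => hzS (hTS q h)
        simp [hzS, hzT]
    obtain ⟨z, hz, hle⟩ := Finset.exists_le_of_sum_le (s := U)
      (f := fun z => μ z * ∑ q, w q * ratio q)
      (g := fun z => μ z *
        ∑ q, w q * ((if z ∈ T q then 1 else 0) + if z ∈ S q then 0 else ratio q)) hU (by
        simp only [Finset.mul_sum]
        rw [Finset.sum_comm, Finset.sum_comm (s := U)]
        refine Finset.sum_le_sum fun q _ => le_of_eq ?_
        have h1 : ∑ z ∈ U, μ z = (∑ z ∈ U with z ∈ S q, μ z) + ∑ z ∈ U with z ∉ S q, μ z :=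
          (Finset.sum_filter_add_sum_filter_not _ _ _).symm
        have h2 : ∑ z ∈ U, μ z * (w q * ((if z ∈ T q then 1 else 0) +
              if z ∈ S q then 0 else ratio q)) =
            w q * ((∑ z ∈ U with z ∈ T q, μ z) + ratio q * ∑ z ∈ U with z ∉ S q, μ z) := by
          simp only [Finset.sum_filter, Finset.mul_sum, ← Finset.sum_add_distrib]
          refine Finset.sum_congr rfl fun z _ => ?_
          split_ifs <;> ring
        rw [h2, ← hmul q, ← Finset.sum_mul, h1]
        ring)
    exact ⟨z :: L z, (le_of_mul_le_mul_left hle (hμ z)).trans (hlower z hz)⟩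

lemma integral_shift_sub_le {φ : ℝ → ℝ} (hφ : Monotone φ) {Δ t : ℝ} (ht : 0 ≤ t) :
    ∫ r in Δ..(2 * Δ), (φ (r + t) - φ (r - t)) ≤ 2 * t * (φ (2 * Δ + t) - φ (Δ - t)) := by
  have hint (a b : ℝ) : IntervalIntegrable φ MeasureTheory.volume a b := hφ.intervalIntegrable
  have hadd : Monotone fun r => φ (r + t) := fun a b hab => hφ (by linarith)
  have hsub : Monotone fun r => φ (r - t) := fun a b hab => hφ (by linarith)
  rw [intervalIntegral.integral_sub hadd.intervalIntegrable hsub.intervalIntegrable,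
    intervalIntegral.integral_comp_add_right, intervalIntegral.integral_comp_sub_right,
    intervalIntegral.integral_interval_sub_interval_comm (hint _ _) (hint _ _) (hint _ _),
    intervalIntegral.integral_symm (Δ - t), intervalIntegral.integral_symm (2 * Δ - t)]
  have hupper : ∫ r in (2 * Δ - t)..(2 * Δ + t), φ r ≤ 2 * t * φ (2 * Δ + t) := by
    have h := intervalIntegral.integral_mono_on (a := 2 * Δ - t) (b := 2 * Δ + t) (by linarith)
      (hint _ _) (intervalIntegrable_const (c := φ (2 * Δ + t))) fun r hr => hφ hr.2
    rw [intervalIntegral.integral_const, smul_eq_mul] at h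
    linarith
  have hlower : 2 * t * φ (Δ - t) ≤ ∫ r in (Δ - t)..(Δ + t), φ r := by
    have h := intervalIntegral.integral_mono_on (a := Δ - t) (b := Δ + t) (by linarith)
      (intervalIntegrable_const (c := φ (Δ - t))) (hint _ _) fun r hr => hφ hr.1
    rw [intervalIntegral.integral_const, smul_eq_mul] at h
    linarith
  linarith

lemma exists_radius_sum_le {ι : Type*} [Fintype ι] (w : ι → ℝ) (hw : ∀ q, 0 ≤ w q)
    (φ : ι → ℝ → ℝ) (hφ : ∀ q, Monotone (φ q)) (t : ι → ℝ) (ht : ∀ q, 0 ≤ t q)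
    {Δ : ℝ} (hΔ : 0 < Δ)
    (h : ∀ q, 2 * t q * (φ q (2 * Δ + t q) - φ q (Δ - t q)) ≤ Δ / 4) :
    ∃ r ∈ Set.Icc Δ (2 * Δ),
      ∑ q, w q * (φ q (r + t q) - φ q (r - t q)) ≤ 1 / 2 * ∑ q, w q := by
  rcases (Finset.sum_nonneg fun q (_ : q ∈ Finset.univ) => hw q).eq_or_lt with h0 | hpos
  · refine ⟨Δ, ⟨le_rfl, by linarith⟩, ?_⟩
    have hzero := (Finset.sum_eq_zero_iff_of_nonneg fun q _ => hw q).1 h0.symm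
    simp [hzero _ (Finset.mem_univ _)]
  by_contra! hcon
  have hint (q : ι) : IntervalIntegrable
      (fun r => w q * (φ q (r + t q) - φ q (r - t q))) MeasureTheory.volume Δ (2 * Δ) := by
    have hadd : Monotone fun r => φ q (r + t q) := fun a b hab => hφ q (by linarith)
    have hsub : Monotone fun r => φ q (r - t q) := fun a b hab => hφ q (by linarith)
    exact (hadd.intervalIntegrable.sub hsub.intervalIntegrable).const_mul _
  have hsum : IntervalIntegrable (fun r => ∑ q, w q * (φ q (r + t q) - φ q (r - t q)))
      MeasureTheory.volume Δ (2 * Δ) := by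
    simpa [Finset.sum_fn] using IntervalIntegrable.sum Finset.univ fun q _ => hint q
  have hlow := intervalIntegral.integral_mono_on (a := Δ) (b := 2 * Δ) (by linarith)
    (intervalIntegrable_const (c := 1 / 2 * ∑ q, w q)) hsum fun r hr => (hcon r hr).le
  rw [intervalIntegral.integral_const, smul_eq_mul,
    intervalIntegral.integral_finsetSum fun q _ => hint q] at hlow
  have hup : ∑ q, ∫ r in Δ..(2 * Δ), w q * (φ q (r + t q) - φ q (r - t q)) ≤
      ∑ q, w q * (Δ / 4) := by
    refine Finset.sum_le_sum fun q _ => ?_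
    rw [intervalIntegral.integral_const_mul]
    exact mul_le_mul_of_nonneg_left ((integral_shift_sub_le (hφ q) (ht q)).trans (h q)) (hw q)
  rw [← Finset.sum_mul] at hup
  nlinarith

section Metric

variable {X : Type*} [MetricSpace X] [Fintype X]

/-- The logarithm of the `μ`-mass of the closed ball of radius `max r 0`. -/
noncomputable def logMass (μ : X → ℝ) (x : X) (r : ℝ) : ℝ :=
  Real.log (∑ z with dist x z ≤ max r 0, μ z)

variable {μ : X → ℝ}

lemma le_mass (hμ : ∀ z, 0 < μ z) (x : X) (r : ℝ) : μ x ≤ ∑ z with dist x z ≤ max r 0, μ z :=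
  Finset.single_le_sum (f := μ) (fun z _ => (hμ z).le) (by simp)

lemma mass_pos (hμ : ∀ z, 0 < μ z) (x : X) (r : ℝ) : 0 < ∑ z with dist x z ≤ max r 0, μ z :=
  (hμ x).trans_le (le_mass hμ x r)

lemma log_le_logMass (hμ : ∀ z, 0 < μ z) (x : X) (r : ℝ) : Real.log (μ x) ≤ logMass μ x r :=
  Real.log_le_log (hμ x) (le_mass hμ x r)

lemma logMass_le_log_sum (hμ : ∀ z, 0 < μ z) (x : X) (r : ℝ) : logMass μ x r ≤ Real.log (∑ z, μ z) :=
  Real.log_le_log (mass_pos hμ x r)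
    (Finset.sum_le_sum_of_subset_of_nonneg (Finset.filter_subset _ _) fun z _ _ => (hμ z).le)

lemma logMass_le_logMass (hμ : ∀ z, 0 < μ z) {x y : X} {r s : ℝ} (hr : 0 ≤ r) (h : r + dist x y ≤ s) :
    logMass μ x r ≤ logMass μ y s := by
  refine Real.log_le_log (mass_pos hμ x r)
    (Finset.sum_le_sum_of_subset_of_nonneg ?_ fun z _ _ => (hμ z).le)
  intro z hz
  simp only [Finset.mem_filter, Finset.mem_univ, true_and, max_eq_left hr] at hz ⊢
  have := dist_triangle y x z
  rw [dist_comm y x] at this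
  exact le_max_of_le_left (by linarith)

lemma logMass_mono (hμ : ∀ z, 0 < μ z) (x : X) : Monotone (logMass μ x) := by
  intro r s hrs
  refine Real.log_le_log (mass_pos hμ x r)
    (Finset.sum_le_sum_of_subset_of_nonneg ?_ fun z _ _ => (hμ z).le)
  intro z hz
  simp only [Finset.mem_filter, Finset.mem_univ, true_and] at hz ⊢
  exact hz.trans (max_le_max hrs le_rfl)

/-- A weighted padded decomposition with padding parameter governed by the local volume growth. -/
lemma exists_partition (hμ : ∀ z, 0 < μ z)
    {ι : Type*} [Fintype ι] (w : ι → ℝ) (hw : ∀ q, 0 ≤ w q)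
    (c : ι → X) (t : X → ℝ) {Δ : ℝ} (hΔ : 0 < Δ) (ht : ∀ x, 0 ≤ t x) (htΔ : ∀ x, t x ≤ Δ)
    (h : ∀ x, 2 * t x * (logMass μ x (2 * Δ + t x) - logMass μ x (Δ - t x)) ≤ Δ / 4) :
    ∃ (P : X → Option X) (G : Finset X),
      (∀ x ∈ G, (∀ y, dist x y ≤ t x → P y = P x) ∧ ∀ y, P y = P x → dist x y ≤ 4 * Δ) ∧
      1 / 2 * ∑ q, w q ≤ ∑ q, if c q ∈ G then w q else 0 := by
  obtain ⟨r, ⟨hr1, hr2⟩, hr⟩ := exists_radius_sum_le w hw (fun q => logMass μ (c q))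
    (fun q => logMass_mono hμ _) (fun q => t (c q)) (fun q => ht _) hΔ fun q => h _
  set T : X → Finset X := fun x => {z | dist x z ≤ max (r - t x) 0}
  set S : X → Finset X := fun x => {z | dist x z ≤ max (r + t x) 0}
  have hTS (x : X) : T x ⊆ S x := by
    intro z hz
    simp only [T, S, Finset.mem_filter, Finset.mem_univ, true_and] at hz ⊢
    exact hz.trans (max_le_max (by linarith [ht x]) le_rfl)
  obtain ⟨L, hL⟩ := exists_list_find_mem μ hμ w hw (fun q => T (c q)) (fun q => S (c q))
    (fun q => hTS _) Finset.univ
  set P : X → Option X := fun x => L.find? fun a => decide (dist x a ≤ r)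
  have hP {x z : X} (hz : z ∈ T x) (hfind : L.find? (fun a => decide (a ∈ S x)) = some z)
      {y : X} (hy : dist x y ≤ t x) : P y = some z := by
    rw [List.find?_eq_some_iff_append] at hfind ⊢
    obtain ⟨-, as, bs, hab, has⟩ := hfind
    simp only [T, Finset.mem_filter, Finset.mem_univ, true_and,
      max_eq_left (sub_nonneg.2 ((htΔ x).trans hr1))] at hz
    refine ⟨?_, as, bs, hab, fun a ha => ?_⟩
    · have := dist_triangle y x z
      rw [dist_comm y x] at this
      simp only [decide_eq_true_eq]
      linarith
    · have := has a ha
      simp only [S, Finset.mem_filter, Finset.mem_univ, true_and, Bool.not_eq_true',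
        decide_eq_false_iff_not, not_le] at this ⊢
      have h1 := lt_of_le_of_lt (le_max_left _ _) this
      have h2 := dist_triangle x y a
      linarith
  refine ⟨P, Finset.univ.filter fun x => ∃ z ∈ T x,
    L.find? (fun a => decide (a ∈ S x)) = some z, ?_, ?_⟩
  · intro x hx
    simp only [Finset.mem_filter, Finset.mem_univ, true_and] at hx
    obtain ⟨z, hz, hfind⟩ := hx
    have hx : P x = some z := hP hz hfind (by simpa using ht x)
    refine ⟨fun y hy => (hP hz hfind hy).trans hx.symm, fun y hy => ?_⟩
    have hxz := List.find?_some hx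
    have hyz := List.find?_some (hy.trans hx)
    simp only [decide_eq_true_eq] at hxz hyz
    linarith [dist_triangle_right x y z]
  · simp only [Finset.mem_filter, Finset.mem_univ, true_and] at hL ⊢
    refine le_trans ?_ hL
    have hterm : ∑ q, w q * (1 - (logMass μ (c q) (r + t (c q)) - logMass μ (c q) (r - t (c q)))) ≤
        ∑ q, w q * ((∑ z with z ∈ T (c q), μ z) / ∑ z with z ∈ S (c q), μ z) := by
      refine Finset.sum_le_sum fun q _ => mul_le_mul_of_nonneg_left ?_ (hw q)
      have hTpos := mass_pos hμ (c q) (r - t (c q))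
      have hSpos := mass_pos hμ (c q) (r + t (c q))
      have hlog := Real.log_le_sub_one_of_pos (div_pos hTpos hSpos)
      rw [Real.log_div hTpos.ne' hSpos.ne'] at hlog
      simp only [logMass, T, S, Finset.mem_filter, Finset.mem_univ, true_and]
      linarith
    simp only [mul_sub, mul_one, Finset.sum_sub_distrib] at hterm hr
    linarith

/-- At a single scale `Δ` there is a nonnegative function `h`, carried by a partition into
clusters, whose signed versions are locally Lipschitz with constant given by the local volume
growth, and which equals `Δ` on a `w`-large set of points with enough volume growth. -/
lemma exists_bump (hμ : ∀ z, 0 < μ z)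
    {ι : Type*} [Fintype ι] (w : ι → ℝ) (hw : ∀ q, 0 ≤ w q)
    (c : ι → X) {Δ : ℝ} (hΔ : 0 < Δ) :
    ∃ (P : X → Option X) (h : X → ℝ) (G : Finset X),
      (∀ z, 0 ≤ h z) ∧ (∀ z, h z ≤ Δ) ∧
      (∀ z z', dist z z' ≤ Δ / 8 → ∀ a b : ℝ, |a| = 1 → |b| = 1 → (P z = P z' → a = b) →
        |a * h z - b * h z'| ≤
          32 * (logMass μ z (16 * Δ) - logMass μ z (Δ / 4)) * dist z z') ∧
      (∀ x ∈ G, 1 / 2 ≤ logMass μ x (11 * Δ) - logMass μ x (Δ / 2) →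
        h x = Δ ∧ ∀ y, P y = P x → dist x y ≤ 4 * Δ) ∧
      1 / 2 * ∑ q, w q ≤ ∑ q, if c q ∈ G then w q else 0 := by
  set ρ : X → ℝ := fun x => logMass μ x (11 * Δ) - logMass μ x (Δ / 2) with hρ
  set t : X → ℝ := fun x => Δ / (16 * max (ρ x) (1 / 2)) with ht
  have hmax (x : X) : 1 / 2 ≤ max (ρ x) (1 / 2) := le_max_right _ _
  have ht0 (x : X) : 0 < t x := div_pos hΔ (by linarith [hmax x])
  have ht8 (x : X) : t x ≤ Δ / 8 :=
    div_le_div_of_nonneg_left hΔ.le (by norm_num) (by linarith [hmax x])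
  have htmul (x : X) : t x * (16 * max (ρ x) (1 / 2)) = Δ :=
    div_mul_cancel₀ _ (by linarith [hmax x])
  obtain ⟨P, G, hPG, hG⟩ := exists_partition hμ w hw c t hΔ (fun x => (ht0 x).le)
    (fun x => (ht8 x).trans (by linarith)) (by
      intro x
      have h1 : logMass μ x (2 * Δ + t x) - logMass μ x (Δ - t x) ≤ max (ρ x) (1 / 2) := by
        refine le_trans ?_ (le_max_left _ _)
        have := logMass_mono hμ x (show 2 * Δ + t x ≤ 11 * Δ by linarith [ht8 x])
        have := logMass_mono hμ x (show Δ / 2 ≤ Δ - t x by linarith [ht8 x])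
        simp only [hρ]
        linarith
      have h2 := mul_le_mul_of_nonneg_left h1 (ht0 x).le
      linarith [htmul x])
  set b : X → X → ℝ := fun z x =>
    if x ∈ G ∧ 1 / 2 ≤ ρ x then max 0 (Δ - 16 * ρ x * dist x z) else 0 with hb
  set h : X → ℝ := fun z => Finset.univ.sup' ⟨z, Finset.mem_univ z⟩ (b z) with hh
  have hle (z x : X) : b z x ≤ h z := Finset.le_sup' (b z) (Finset.mem_univ x)
  have hb0 (z x : X) : 0 ≤ b z x := by
    simp only [hb]
    split_ifs
    exacts [le_max_left _ _, le_rfl]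
  have hh0 (z : X) : 0 ≤ h z := (hb0 z z).trans (hle z z)
  have hbΔ (z x : X) : b z x ≤ Δ := by
    simp only [hb]
    split_ifs with hx
    · refine max_le hΔ.le ?_
      have : 0 ≤ 16 * ρ x * dist x z := mul_nonneg (by linarith [hx.2]) dist_nonneg
      linarith
    · exact hΔ.le
  have hhΔ (z : X) : h z ≤ Δ := Finset.sup'_le _ _ fun x _ => hbΔ z x
  have hattain (z : X) (hz : 0 < h z) : ∃ x ∈ G, 1 / 2 ≤ ρ x ∧ dist x z ≤ t x ∧
      t x * (16 * ρ x) = Δ ∧ h z = Δ - 16 * ρ x * dist x z := by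
    obtain ⟨x, -, hx⟩ := Finset.exists_mem_eq_sup' ⟨z, Finset.mem_univ z⟩ (b z)
    have hxz : h z = b z x := hx
    rw [hxz] at hz
    by_cases hG : x ∈ G ∧ 1 / 2 ≤ ρ x
    · have hbx : b z x = max 0 (Δ - 16 * ρ x * dist x z) := if_pos hG
      have hpos : 0 < Δ - 16 * ρ x * dist x z := by
        rw [hbx] at hz
        simpa using hz
      have htx : t x * (16 * ρ x) = Δ := by
        have := htmul x
        rwa [max_eq_left hG.2] at this
      refine ⟨x, hG.1, hG.2, ?_, htx, ?_⟩
      · by_contra! hcon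
        nlinarith [hG.2]
      · rw [hxz, hbx, max_eq_right hpos.le]
    · have hbx : b z x = 0 := if_neg hG
      exact absurd hz (by simp [hbx])
  have hstep (z z' : X) (R : ℝ) (hR : ∀ x, dist x z ≤ Δ / 8 → ρ x ≤ R) (hR0 : 0 ≤ R) :
      h z ≤ h z' + 16 * R * dist z z' ∧ (P z ≠ P z' → h z ≤ 16 * R * dist z z') := by
    rcases (hh0 z).eq_or_lt with hz | hz
    · have : 0 ≤ 16 * R * dist z z' := by positivity
      rw [← hz]
      exact ⟨add_nonneg (hh0 z') this, fun _ => this⟩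
    obtain ⟨x, hxG, hρx, hxt, htx, hhz⟩ := hattain z hz
    have hdist := dist_triangle x z z'
    have hRx : ρ x ≤ R := hR x (hxt.trans (ht8 x))
    have hmul : 16 * ρ x * dist x z' ≤ 16 * ρ x * dist x z + 16 * R * dist z z' := by
      have h1 := mul_le_mul_of_nonneg_left hdist (show 0 ≤ 16 * ρ x by linarith)
      have h2 := mul_le_mul_of_nonneg_right hRx (dist_nonneg (x := z) (y := z'))
      linarith
    constructor
    · have hbz : b z' x = max 0 (Δ - 16 * ρ x * dist x z') := if_pos ⟨hxG, hρx⟩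
      have := (le_max_right 0 (Δ - 16 * ρ x * dist x z')).trans (hbz.symm.le.trans (hle z' x))
      linarith
    · intro hne
      have hfar : t x < dist x z' := by
        by_contra! hcon
        exact hne (((hPG x hxG).1 z hxt).trans ((hPG x hxG).1 z' hcon).symm)
      nlinarith
  refine ⟨P, h, G, hh0, hhΔ, ?_, ?_, hG⟩
  · intro z z' hzz a a' ha ha' hP
    set R := logMass μ z (16 * Δ) - logMass μ z (Δ / 4) with hRdef
    have hR (x : X) (hx : dist x z ≤ Δ / 4) : ρ x ≤ R := by
      have h1 := logMass_le_logMass hμ (x := x) (y := z) (r := 11 * Δ) (s := 16 * Δ)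
        (by linarith) (by linarith)
      have h2 := logMass_le_logMass hμ (x := z) (y := x) (r := Δ / 4) (s := Δ / 2)
        (by linarith) (by rw [dist_comm]; linarith)
      simp only [hρ, hRdef]
      linarith
    have hR0 : 0 ≤ R := sub_nonneg.2 (logMass_mono hμ z (by linarith))
    obtain ⟨h1, h1'⟩ := hstep z z' R (fun x hx => hR x (by linarith)) hR0
    obtain ⟨h2, h2'⟩ := hstep z' z R (fun x hx => hR x (by
      have := dist_triangle x z' z
      rw [dist_comm z' z] at this
      linarith)) hR0
    rw [dist_comm z' z] at h2 h2'
    have hnn : 0 ≤ 16 * R * dist z z' := by positivity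
    by_cases hPz : P z = P z'
    · rw [← hP hPz, ← mul_sub, abs_mul, ha, one_mul, abs_le]
      constructor <;> linarith
    · refine (abs_sub _ _).trans ?_
      rw [abs_mul, abs_mul, ha, ha', one_mul, one_mul, abs_of_nonneg (hh0 z),
        abs_of_nonneg (hh0 z')]
      linarith [h1' hPz, h2' (Ne.symm hPz)]
  · intro x hx hρx
    refine ⟨le_antisymm (hhΔ x) ?_, (hPG x hx).2⟩
    have hbx : b x x = max 0 (Δ - 16 * ρ x * dist x x) := if_pos ⟨hx, hρx⟩
    rw [dist_self, mul_zero, sub_zero] at hbx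
    exact (le_max_right 0 Δ).trans (hbx.symm.le.trans (hle x x))

lemma half_le_growth_or (hμ : ∀ z, 0 < μ z) {x y : X} {Δ : ℝ} (hΔ : 0 < Δ) (h5 : 5 * Δ ≤ dist x y)
    (h10 : dist x y < 10 * Δ) :
    1 / 2 ≤ logMass μ x (11 * Δ) - logMass μ x (Δ / 2) ∨
      1 / 2 ≤ logMass μ y (11 * Δ) - logMass μ y (Δ / 2) := by
  wlog hle : logMass μ x (Δ / 2) ≤ logMass μ y (Δ / 2) generalizing x y
  · rw [dist_comm] at h5 h10
    exact (this h5 h10 (not_le.1 hle).le).symm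
  left
  have hmass := (Real.log_le_log_iff (mass_pos hμ x (Δ / 2)) (mass_pos hμ y (Δ / 2))).1 hle
  have hsum : (∑ z with dist x z ≤ max (Δ / 2) 0, μ z) +
      (∑ z with dist y z ≤ max (Δ / 2) 0, μ z) ≤ ∑ z with dist x z ≤ max (11 * Δ) 0, μ z := by
    rw [← Finset.sum_union]
    · refine Finset.sum_le_sum_of_subset_of_nonneg ?_ fun z _ _ => (hμ z).le
      intro z hz
      simp only [Finset.mem_union, Finset.mem_filter, Finset.mem_univ, true_and,
        max_eq_left (half_pos hΔ).le,
        max_eq_left (show 0 ≤ 11 * Δ by linarith)] at hz ⊢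
      rcases hz with hz | hz
      · linarith
      · linarith [dist_triangle x y z]
    · rw [Finset.disjoint_left]
      intro z hz hz'
      simp only [Finset.mem_filter, Finset.mem_univ, true_and,
        max_eq_left (half_pos hΔ).le] at hz hz'
      linarith [dist_triangle_right x y z]
  have hpos := mass_pos hμ x (Δ / 2)
  have hlog : Real.log (2 * ∑ z with dist x z ≤ max (Δ / 2) 0, μ z) ≤ logMass μ x (11 * Δ) :=
    Real.log_le_log (by linarith) (by linarith)
  rw [Real.log_mul two_ne_zero hpos.ne'] at hlog
  have := Real.log_two_gt_d9
  have hdef : logMass μ x (Δ / 2) = Real.log (∑ z with dist x z ≤ max (Δ / 2) 0, μ z) := rfl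
  linarith

lemma exists_sign {I Q : Type*} [Fintype I] [DecidableEq I] [Fintype Q]
    (w : Q → ℝ) (hw : ∀ q, 0 ≤ w q) (τ : Q → ℝ) (F : Q → (I → Bool) → ℝ) (G : Finset Q)
    (h : ∀ q ∈ G, ∃ a, ∀ s, 2 * τ q ≤ |F q s - F q (Function.update s a (!s a))|) :
    ∃ s, 1 / 2 * ∑ q ∈ G, w q ≤ ∑ q ∈ G, if τ q ≤ |F q s| then w q else 0 := by
  obtain ⟨s, -, hs⟩ := Finset.exists_le_of_sum_le (s := (Finset.univ : Finset (I → Bool)))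
    (f := fun _ => 1 / 2 * ∑ q ∈ G, w q)
    (g := fun s => ∑ q ∈ G, if τ q ≤ |F q s| then w q else 0) Finset.univ_nonempty (by
      simp only [Finset.mul_sum]
      rw [Finset.sum_comm, Finset.sum_comm (s := Finset.univ)]
      refine Finset.sum_le_sum fun q hq => ?_
      obtain ⟨a, ha⟩ := h q hq
      set flip : (I → Bool) → I → Bool := fun s => Function.update s a (!s a)
      have hinv : Function.Involutive flip := fun s => by simp [flip]
      have hflip : ∑ s, (if τ q ≤ |F q (flip s)| then w q else 0) =
          ∑ s, if τ q ≤ |F q s| then w q else 0 :=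
        Equiv.sum_comp (hinv.toPerm flip) fun s => if τ q ≤ |F q s| then w q else 0
      have hadd : ∑ _s : I → Bool, w q ≤ ∑ s, ((if τ q ≤ |F q s| then w q else 0) +
          if τ q ≤ |F q (flip s)| then w q else 0) := by
        refine Finset.sum_le_sum fun s _ => ?_
        have h1 := (ha s).trans (abs_sub _ _)
        have h2 := hw q
        change 2 * τ q ≤ |F q s| + |F q (flip s)| at h1
        split_ifs <;> linarith
      rw [Finset.sum_add_distrib, hflip] at hadd
      rw [← Finset.mul_sum]
      linarith)
  exact ⟨s, hs⟩

lemma sum_range_shift_sub (a : ℕ → ℝ) (K N : ℕ) :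
    ∑ i ∈ Finset.range N, (a (i + K) - a i) = ∑ j ∈ Finset.range K, (a (N + j) - a j) := by
  rw [Finset.sum_sub_distrib, Finset.sum_sub_distrib]
  have h1 := Finset.sum_range_add a N K
  have h2 := Finset.sum_range_add a K N
  rw [Nat.add_comm K N, h1] at h2
  simp only [Nat.add_comm K] at h2
  linarith

lemma sum_dyadic_below_le {δ D : ℝ} (hδ : 0 < δ) (hD : 0 ≤ D) (N : ℕ) :
    ∑ i ∈ Finset.range N, (if δ * 2 ^ i < D then 2 * (δ * 2 ^ i) else 0) ≤ 4 * D := by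
  suffices h : ∑ i ∈ Finset.range N, (if δ * 2 ^ i < D then 2 * (δ * 2 ^ i) else 0) ≤ 4 * D ∧
      ∑ i ∈ Finset.range N, (if δ * 2 ^ i < D then 2 * (δ * 2 ^ i) else 0) ≤ 2 * (δ * 2 ^ N) from
    h.1
  induction N with
  | zero => simp [hδ.le, hD]
  | succ N ih =>
    have : 0 < δ * 2 ^ N := by positivity
    rw [Finset.sum_range_succ, pow_succ]
    split_ifs with hlt
    · constructor <;> linarith
    · constructor <;> linarith

/-- A one-dimensional map that expands every point `z` by at most `O(log (μ X / μ z))` and is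
bounded below on a constant `w`-fraction of the pairs. -/
lemma exists_coordinate (hμ : ∀ z, 0 < μ z)
    {Q : Type*} [Fintype Q] (u v : Q → X) (huv : ∀ q, u q ≠ v q)
    (w : Q → ℝ) (hw : ∀ q, 0 ≤ w q) :
    ∃ f : X → ℝ,
      (∀ z z', |f z - f z'| ≤
        (192 * (Real.log (∑ y, μ y) - Real.log (μ z)) + 32) * dist z z') ∧
      1 / 4 * ∑ q, w q ≤
        ∑ q, if dist (u q) (v q) / 10 ≤ |f (u q) - f (v q)| then w q else 0 := by
  obtain ⟨δ, hδ, hδQ⟩ : ∃ δ : ℝ, 0 < δ ∧ ∀ q, 5 * δ ≤ dist (u q) (v q) := by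
    rcases isEmpty_or_nonempty Q with hQ | hQ
    · exact ⟨1, one_pos, fun q => hQ.elim q⟩
    · obtain ⟨q₀, hq₀⟩ := Finite.exists_min fun q => dist (u q) (v q)
      have := dist_pos.2 (huv q₀)
      exact ⟨dist (u q₀) (v q₀) / 5, by linarith, fun q => by linarith [hq₀ q]⟩
  have hscale (q : Q) : ∃ k : ℕ, 5 * (δ * 2 ^ k) ≤ dist (u q) (v q) ∧
      dist (u q) (v q) < 10 * (δ * 2 ^ k) := by
    obtain ⟨k, hk1, hk2⟩ := exists_nat_pow_near (x := dist (u q) (v q) / (5 * δ)) (y := 2)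
      ((one_le_div (by linarith)).2 (hδQ q)) one_lt_two
    rw [le_div_iff₀ (by linarith)] at hk1
    rw [div_lt_iff₀ (by linarith), pow_succ] at hk2
    exact ⟨k, by linarith, by linarith⟩
  choose k₀ hk₀ using hscale
  obtain ⟨N, hN⟩ : ∃ N, ∀ q, k₀ q < N :=
    ⟨Finset.univ.sup k₀ + 1, fun q => Nat.lt_succ_of_le (Finset.le_sup (Finset.mem_univ q))⟩
  set k : Q → Fin N := fun q => ⟨k₀ q, hN q⟩
  set Δ : Fin N → ℝ := fun i => δ * 2 ^ (i : ℕ) with hΔdef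
  have hΔ (i : Fin N) : 0 < Δ i := by positivity
  have hk5 (q : Q) : 5 * Δ (k q) ≤ dist (u q) (v q) := (hk₀ q).1
  have hk10 (q : Q) : dist (u q) (v q) < 10 * Δ (k q) := (hk₀ q).2
  have hend (q : Q) : ∃ x y : X, (x = u q ∧ y = v q ∨ x = v q ∧ y = u q) ∧
      1 / 2 ≤ logMass μ x (11 * Δ (k q)) - logMass μ x (Δ (k q) / 2) := by
    rcases half_le_growth_or hμ (hΔ _) (hk5 q) (hk10 q) with h | h
    · exact ⟨u q, v q, Or.inl ⟨rfl, rfl⟩, h⟩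
    · exact ⟨v q, u q, Or.inr ⟨rfl, rfl⟩, h⟩
  choose c c' hc hgrowth using hend
  choose P h G hh0 hhΔ hlip hgood hweight using fun i : Fin N =>
    exists_bump hμ (fun q => if k q = i then w q else 0)
      (fun q => by split_ifs <;> simp [hw q]) c (hΔ i)
  set sgn : Bool → ℝ := fun b => if b then 1 else -1 with hsgn
  have hsgn_abs (b : Bool) : |sgn b| = 1 := by cases b <;> simp [hsgn]
  have hsgn_flip (b : Bool) : |sgn b - sgn (!b)| = 2 := by cases b <;> norm_num [hsgn]
  set f : (Fin N × Option X → Bool) → X → ℝ := fun s x =>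
    ∑ i, sgn (s (i, P i x)) * h i x with hf
  set good : Finset Q := Finset.univ.filter fun q => c q ∈ G (k q) with hgooddef
  have hgood_weight : 1 / 2 * ∑ q, w q ≤ ∑ q ∈ good, w q := by
    have h1 := Finset.sum_le_sum fun i (_ : i ∈ (Finset.univ : Finset (Fin N))) => hweight i
    have h2 : ∑ i, ∑ q, (if k q = i then w q else 0) = ∑ q, w q := by
      rw [Finset.sum_comm]
      simp
    rw [← Finset.mul_sum, h2] at h1
    refine h1.trans (le_of_eq ?_)
    rw [hgooddef, Finset.sum_filter, Finset.sum_comm]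
    refine Finset.sum_congr rfl fun q _ => ?_
    rw [Finset.sum_eq_single (k q)]
    · simp
    · intro i _ hi
      simp [Ne.symm hi]
    · simp
  obtain ⟨s, hs⟩ := exists_sign w hw (fun q => Δ (k q))
    (fun q s => f s (u q) - f s (v q)) good (by
    intro q hq
    obtain ⟨hhc, hfar⟩ := hgood (k q) (c q) (Finset.mem_filter.1 hq).2 (hgrowth q)
    have hne : P (k q) (c' q) ≠ P (k q) (c q) := by
      intro heq
      have h1 := hfar _ heq
      have h2 := hk5 q
      have h3 : dist (c q) (c' q) = dist (u q) (v q) := by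
        rcases hc q with ⟨h1, h2⟩ | ⟨h1, h2⟩
        · rw [h1, h2]
        · rw [h1, h2, dist_comm]
      linarith [hΔ (k q)]
    refine ⟨(k q, P (k q) (c q)), fun s => ?_⟩
    set s' := Function.update s (k q, P (k q) (c q)) (!s (k q, P (k q) (c q))) with hs'
    have hother : f s' (c' q) = f s (c' q) := by
      simp only [hf]
      refine Finset.sum_congr rfl fun i _ => ?_
      rw [hs', Function.update_of_ne]
      intro heq
      obtain ⟨rfl, h2⟩ := Prod.mk.inj heq
      exact hne h2
    have hsame : |f s (c q) - f s' (c q)| = 2 * Δ (k q) := by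
      have : f s (c q) - f s' (c q) =
          (sgn (s (k q, P (k q) (c q))) - sgn (!s (k q, P (k q) (c q)))) * Δ (k q) := by
        simp only [hf]
        rw [← Finset.sum_sub_distrib, Finset.sum_eq_single (k q)]
        · rw [hs', Function.update_self, hhc]
          ring
        · intro i _ hi
          rw [hs', Function.update_of_ne, sub_self]
          intro heq
          exact hi (Prod.mk.inj heq).1
        · simp
      rw [this, abs_mul, hsgn_flip, abs_of_pos (hΔ _)]
    change 2 * Δ (k q) ≤ |f s (u q) - f s (v q) - (f s' (u q) - f s' (v q))|
    rcases hc q with ⟨h1, h2⟩ | ⟨h1, h2⟩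
    · rw [← h1, ← h2, hother, sub_sub_sub_cancel_right, hsame]
    · rw [← h1, ← h2, hother, sub_sub_sub_cancel_left, abs_sub_comm, hsame])
  refine ⟨f s, fun z z' => ?_, ?_⟩
  · have hterm (i : Fin N) : |sgn (s (i, P i z)) * h i z - sgn (s (i, P i z')) * h i z'| ≤
        32 * (logMass μ z (16 * Δ i) - logMass μ z (Δ i / 4)) * dist z z' +
          if Δ i < 8 * dist z z' then 2 * Δ i else 0 := by
      split_ifs with hlt
      · have h1 := abs_sub (sgn (s (i, P i z)) * h i z) (sgn (s (i, P i z')) * h i z')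
        rw [abs_mul, abs_mul, hsgn_abs, hsgn_abs, abs_of_nonneg (hh0 i z),
          abs_of_nonneg (hh0 i z')] at h1
        have h2 : 0 ≤ 32 * (logMass μ z (16 * Δ i) - logMass μ z (Δ i / 4)) * dist z z' := by
          have := logMass_mono hμ z (show Δ i / 4 ≤ 16 * Δ i by linarith [hΔ i])
          exact mul_nonneg (by linarith) dist_nonneg
        linarith [hhΔ i z, hhΔ i z']
      · rw [add_zero]
        refine hlip i z z' (by linarith) _ _ (hsgn_abs _) (hsgn_abs _) fun hP => ?_
        rw [hP]
    have hgrow : ∑ i, (logMass μ z (16 * Δ i) - logMass μ z (Δ i / 4)) ≤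
        6 * (Real.log (∑ y, μ y) - Real.log (μ z)) := by
      have h1 : ∑ i, (logMass μ z (16 * Δ i) - logMass μ z (Δ i / 4)) =
          ∑ i ∈ Finset.range N, (logMass μ z (δ * 2 ^ (i + 6) / 4) -
            logMass μ z (δ * 2 ^ i / 4)) := by
        rw [← Fin.sum_univ_eq_sum_range
          (fun i => logMass μ z (δ * 2 ^ (i + 6) / 4) - logMass μ z (δ * 2 ^ i / 4))]
        refine Finset.sum_congr rfl fun i _ => ?_
        have : 16 * Δ i = δ * 2 ^ ((i : ℕ) + 6) / 4 := by
          simp only [hΔdef, pow_add]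
          ring
        rw [this]
      rw [h1, sum_range_shift_sub (fun i => logMass μ z (δ * 2 ^ i / 4)) 6 N]
      refine (Finset.sum_le_card_nsmul _ _ _ fun j _ =>
        sub_le_sub (logMass_le_log_sum hμ z _) (log_le_logMass hμ z _)).trans_eq ?_
      simp
    have hsmall : ∑ i, (if Δ i < 8 * dist z z' then 2 * Δ i else 0) ≤ 4 * (8 * dist z z') := by
      refine le_trans (le_of_eq ?_) (sum_dyadic_below_le hδ
        (show 0 ≤ 8 * dist z z' by positivity) N)
      exact Fin.sum_univ_eq_sum_range
        (fun i => if δ * 2 ^ i < 8 * dist z z' then 2 * (δ * 2 ^ i) else 0) N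
    calc |f s z - f s z'| ≤ ∑ i, |sgn (s (i, P i z)) * h i z - sgn (s (i, P i z')) * h i z'| := by
          simp only [hf, ← Finset.sum_sub_distrib]
          exact Finset.abs_sum_le_sum_abs _ _
      _ ≤ ∑ i, (32 * (logMass μ z (16 * Δ i) - logMass μ z (Δ i / 4)) * dist z z' +
          if Δ i < 8 * dist z z' then 2 * Δ i else 0) := Finset.sum_le_sum fun i _ => hterm i
      _ = 32 * (∑ i, (logMass μ z (16 * Δ i) - logMass μ z (Δ i / 4))) * dist z z' +
          ∑ i, (if Δ i < 8 * dist z z' then 2 * Δ i else 0) := by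
          rw [Finset.sum_add_distrib, Finset.mul_sum, Finset.sum_mul]
      _ ≤ _ := by
          have := mul_le_mul_of_nonneg_right hgrow (dist_nonneg (x := z) (y := z'))
          linarith
  · have hmono : ∑ q ∈ good, (if Δ (k q) ≤ |f s (u q) - f s (v q)| then w q else 0) ≤
        ∑ q, if dist (u q) (v q) / 10 ≤ |f s (u q) - f s (v q)| then w q else 0 := by
      refine (Finset.sum_le_sum fun q _ => ?_).trans
        (Finset.sum_le_sum_of_subset_of_nonneg (Finset.subset_univ good) fun q _ _ => ?_)
      · have h1 := hk10 q
        have h2 := hw q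
        split_ifs <;> linarith
      · have h2 := hw q
        split_ifs <;> linarith
    linarith

end Metric

/-- Multiplicative weights: if for all weights some member of a family succeeds on a quarter of
the weight, then `m` members can be chosen such that most indices see many successes. -/
lemma exists_family {Y Q : Type*} [Fintype Q] (adm : Y → Prop) (succeeds : Y → Q → Prop)
    (h : ∀ w : Q → ℝ, (∀ q, 0 ≤ w q) →
      ∃ f, adm f ∧ 1 / 4 * ∑ q, w q ≤ ∑ q, if succeeds f q then w q else 0) (m : ℕ) :
    ∃ F : Fin m → Y, (∀ i, adm (F i)) ∧
      ∑ q, (1 / 2 : ℝ) ^ (Finset.univ.filter fun i => succeeds (F i) q).card ≤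
        (7 / 8) ^ m * Fintype.card Q := by
  induction m with
  | zero => exact ⟨fun i => i.elim0, fun i => i.elim0, by simp⟩
  | succ m ih =>
    obtain ⟨F, hF, hsum⟩ := ih
    obtain ⟨f, hf, hw⟩ := h
      (fun q => (1 / 2 : ℝ) ^ (Finset.univ.filter fun i => succeeds (F i) q).card)
      (fun q => by positivity)
    refine ⟨Fin.cons f F, fun i => Fin.cases hf hF i, ?_⟩
    have hstep : ∑ q, (1 / 2 : ℝ) ^
          (Finset.univ.filter fun i => succeeds ((Fin.cons f F : Fin (m + 1) → Y) i) q).card =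
        ∑ q, (1 / 2 : ℝ) ^ (Finset.univ.filter fun i => succeeds (F i) q).card - 1 / 2 *
          ∑ q, if succeeds f q then
            (1 / 2 : ℝ) ^ (Finset.univ.filter fun i => succeeds (F i) q).card else 0 := by
      rw [Finset.mul_sum, ← Finset.sum_sub_distrib]
      refine Finset.sum_congr rfl fun q _ => ?_
      rw [Fin.card_filter_univ_succ]
      simp only [Fin.cons_zero, Fin.cons_succ]
      split_ifs
      · rw [pow_succ]
        ring
      · ring
    rw [hstep, pow_succ]
    linarith

lemma norm_piLp_le {p : ℝ≥0∞} [Fact (1 ≤ p)] {m : ℕ} (hm : 0 < m)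
    (y : PiLp p fun _ : Fin m => ℝ) {a : ℝ} (hy : ∀ i, |y i| ≤ a) :
    ‖y‖ ≤ (m : ℝ) ^ (1 / p.toReal) * a := by
  have ha : 0 ≤ a := (abs_nonneg _).trans (hy ⟨0, hm⟩)
  rcases eq_or_ne p ∞ with rfl | hp
  · rw [PiLp.norm_eq_ciSup]
    simpa using Real.iSup_le hy ha
  have hp0 : 0 < p.toReal := ENNReal.toReal_pos
    (zero_lt_one.trans_le (Fact.out : 1 ≤ p)).ne' hp
  rw [PiLp.norm_eq_sum hp0]
  calc (∑ i, ‖y i‖ ^ p.toReal) ^ (1 / p.toReal)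
      ≤ (m * a ^ p.toReal) ^ (1 / p.toReal) := by
        refine Real.rpow_le_rpow (Finset.sum_nonneg fun i _ => by positivity) ?_ (by positivity)
        refine (Finset.sum_le_card_nsmul _ _ (a ^ p.toReal) fun i _ =>
          Real.rpow_le_rpow (norm_nonneg _) (hy i) hp0.le).trans_eq ?_
        simp
    _ = (m : ℝ) ^ (1 / p.toReal) * a := by
        rw [Real.mul_rpow (by positivity) (by positivity), ← Real.rpow_mul ha,
          mul_one_div_cancel hp0.ne', Real.rpow_one]

lemma le_norm_piLp {p : ℝ≥0∞} [Fact (1 ≤ p)] {m : ℕ} (hm : 0 < m)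
    (y : PiLp p fun _ : Fin m => ℝ) {a : ℝ} (ha : 0 ≤ a)
    (hy : m ≤ 8 * (Finset.univ.filter fun i => a ≤ |y i|).card) :
    (m : ℝ) ^ (1 / p.toReal) * a ≤ 8 * ‖y‖ := by
  rcases eq_or_ne p ∞ with rfl | hp
  · obtain ⟨i, hi⟩ := Finset.card_pos.1
      (show 0 < (Finset.univ.filter fun i => a ≤ |y i|).card by omega)
    have h1 := (Finset.mem_filter.1 hi).2
    have h2 := PiLp.norm_apply_le y i
    rw [Real.norm_eq_abs] at h2
    simp only [ENNReal.toReal_top, div_zero, Real.rpow_zero, one_mul]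
    linarith [norm_nonneg y]
  have hp1 : 1 ≤ p.toReal := by
    simpa using ENNReal.toReal_mono hp (Fact.out : 1 ≤ p)
  have hp0 : 0 < p.toReal := by linarith
  have hsum : (m : ℝ) / 8 * a ^ p.toReal ≤ ∑ i, ‖y i‖ ^ p.toReal := by
    have h1 : ((Finset.univ.filter fun i => a ≤ |y i|).card : ℝ) * a ^ p.toReal ≤
        ∑ i, ‖y i‖ ^ p.toReal := by
      rw [← nsmul_eq_mul]
      refine (Finset.card_nsmul_le_sum _ (fun i => ‖y i‖ ^ p.toReal) _ fun i hi => ?_).trans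
        (Finset.sum_le_sum_of_subset_of_nonneg (Finset.subset_univ _) fun i _ _ => by positivity)
      exact Real.rpow_le_rpow ha (Finset.mem_filter.1 hi).2 hp0.le
    have h2 : (m : ℝ) ≤ 8 * ((Finset.univ.filter fun i => a ≤ |y i|).card : ℝ) := by
      exact_mod_cast hy
    refine le_trans (mul_le_mul_of_nonneg_right ?_ (by positivity)) h1
    linarith
  rw [PiLp.norm_eq_sum hp0]
  have h1 := Real.rpow_le_rpow (by positivity) hsum (show 0 ≤ 1 / p.toReal by positivity)
  rw [Real.mul_rpow (by positivity) (by positivity), ← Real.rpow_mul ha,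
    mul_one_div_cancel hp0.ne', Real.rpow_one, Real.div_rpow (by positivity) (by norm_num)] at h1
  have h2 : (8 : ℝ) ^ (1 / p.toReal) ≤ 8 := by
    have := Real.rpow_le_rpow_of_exponent_le (show (1 : ℝ) ≤ 8 by norm_num)
      ((div_le_one hp0).2 hp1)
    rwa [Real.rpow_one] at this
  have h3 : (m : ℝ) ^ (1 / p.toReal) / 8 ≤ (m : ℝ) ^ (1 / p.toReal) / 8 ^ (1 / p.toReal) :=
    div_le_div_of_nonneg_left (by positivity) (by positivity) h2
  have h4 := mul_le_mul_of_nonneg_right h3 ha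
  linarith

/-- Maps succeeding on a constant fraction of every weighted set of pairs combine into a
non-contractive embedding of dimension `O(log n)`. -/
lemma exists_embedding (p : ℝ≥0∞) [Fact (1 ≤ p)] {X : Type*} [MetricSpace X] [Fintype X]
    (hX : 2 ≤ Fintype.card X) (K : X → ℝ)
    (h : ∀ w : {q : X × X // q.1 ≠ q.2} → ℝ, (∀ q, 0 ≤ w q) → ∃ f : X → ℝ,
      (∀ z z', |f z - f z'| ≤ K z * dist z z') ∧ 1 / 4 * ∑ q, w q ≤
        ∑ q, if dist q.1.1 q.1.2 / 10 ≤ |f q.1.1 - f q.1.2| then w q else 0) :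
    ∃ (m : ℕ) (f : X → PiLp p (fun _ : Fin m => ℝ)),
      (m : ℝ) ≤ 64 * Real.logb 2 (Fintype.card X) ∧
      (∀ x y : X, dist x y ≤ dist (f x) (f y)) ∧
      ∀ x y : X, dist (f x) (f y) ≤ 80 * K x * dist x y := by
  set n := Fintype.card X with hn
  set k := Nat.clog 2 n with hk
  have hk0 : 0 < k := Nat.clog_pos one_lt_two hX
  have hm : 0 < 32 * k := by omega
  obtain ⟨F, hF, hsum⟩ := exists_family _ _ h (32 * k)
  set A : ℝ := ((32 * k : ℕ) : ℝ) ^ (1 / p.toReal) with hA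
  have hA0 : 0 < A := Real.rpow_pos_of_pos (by exact_mod_cast hm) _
  have hcoord (x y : X) (i : Fin (32 * k)) :
      |(WithLp.toLp p (fun i => 80 / A * F i x) - WithLp.toLp p (fun i => 80 / A * F i y) :
        PiLp p fun _ : Fin (32 * k) => ℝ) i| = 80 / A * |F i x - F i y| := by
    simp only [PiLp.sub_apply]
    rw [← mul_sub, abs_mul, abs_of_pos (by positivity)]
  refine ⟨32 * k, fun x => WithLp.toLp p fun i => 80 / A * F i x, ?_, fun x y => ?_,
    fun x y => ?_⟩
  · have hlog1 : 1 ≤ Real.logb 2 n := by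
      rw [Real.le_logb_iff_rpow_le one_lt_two (by positivity)]
      simpa using (by exact_mod_cast hX : (2 : ℝ) ≤ n)
    have hlog2 : ((k - 1 : ℕ) : ℝ) ≤ Real.logb 2 n := by
      rw [Real.le_logb_iff_rpow_le one_lt_two (by positivity), Real.rpow_natCast]
      exact_mod_cast (Nat.pow_pred_clog_lt_self one_lt_two hX).le
    rw [Nat.cast_sub hk0] at hlog2
    push_cast at hlog2 ⊢
    linarith
  · rcases eq_or_ne x y with rfl | hxy
    · simp
    have hcnt : 4 * k ≤ (Finset.univ.filter fun i => dist x y / 10 ≤ |F i x - F i y|).card := by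
      by_contra! hlt
      have h1 := (Finset.single_le_sum (f := fun q : {q : X × X // q.1 ≠ q.2} => (1 / 2 : ℝ) ^
        (Finset.univ.filter fun i =>
          dist q.1.1 q.1.2 / 10 ≤ |F i q.1.1 - F i q.1.2|).card)
        (fun q _ => by positivity) (Finset.mem_univ ⟨(x, y), hxy⟩)).trans hsum
      have h2 : (1 / 2 : ℝ) ^ (4 * k) ≤
          (1 / 2 : ℝ) ^ (Finset.univ.filter fun i => dist x y / 10 ≤ |F i x - F i y|).card :=
        pow_le_pow_of_le_one (by norm_num) (by norm_num) hlt.le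
      have h3 : (Fintype.card {q : X × X // q.1 ≠ q.2} : ℝ) ≤ 4 ^ k := by
        have h4 : Fintype.card {q : X × X // q.1 ≠ q.2} ≤ n * n := by
          refine (Fintype.card_subtype_le _).trans_eq ?_
          rw [Fintype.card_prod]
        have h5 : n ≤ 2 ^ k := Nat.le_pow_clog one_lt_two n
        have h6 : n * n ≤ 4 ^ k := by
          calc n * n ≤ 2 ^ k * 2 ^ k := Nat.mul_le_mul h5 h5
            _ = 4 ^ k := by rw [← mul_pow]; norm_num
        exact_mod_cast h4.trans h6
      have h4 : (1 / 16 : ℝ) ^ k ≤ ((7 / 8) ^ 32 * 4) ^ k := by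
        calc (1 / 16 : ℝ) ^ k = (1 / 2) ^ (4 * k) := by rw [pow_mul]; norm_num
          _ ≤ (7 / 8) ^ (32 * k) * 4 ^ k :=
            (h2.trans h1).trans (mul_le_mul_of_nonneg_left h3 (by positivity))
          _ = ((7 / 8) ^ 32 * 4) ^ k := by rw [mul_pow, pow_mul]
      have h5 : ((7 / 8 : ℝ) ^ 32 * 4) ^ k < (1 / 16) ^ k :=
        pow_lt_pow_left₀ (by norm_num) (by norm_num) hk0.ne'
      linarith
    rw [dist_eq_norm]
    have h1 := le_norm_piLp hm (WithLp.toLp p (fun i => 80 / A * F i x) -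
        WithLp.toLp p (fun i => 80 / A * F i y) : PiLp p fun _ : Fin (32 * k) => ℝ)
      (a := 80 / A * (dist x y / 10)) (by positivity) (by
        simp only [hcoord, mul_le_mul_iff_right₀ (show 0 < 80 / A by positivity)]
        omega)
    have h2 : A * (80 / A * (dist x y / 10)) = 8 * dist x y := by
      field_simp
      ring
    rw [← hA, h2] at h1
    linarith
  · rw [dist_eq_norm]
    refine (norm_piLp_le hm _ (a := 80 / A * (K x * dist x y)) fun i => ?_).trans_eq ?_
    · rw [hcoord]
      exact mul_le_mul_of_nonneg_left (hF i x y) (by positivity)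
    · rw [← hA]
      field_simp

lemma sum_inv_sq_le (n : ℕ) : ∑ i ∈ Finset.range n, (1 / ((i : ℝ) + 1) ^ 2) ≤ 2 := by
  suffices h : ∑ i ∈ Finset.range (n + 1), (1 / ((i : ℝ) + 1) ^ 2) ≤ 2 - 1 / ((n : ℝ) + 1) by
    refine (Finset.sum_le_sum_of_subset_of_nonneg
      (Finset.range_subset_range.2 (Nat.le_succ n)) fun i _ _ => by positivity).trans (h.trans ?_)
    have : 0 < 1 / ((n : ℝ) + 1) := by positivity
    linarith
  induction n with
  | zero => norm_num
  | succ n ih =>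
    rw [Finset.sum_range_succ]
    have : 1 / (((n + 1 : ℕ) : ℝ) + 1) ^ 2 ≤ 1 / ((n : ℝ) + 1) - 1 / (((n + 1 : ℕ) : ℝ) + 1) := by
      push_cast
      rw [div_sub_div _ _ (by positivity) (by positivity),
        div_le_div_iff₀ (by positivity) (by positivity)]
      have : (0 : ℝ) ≤ n := n.cast_nonneg
      nlinarith
    linarith

end PrioritizedEmbedding

/-- There is a universal constant `C > 0` such that every finite metric
space `X` on `n ≥ 2` points with a priority ranking `π` embeds non-contractively into
`ℓ_p^m` (for any `1 ≤ p ≤ ∞`) with dimension `m ≤ C·log₂ n` and prioritized distortion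
`C·(1 + log₂(j+1))` for the pair of ranks `j < i`. -/
theorem stmt11 :
    ∃ C : ℝ, 0 < C ∧
      ∀ (p : ℝ≥0∞) [Fact (1 ≤ p)] (X : Type) [MetricSpace X] [Fintype X],
        2 ≤ Fintype.card X →
        ∀ π : Fin (Fintype.card X) ≃ X,
          ∃ (m : ℕ) (f : X → PiLp p (fun _ : Fin m => ℝ)),
            (m : ℝ) ≤ C * Real.logb 2 (Fintype.card X : ℝ) ∧
            (∀ x y : X, dist x y ≤ dist (f x) (f y)) ∧
            ∀ j i : Fin (Fintype.card X), j < i →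
              dist (f (π j)) (f (π i)) ≤
                C * (1 + Real.logb 2 (((j : ℕ) : ℝ) + 1 + 1)) * dist (π j) (π i) := by
  refine ⟨30720, by norm_num, fun p _ X _ _ hX π => ?_⟩
  set μ : X → ℝ := fun x => 1 / (((π.symm x : ℕ) : ℝ) + 1) ^ 2 with hμdef
  have hμ (x : X) : 0 < μ x := by positivity
  obtain ⟨m, f, hm, hlow, hup⟩ := PrioritizedEmbedding.exists_embedding p hX
    (fun z => 192 * (Real.log (∑ y, μ y) - Real.log (μ z)) + 32) fun w hw =>
      PrioritizedEmbedding.exists_coordinate hμ (fun q => q.1.1) (fun q => q.1.2)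
        (fun q => q.2) w hw
  have hlogX : 0 ≤ Real.logb 2 (Fintype.card X : ℝ) :=
    Real.logb_nonneg one_lt_two (by exact_mod_cast (one_le_two.trans hX))
  refine ⟨m, f, by linarith, hlow, fun j i _ => (hup _ _).trans ?_⟩
  refine mul_le_mul_of_nonneg_right ?_ dist_nonneg
  have hj : (0 : ℝ) ≤ (j : ℕ) := Nat.cast_nonneg _
  have hsum : ∑ y, μ y ≤ 2 := by
    rw [← Equiv.sum_comp π]
    simp only [hμdef, Equiv.symm_apply_apply]
    rw [Fin.sum_univ_eq_sum_range (fun i => 1 / ((i : ℝ) + 1) ^ 2)]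
    exact PrioritizedEmbedding.sum_inv_sq_le _
  have hpos : 0 < ∑ y, μ y := (hμ (π j)).trans_le
    (Finset.single_le_sum (fun y _ => (hμ y).le) (Finset.mem_univ _))
  have hlogsum : Real.log (∑ y, μ y) ≤ 1 := by
    have := Real.log_le_log hpos hsum
    linarith [Real.log_two_lt_d9]
  have hlogμ : Real.log (μ (π j)) = -(2 * Real.log (((j : ℕ) : ℝ) + 1)) := by
    simp only [hμdef, Equiv.symm_apply_apply, one_div, Real.log_inv, Real.log_pow]
    norm_num
  have hlogj : Real.log (((j : ℕ) : ℝ) + 1) ≤ Real.logb 2 (((j : ℕ) : ℝ) + 1 + 1) := by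
    refine (Real.log_le_log (by linarith) (show ((j : ℕ) : ℝ) + 1 ≤ (j : ℕ) + 1 + 1 by
      linarith)).trans ?_
    rw [Real.logb, le_div_iff₀ (Real.log_pos one_lt_two)]
    refine mul_le_of_le_one_right (Real.log_nonneg (by linarith)) ?_
    linarith [Real.log_two_lt_d9]
  rw [hlogμ]
  linarith
end

section
/- Let (X,d_X), (Y,d_Y), (Z,d_Z) be finite metric spaces, let f : X → Y be a non-contractive bijection with scaling distortion α, and let g : Y → Z be a non-contractive map with scaling distortion β (where α, β : (0,1) → ℝ≥0). Then the composition g∘f : X → Z has scaling distortion ε ↦ α(ε/2)·β(ε/2). -/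
open Finset

attribute [local instance] Classical.propDecidable

/-- Ordered pairs of distinct points of `X` whose distortion under `f` is at most `t`. -/
noncomputable def goodPairsMet {X Y : Type} [MetricSpace X] [MetricSpace Y] [Fintype X]
    (f : X → Y) (t : ℝ) : Finset (X × X) :=
  Finset.univ.offDiag.filter (fun p => dist (f p.1) (f p.2) ≤ t * dist p.1 p.2)

/-- `f` has scaling distortion `γ`: for every `ε ∈ (0,1)`, at least a `(1-ε)` fraction of
the pairs of distinct points have distortion at most `γ ε` (counted over ordered pairs:
`n·(n-1) = 2·(n choose 2)`). -/
def HasScalingMet {X Y : Type} [MetricSpace X] [MetricSpace Y] [Fintype X]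
    (f : X → Y) (γ : ℝ → ℝ) : Prop :=
  ∀ ε : ℝ, 0 < ε → ε < 1 →
    (1 - ε) * ((Fintype.card X : ℝ) * ((Fintype.card X : ℝ) - 1)) ≤
      ((goodPairsMet f (γ ε)).card : ℝ)

theorem mem_goodPairsMet {X Y : Type} [MetricSpace X] [MetricSpace Y] [Fintype X]
    {f : X → Y} {t : ℝ} {p : X × X} :
    p ∈ goodPairsMet f t ↔ p.1 ≠ p.2 ∧ dist (f p.1) (f p.2) ≤ t * dist p.1 p.2 := by
  simp [goodPairsMet]

/-- Inclusion–exclusion for sets of ordered pairs of distinct points. -/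
theorem card_add_card_le_card_inter_add {X : Type*} [Fintype X] [DecidableEq X]
    {A B : Finset (X × X)} (hA : ∀ p ∈ A, p.1 ≠ p.2) (hB : ∀ p ∈ B, p.1 ≠ p.2) :
    (A.card : ℝ) + B.card ≤
      (A ∩ B).card + (Fintype.card X : ℝ) * ((Fintype.card X : ℝ) - 1) := by
  have hsub : A ∪ B ⊆ (Finset.univ : Finset X).offDiag := by
    intro p hp
    rcases Finset.mem_union.1 hp with h | h
    · simpa using hA p h
    · simpa using hB p h
  have hle := Finset.card_le_card hsub
  rw [Finset.offDiag_card, Finset.card_univ] at hle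
  have hcast : ((A ∪ B).card : ℝ) ≤ (Fintype.card X : ℝ) * ((Fintype.card X : ℝ) - 1) := by
    calc ((A ∪ B).card : ℝ)
        ≤ ((Fintype.card X * Fintype.card X - Fintype.card X : ℕ) : ℝ) := by exact_mod_cast hle
      _ = _ := by
        rw [Nat.cast_sub (Nat.le_mul_self _)]
        push_cast
        ring
  have hadd : ((A ∪ B).card : ℝ) + (A ∩ B).card = A.card + B.card := by
    exact_mod_cast Finset.card_union_add_card_inter A B
  linarith

/-- (Composition.) If `f : X → Y` is a non-contractive bijection with
scaling distortion `α` and `g : Y → Z` is non-contractive with scaling distortion `β`,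
then `g ∘ f` has scaling distortion `ε ↦ α(ε/2)·β(ε/2)`. -/
theorem stmt12 (X Y Z : Type) [MetricSpace X] [MetricSpace Y] [MetricSpace Z]
    [Fintype X] [Fintype Y] [Fintype Z]
    (f : X → Y) (g : Y → Z) (α β : ℝ → ℝ)
    (hαpos : ∀ ε ∈ Set.Ioo (0 : ℝ) 1, 0 ≤ α ε) (hβpos : ∀ ε ∈ Set.Ioo (0 : ℝ) 1, 0 ≤ β ε)
    (hf : Function.Bijective f)
    (hfnc : ∀ x y : X, dist x y ≤ dist (f x) (f y))
    (hgnc : ∀ x y : Y, dist x y ≤ dist (g x) (g y))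
    (hα : HasScalingMet f α) (hβ : HasScalingMet g β) :
    HasScalingMet (g ∘ f) (fun ε => α (ε / 2) * β (ε / 2)) := by
  intro ε hε0 hε1
  have hA := hα (ε / 2) (by linarith) (by linarith)
  have hB := hβ (ε / 2) (by linarith) (by linarith)
  have hβ0 := hβpos (ε / 2) ⟨by linarith, by linarith⟩
  rw [← Fintype.card_of_bijective hf] at hB
  set A := goodPairsMet f (α (ε / 2)) with hAdef
  set B := (goodPairsMet g (β (ε / 2))).preimage (Prod.map f f)
    (hf.injective.prodMap hf.injective).injOn with hBdef
  have hmemB : ∀ p, p ∈ B ↔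
      f p.1 ≠ f p.2 ∧ dist (g (f p.1)) (g (f p.2)) ≤ β (ε / 2) * dist (f p.1) (f p.2) := by
    intro p
    simp [hBdef, mem_goodPairsMet]
  have hcardB : (goodPairsMet g (β (ε / 2))).card ≤ B.card := by
    refine Finset.card_le_card_of_surjOn (Prod.map f f) fun q hq => ?_
    obtain ⟨p, rfl⟩ := hf.surjective.prodMap hf.surjective q
    exact ⟨p, by simpa [hBdef] using hq, rfl⟩
  have hcardB' : ((goodPairsMet g (β (ε / 2))).card : ℝ) ≤ B.card := by exact_mod_cast hcardB
  have hinter := card_add_card_le_card_inter_add (A := A) (B := B)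
    (fun p hp => (mem_goodPairsMet.1 hp).1)
    (fun p hp h => ((hmemB p).1 hp).1 (congrArg f h))
  have hsub : A ∩ B ⊆ goodPairsMet (g ∘ f) (α (ε / 2) * β (ε / 2)) := by
    intro p hp
    obtain ⟨hpA, hpB⟩ := Finset.mem_inter.1 hp
    obtain ⟨hne, hdist⟩ := mem_goodPairsMet.1 hpA
    refine mem_goodPairsMet.2 ⟨hne, ?_⟩
    calc dist (g (f p.1)) (g (f p.2)) ≤ β (ε / 2) * dist (f p.1) (f p.2) := ((hmemB p).1 hpB).2
      _ ≤ β (ε / 2) * (α (ε / 2) * dist p.1 p.2) := mul_le_mul_of_nonneg_left hdist hβ0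
      _ = α (ε / 2) * β (ε / 2) * dist p.1 p.2 := by ring
  have hle : ((A ∩ B).card : ℝ) ≤
      (goodPairsMet (g ∘ f) (α (ε / 2) * β (ε / 2))).card := by
    exact_mod_cast Finset.card_le_card hsub
  linarith
end
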